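/- There exist absolute constants c₀, c, C > 0 such that the following holds for all sufficiently large N. Set Q := exp((log N)^{1/10}). Suppose that no primitive real (quadratic) Dirichlet character χ of conductor q < Q has a real zero β of its Dirichlet L-function L(s, χ) with 1 − c₀/log Q < β < 1. Then for every arithmetic progression P ⊆ {1, …, N} one has both |∑_{n ∈ P} μ(n)| ≤ C·N·exp(−c·(log N)^{1/10}) and |∑_{n ∈ P} (Λ(n) − Λ_{Cramér,Q}(n))| ≤ C·N·exp(−c·(log N)^{1/10}), where μ is the Möbius function and Λ is the von Mangoldt function. -/

import Mathlib

open scoped Classical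

noncomputable section

/-- The Cramér model `Λ_{Cramér,w}(n) = ∏_{p < w, p prime} (p/(p-1))·1_{p ∤ n}`. -/
def cramer (w : ℝ) (n : ℤ) : ℝ :=
  ∏ p ∈ (Finset.range (⌈w⌉₊ + 1)).filter fun p => Nat.Prime p ∧ (p : ℝ) < w,
    if (p : ℤ) ∣ n then 0 else (p : ℝ) / ((p : ℝ) - 1)

/-- The quantity `Q = exp((log N)^{1/10})`. -/
def Qparam (N : ℝ) : ℝ := Real.exp (Real.log N ^ ((1 : ℝ) / 10))

/-- The arithmetic progression `{n : N'' < n ≤ N', n ≡ a (mod m)}` as a finite set. -/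
def progFinset (N'' N' : ℝ) (a m : ℕ) : Finset ℕ :=
  (Finset.range (⌊N'⌋₊ + 1)).filter fun n => N'' < (n : ℝ) ∧ (n : ℝ) ≤ N' ∧ n % m = a % m

end

set_option linter.all false


lemma esz_cpow_sub (s : ℂ) (hs : 0 ≤ s.re) (a x y : ℝ) (ha : 0 < a) (hx : a ≤ x) (hy : a ≤ y) :
    ‖(x : ℂ) ^ (-s) - (y : ℂ) ^ (-s)‖ ≤ ‖s‖ * a ^ (-s.re - 1) * |x - y| := by
  have hd : ∀ u ∈ Set.Ici a, HasDerivWithinAt (fun u : ℝ => (u : ℂ) ^ (-s))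
      (-s * (u : ℂ) ^ (-s - 1)) (Set.Ici a) u := by
    intro u hu
    have hu0 : 0 < u := lt_of_lt_of_le ha hu
    have h1 : HasDerivAt (fun z : ℂ => z ^ (-s)) (-s * (u : ℂ) ^ (-s - 1)) (u : ℂ) := by
      have := (hasDerivAt_id (u : ℂ)).cpow_const (c := -s) (by
        left; simpa using hu0)
      simpa using this
    exact h1.comp_ofReal.hasDerivWithinAt
  have hb : ∀ u ∈ Set.Ici a, ‖-s * (u : ℂ) ^ (-s - 1)‖ ≤ ‖s‖ * a ^ (-s.re - 1) := by
    intro u hu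
    have hu0 : 0 < u := lt_of_lt_of_le ha hu
    rw [norm_mul, norm_neg, Complex.norm_cpow_eq_rpow_re_of_pos hu0]
    gcongr
    have : (-s - 1).re = -s.re - 1 := by simp
    rw [this]
    exact Real.rpow_le_rpow_of_nonpos ha hu (by linarith)
  have := (convex_Ici a).norm_image_sub_le_of_norm_hasDerivWithin_le hd hb hy hx
  simpa using this

lemma esz_T_bound (s : ℂ) (hs : 0 ≤ s.re) (a : ℝ) (ha : 0 < a) :
    ‖(s - 1) * (a : ℂ) ^ (-s) + ((a + 1 : ℝ) : ℂ) ^ (1 - s) - (a : ℂ) ^ (1 - s)‖ ≤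
      ‖s - 1‖ * (‖s‖ * a ^ (-s.re - 1)) := by
  have hd : ∀ u ∈ Set.Icc a (a + 1), HasDerivWithinAt
      (fun u : ℝ => (u : ℂ) ^ (1 - s) + (s - 1) * (a : ℂ) ^ (-s) * (u : ℂ))
      ((1 - s) * (u : ℂ) ^ (-s) + (s - 1) * (a : ℂ) ^ (-s)) (Set.Icc a (a + 1)) u := by
    intro u hu
    have hu0 : 0 < u := lt_of_lt_of_le ha hu.1
    have h1 : HasDerivAt (fun z : ℂ => z ^ (1 - s)) ((1 - s) * (u : ℂ) ^ (-s)) (u : ℂ) := by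
      have := (hasDerivAt_id (u : ℂ)).cpow_const (c := 1 - s) (by
        left; simpa using hu0)
      have e : 1 - s - 1 = -s := by ring
      simpa [e] using this
    have h2 : HasDerivAt (fun z : ℂ => (s - 1) * (a : ℂ) ^ (-s) * z)
        ((s - 1) * (a : ℂ) ^ (-s)) (u : ℂ) := by
      simpa using (hasDerivAt_id (u : ℂ)).const_mul ((s - 1) * (a : ℂ) ^ (-s))
    exact (h1.add h2).comp_ofReal.hasDerivWithinAt
  have hb : ∀ u ∈ Set.Icc a (a + 1),
      ‖(1 - s) * (u : ℂ) ^ (-s) + (s - 1) * (a : ℂ) ^ (-s)‖ ≤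
        ‖s - 1‖ * (‖s‖ * a ^ (-s.re - 1)) := by
    intro u hu
    have e : (1 - s) * (u : ℂ) ^ (-s) + (s - 1) * (a : ℂ) ^ (-s)
        = (s - 1) * ((a : ℂ) ^ (-s) - (u : ℂ) ^ (-s)) := by ring
    rw [e, norm_mul]
    gcongr
    have := esz_cpow_sub s hs a a u ha le_rfl hu.1
    refine this.trans ?_
    have h3 : |a - u| ≤ 1 := by rw [abs_le]; constructor <;> linarith [hu.1, hu.2]
    calc _ ≤ ‖s‖ * a ^ (-s.re - 1) * 1 := by gcongr
      _ = _ := by ring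
  have := (convex_Icc a (a + 1)).norm_image_sub_le_of_norm_hasDerivWithin_le hd hb
    (show a ∈ Set.Icc a (a + 1) by simp) (show a + 1 ∈ Set.Icc a (a + 1) by simp)
  have e2 : ‖a + 1 - a‖ = 1 := by simp
  rw [e2, mul_one] at this
  refine le_trans (le_of_eq ?_) this
  congr 1
  push_cast
  ring

/-- identity theorem for series on `Re > 1/4`. -/
lemma esz_ident (g : ℂ → ℂ) (hg : Differentiable ℂ g) (t : ℕ → ℂ → ℂ)
    (ht : ∀ n, Differentiable ℂ (t n)) (K : ℝ) (hK : 0 ≤ K)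
    (hb : ∀ n s, 1 / 4 < s.re → ‖t n s‖ ≤ K * (‖s‖ + 1) ^ 2 * ((n : ℝ) + 1) ^ (-(5 / 4) : ℝ))
    (heq : ∀ s : ℂ, 1 < s.re → Filter.Tendsto (fun M => ∑ n ∈ Finset.range M, t n s)
      Filter.atTop (nhds (g s))) (s : ℂ) (hs : 1 / 4 < s.re) :
    HasSum (fun n => t n s) (g s) := by
  have hsum0 : Summable (fun n : ℕ => ((n : ℝ) + 1) ^ (-(5 / 4) : ℝ)) := by
    have h := (Real.summable_nat_rpow (p := -(5/4))).2 (by norm_num)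
    have := (summable_nat_add_iff 1).2 h
    simpa using this
  have hsum : ∀ z : ℂ, 1 / 4 < z.re → Summable (fun n => t n z) := fun z hz =>
    Summable.of_norm_bounded (hsum0.mul_left _) (fun n => hb n z hz)
  set R : ℝ := ‖s‖ + 3 with hR
  set U : Set ℂ := {z | 1 / 4 < z.re} ∩ Metric.ball 0 R with hU
  have hUo : IsOpen U := (isOpen_lt continuous_const Complex.continuous_re).inter Metric.isOpen_ball
  have hUc : Convex ℝ U := (convex_halfSpace_re_gt _).inter (convex_ball _ _)
  have hd : DifferentiableOn ℂ (fun z => ∑' n, t n z) U := by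
    apply Complex.differentiableOn_tsum_of_summable_norm (hsum0.mul_left (K * (R + 1) ^ 2))
      (fun n => (ht n).differentiableOn) hUo
    intro n z hz
    refine (hb n z hz.1).trans ?_
    have : ‖z‖ ≤ R := by simpa using (Metric.mem_ball.1 hz.2).le
    gcongr
  have h2 : (2 : ℂ) ∈ U := by
    refine ⟨by norm_num, ?_⟩
    simp only [Metric.mem_ball, dist_zero_right, hR]
    have : ‖(2 : ℂ)‖ = 2 := by simp
    rw [this]; linarith [norm_nonneg s]
  have hsU : s ∈ U := ⟨hs, by simp [hR]⟩
  have hev : (fun z => ∑' n, t n z) =ᶠ[nhds (2 : ℂ)] g := by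
    have : {z : ℂ | 1 < z.re} ∈ nhds (2 : ℂ) :=
      (isOpen_lt continuous_const Complex.continuous_re).mem_nhds (by norm_num)
    filter_upwards [this] with z hz
    have h1 := (hsum z (lt_trans (by norm_num) hz)).hasSum.tendsto_sum_nat
    exact tendsto_nhds_unique h1 (heq z hz)
  have := (hd.analyticOnNhd hUo).eqOn_of_preconnected_of_eventuallyEq
    (hg.differentiableOn.analyticOnNhd hUo) hUc.isPreconnected h2 hev hsU
  rw [← this]
  exact (hsum s hs).hasSum

lemma esz_rpow_aux (n : ℕ) (σ : ℝ) (hσ : 1 / 4 < σ) :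
    ((n : ℝ) + 1) ^ (-σ - 1) ≤ ((n : ℝ) + 1) ^ (-(5 / 4) : ℝ) :=
  Real.rpow_le_rpow_of_exponent_le (by linarith [(Nat.cast_nonneg n : (0 : ℝ) ≤ n)]) (by linarith)

lemma esz_zeta1_sum (s : ℂ) (hs : 1 / 4 < s.re) :
    HasSum (fun n : ℕ => (s - 1) * (((n : ℝ) + 1 : ℝ) : ℂ) ^ (-s) +
      (((n : ℝ) + 1 + 1 : ℝ) : ℂ) ^ (1 - s) - (((n : ℝ) + 1 : ℝ) : ℂ) ^ (1 - s))
      (riemannZeta₁ s - 1) := by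
  have hne : ∀ n : ℕ, (((n : ℝ) + 1 : ℝ) : ℂ) ≠ 0 := fun n => by
    exact_mod_cast (by positivity : ((n : ℝ) + 1) ≠ 0)
  have hne' : ∀ n : ℕ, (((n : ℝ) + 1 + 1 : ℝ) : ℂ) ≠ 0 := fun n => by
    exact_mod_cast (by positivity : ((n : ℝ) + 1 + 1) ≠ 0)
  refine esz_ident (fun s => riemannZeta₁ s - 1) (differentiable_riemannZeta₁.sub_const 1)
    (fun n s => (s - 1) * (((n : ℝ) + 1 : ℝ) : ℂ) ^ (-s) +
      (((n : ℝ) + 1 + 1 : ℝ) : ℂ) ^ (1 - s) - (((n : ℝ) + 1 : ℝ) : ℂ) ^ (1 - s)) ?_ 1 zero_le_one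
    ?_ ?_ s hs
  · intro n
    have h1 : Differentiable ℂ (fun s : ℂ => (((n : ℝ) + 1 : ℝ) : ℂ) ^ (-s)) :=
      (differentiable_id.neg).const_cpow (Or.inl (hne n))
    have h2 : Differentiable ℂ (fun s : ℂ => (((n : ℝ) + 1 + 1 : ℝ) : ℂ) ^ (1 - s)) :=
      (differentiable_id.const_sub 1).const_cpow (Or.inl (hne' n))
    have h3 : Differentiable ℂ (fun s : ℂ => (((n : ℝ) + 1 : ℝ) : ℂ) ^ (1 - s)) :=
      (differentiable_id.const_sub 1).const_cpow (Or.inl (hne n))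
    exact (((differentiable_id.sub_const 1).mul h1).add h2).sub h3
  · intro n s hs
    refine (esz_T_bound s (by linarith) ((n : ℝ) + 1) (by positivity)).trans ?_
    have h1 := esz_rpow_aux n s.re hs
    have h2 : ‖s - 1‖ ≤ ‖s‖ + 1 := by simpa using norm_sub_le s 1
    calc _ ≤ (‖s‖ + 1) * ((‖s‖ + 1) * ((n : ℝ) + 1) ^ (-(5 / 4) : ℝ)) := by
          gcongr
          linarith
      _ = _ := by ring
  · intro s hs
    have hpart : ∀ M : ℕ, ∑ n ∈ Finset.range M, ((s - 1) * (((n : ℝ) + 1 : ℝ) : ℂ) ^ (-s) +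
      (((n : ℝ) + 1 + 1 : ℝ) : ℂ) ^ (1 - s) - (((n : ℝ) + 1 : ℝ) : ℂ) ^ (1 - s))
        = (s - 1) * ∑ n ∈ Finset.range M, 1 / ((n : ℂ) + 1) ^ s
          + (((M : ℝ) + 1 : ℝ) : ℂ) ^ (1 - s) - 1 := by
      intro M
      induction M with
      | zero => simp
      | succ M ih =>
        rw [Finset.sum_range_succ, ih, Finset.sum_range_succ]
        rw [Complex.cpow_neg]
        push_cast
        ring
    simp only [hpart]
    have hz : (s - 1) * riemannZeta s = riemannZeta₁ s := by
      have hs1 : s ≠ 1 := by rintro rfl; simp at hs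
      have := sub_ne_zero.2 hs1
      rw [riemannZeta_eq_inv_sub_mul hs1]; field_simp
    have ht1 : Filter.Tendsto (fun M => ∑ n ∈ Finset.range M, 1 / ((n : ℂ) + 1) ^ s)
        Filter.atTop (nhds (riemannZeta s)) := by
      rw [zeta_eq_tsum_one_div_nat_add_one_cpow hs]
      apply HasSum.tendsto_sum_nat
      apply Summable.hasSum
      have := (summable_nat_add_iff 1).2 (Complex.summable_one_div_nat_cpow.2 hs)
      simpa using this
    have ht2 : Filter.Tendsto (fun M : ℕ => (((M : ℝ) + 1 : ℝ) : ℂ) ^ (1 - s))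
        Filter.atTop (nhds 0) := by
      rw [tendsto_zero_iff_norm_tendsto_zero]
      have : ∀ M : ℕ, ‖(((M : ℝ) + 1 : ℝ) : ℂ) ^ (1 - s)‖ = ((M : ℝ) + 1) ^ (-(s.re - 1)) := by
        intro M
        rw [Complex.norm_cpow_eq_rpow_re_of_pos (by positivity)]; simp
      simp only [this]
      exact (tendsto_rpow_neg_atTop (by linarith)).comp
        (Filter.tendsto_atTop_add_const_right _ 1 tendsto_natCast_atTop_atTop)
    have := ((ht1.const_mul (s - 1)).add ht2).sub_const 1
    simpa [hz] using this


lemma esz_sum_period {m : ℕ} [NeZero m] (f : ZMod m → ℂ) (n : ℕ) :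
    ∑ k ∈ Finset.range m, f ((n + k : ℕ) : ZMod m) = ∑ j, f j := by
  have h1 : ∑ j, f j = ∑ j : ZMod m, f ((n : ZMod m) + j) :=
    (Fintype.sum_equiv (Equiv.addLeft (n : ZMod m)) _ _ (fun j => by simp)).symm
  rw [h1]
  refine Finset.sum_bij' (fun k _ => (k : ZMod m)) (fun j _ => j.val) ?_ ?_ ?_ ?_ ?_
  · simp
  · intro j _; simpa using ZMod.val_lt j
  · intro k hk; exact ZMod.val_cast_of_lt (by simpa using hk)
  · intro j _; simp
  · intro k _; simp

lemma esz_P_bound {m : ℕ} [NeZero m] (f : ZMod m → ℂ) (hf : ∀ j, ‖f j‖ ≤ 2)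
    (h0 : ∑ j, f j = 0) (n : ℕ) :
    ‖∑ k ∈ Finset.range n, f ((k + 1 : ℕ) : ZMod m)‖ ≤ 2 * m := by
  induction n using Nat.strong_induction_on with
  | _ n ih =>
    by_cases h : n < m
    · calc _ ≤ ∑ k ∈ Finset.range n, ‖f ((k + 1 : ℕ) : ZMod m)‖ := norm_sum_le _ _
        _ ≤ ∑ k ∈ Finset.range n, (2 : ℝ) := Finset.sum_le_sum fun k _ => hf _
        _ = 2 * n := by simp [mul_comm]
        _ ≤ 2 * m := by gcongr
    · push Not at h
      obtain ⟨r, rfl⟩ := Nat.exists_eq_add_of_le' h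
      rw [Finset.sum_range_add]
      have : ∑ x ∈ Finset.range m, f ((r + x + 1 : ℕ) : ZMod m) = 0 := by
        rw [← h0, ← esz_sum_period f (r + 1)]
        exact Finset.sum_congr rfl fun k _ => by congr 2; ring
      rw [this, add_zero]
      exact ih r (by have := NeZero.pos m; omega)

lemma esz_L_part {m : ℕ} [NeZero m] (f : ZMod m → ℂ) (s : ℂ) (M : ℕ) :
    ∑ n ∈ Finset.range M, (∑ k ∈ Finset.range (n + 1), f ((k + 1 : ℕ) : ZMod m)) *
        ((((n : ℝ) + 1 : ℝ) : ℂ) ^ (-s) - (((n : ℝ) + 1 + 1 : ℝ) : ℂ) ^ (-s))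
      = ∑ n ∈ Finset.range M, f ((n + 1 : ℕ) : ZMod m) * (((n : ℝ) + 1 : ℝ) : ℂ) ^ (-s)
        - (∑ k ∈ Finset.range M, f ((k + 1 : ℕ) : ZMod m)) * (((M : ℝ) + 1 : ℝ) : ℂ) ^ (-s) := by
  induction M with
  | zero => simp
  | succ M ih =>
    rw [Finset.sum_range_succ, ih, Finset.sum_range_succ (n := M), Finset.sum_range_succ (n := M)]
    push_cast
    ring

lemma esz_L_sum_norm {m : ℕ} [NeZero m] (f : ZMod m → ℂ) (hf : ∀ j, ‖f j‖ ≤ 2)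
    (h0 : ∑ j, f j = 0) (s : ℂ) (hs : 0 ≤ s.re) (n : ℕ) :
    ‖(∑ k ∈ Finset.range (n + 1), f ((k + 1 : ℕ) : ZMod m)) *
        ((((n : ℝ) + 1 : ℝ) : ℂ) ^ (-s) - (((n : ℝ) + 1 + 1 : ℝ) : ℂ) ^ (-s))‖ ≤
      (2 * m * ‖s‖) * ((n : ℝ) + 1) ^ (-s.re - 1) := by
  rw [norm_mul]
  have h1 := esz_P_bound f hf h0 (n + 1)
  have h2 := esz_cpow_sub s hs ((n : ℝ) + 1) ((n : ℝ) + 1) ((n : ℝ) + 1 + 1) (by positivity) le_rfl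
    (by linarith)
  have h3 : |(n : ℝ) + 1 - ((n : ℝ) + 1 + 1)| = 1 := by
    rw [show (n : ℝ) + 1 - ((n : ℝ) + 1 + 1) = -1 by ring]; simp
  rw [h3, mul_one] at h2
  calc _ ≤ 2 * m * (‖s‖ * ((n : ℝ) + 1) ^ (-s.re - 1)) := by gcongr
    _ = _ := by ring

lemma esz_L_sum {m : ℕ} [NeZero m] (f : ZMod m → ℂ) (hf : ∀ j, ‖f j‖ ≤ 2)
    (h0 : ∑ j, f j = 0) (s : ℂ) (hs : 1 / 4 < s.re) :
    HasSum (fun n : ℕ => (∑ k ∈ Finset.range (n + 1), f ((k + 1 : ℕ) : ZMod m)) *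
        ((((n : ℝ) + 1 : ℝ) : ℂ) ^ (-s) - (((n : ℝ) + 1 + 1 : ℝ) : ℂ) ^ (-s)))
      (ZMod.LFunction f s) := by
  have hne : ∀ n : ℕ, (((n : ℝ) + 1 : ℝ) : ℂ) ≠ 0 := fun n => by
    exact_mod_cast (by positivity : ((n : ℝ) + 1) ≠ 0)
  have hne' : ∀ n : ℕ, (((n : ℝ) + 1 + 1 : ℝ) : ℂ) ≠ 0 := fun n => by
    exact_mod_cast (by positivity : ((n : ℝ) + 1 + 1) ≠ 0)
  refine esz_ident (ZMod.LFunction f) (ZMod.differentiable_LFunction_of_sum_zero h0)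
    (fun n s => (∑ k ∈ Finset.range (n + 1), f ((k + 1 : ℕ) : ZMod m)) *
        ((((n : ℝ) + 1 : ℝ) : ℂ) ^ (-s) - (((n : ℝ) + 1 + 1 : ℝ) : ℂ) ^ (-s))) ?_ (2 * m)
    (by positivity) ?_ ?_ s hs
  · intro n
    have h1 : Differentiable ℂ (fun s : ℂ => (((n : ℝ) + 1 : ℝ) : ℂ) ^ (-s)) :=
      (differentiable_id.neg).const_cpow (Or.inl (hne n))
    have h2 : Differentiable ℂ (fun s : ℂ => (((n : ℝ) + 1 + 1 : ℝ) : ℂ) ^ (-s)) :=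
      (differentiable_id.neg).const_cpow (Or.inl (hne' n))
    exact (h1.sub h2).const_mul _
  · intro n s hs
    refine (esz_L_sum_norm f hf h0 s (by linarith) n).trans ?_
    have h1 := esz_rpow_aux n s.re hs
    have : ‖s‖ ≤ (‖s‖ + 1) ^ 2 := by nlinarith [norm_nonneg s]
    gcongr
  · intro s hs
    simp only [esz_L_part]
    have ht1 : Filter.Tendsto (fun M => ∑ n ∈ Finset.range M,
        f ((n + 1 : ℕ) : ZMod m) * (((n : ℝ) + 1 : ℝ) : ℂ) ^ (-s))
        Filter.atTop (nhds (ZMod.LFunction f s)) := by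
      rw [ZMod.LFunction_eq_LSeries f hs]
      have hsm : LSeriesSummable (fun n => f n) s := ZMod.LSeriesSummable_of_one_lt_re f hs
      have h1 : HasSum (LSeries.term (fun n => f n) s) (LSeries (fun n => f n) s) := hsm.hasSum
      have h2 := (hasSum_nat_add_iff' 1).2 h1
      simp only [Finset.range_one, Finset.sum_singleton, LSeries.term_zero, sub_zero] at h2
      have h3 := h2.tendsto_sum_nat
      refine h3.congr fun M => Finset.sum_congr rfl fun n _ => ?_
      rw [LSeries.term_of_ne_zero (by omega), Complex.cpow_neg]
      push_cast
      rw [div_eq_mul_inv]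
    have ht2 : Filter.Tendsto (fun M : ℕ => (∑ k ∈ Finset.range M, f ((k + 1 : ℕ) : ZMod m)) *
        (((M : ℝ) + 1 : ℝ) : ℂ) ^ (-s)) Filter.atTop (nhds 0) := by
      apply squeeze_zero_norm (a := fun M : ℕ => 2 * m * ((M : ℝ) + 1) ^ (-s.re))
      · intro M
        rw [norm_mul, Complex.norm_cpow_eq_rpow_re_of_pos (by positivity)]
        have := esz_P_bound f hf h0 M
        simp only [Complex.neg_re]
        gcongr
      · have : Filter.Tendsto (fun M : ℕ => ((M : ℝ) + 1) ^ (-s.re)) Filter.atTop (nhds 0) :=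
          (tendsto_rpow_neg_atTop (by linarith)).comp
            (Filter.tendsto_atTop_add_const_right _ 1 tendsto_natCast_atTop_atTop)
        simpa using this.const_mul (2 * (m : ℝ))
    simpa using ht1.sub ht2

noncomputable def eszZ : ℝ := ∑' n : ℕ, ((n : ℝ) + 1) ^ (-(5 / 4) : ℝ)

lemma eszZ_summable : Summable (fun n : ℕ => ((n : ℝ) + 1) ^ (-(5 / 4) : ℝ)) := by
  have h := (Real.summable_nat_rpow (p := -(5/4))).2 (by norm_num)
  have := (summable_nat_add_iff 1).2 h
  simpa using this

lemma eszZ_nonneg : 0 ≤ eszZ := tsum_nonneg fun n => by positivity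

lemma esz_tail (t : ℕ → ℂ) (S : ℂ) (hS : HasSum t S) (K σ : ℝ) (hK : 0 ≤ K) (hσ : 1 / 2 ≤ σ)
    (ht : ∀ n : ℕ, ‖t n‖ ≤ K * ((n : ℝ) + 1) ^ (-σ - 1)) (M : ℕ) :
    ‖S - ∑ n ∈ Finset.range M, t n‖ ≤ K * ((M : ℝ) + 1) ^ (-(1 / 4) : ℝ) * eszZ := by
  have h1 := (hasSum_nat_add_iff' M).2 hS
  rw [← h1.tsum_eq]
  have hs : Summable (fun n : ℕ => K * ((M : ℝ) + 1) ^ (-(1 / 4) : ℝ) *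
      ((n : ℝ) + 1) ^ (-(5 / 4) : ℝ)) := eszZ_summable.mul_left _
  refine (tsum_of_norm_bounded hs.hasSum fun n => ?_).trans (le_of_eq ?_)
  · refine (ht (n + M)).trans ?_
    rw [mul_assoc]
    gcongr
    push_cast
    have hn : (0 : ℝ) ≤ n := Nat.cast_nonneg n
    have hM : (0 : ℝ) ≤ M := Nat.cast_nonneg M
    calc ((n : ℝ) + M + 1) ^ (-σ - 1) ≤ ((n : ℝ) + M + 1) ^ (-(1 / 4) + -(5 / 4) : ℝ) :=
          Real.rpow_le_rpow_of_exponent_le (by linarith) (by linarith)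
      _ = ((n : ℝ) + M + 1) ^ (-(1 / 4) : ℝ) * ((n : ℝ) + M + 1) ^ (-(5 / 4) : ℝ) :=
          Real.rpow_add (by positivity) _ _
      _ ≤ _ := by
        gcongr ?_ * ?_
        · exact Real.rpow_le_rpow_of_nonpos (by positivity) (by linarith) (by norm_num)
        · exact Real.rpow_le_rpow_of_nonpos (by positivity) (by linarith) (by norm_num)
  · rw [tsum_mul_left]; rfl

lemma esz_L_crude {m : ℕ} [NeZero m] (f : ZMod m → ℂ) (hf : ∀ j, ‖f j‖ ≤ 2)
    (h0 : ∑ j, f j = 0) (s : ℂ) (hs : 1 / 2 ≤ s.re) :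
    ‖ZMod.LFunction f s‖ ≤ 2 * m * ‖s‖ * eszZ := by
  have := esz_tail _ _ (esz_L_sum f hf h0 s (by linarith)) (2 * m * ‖s‖) s.re (by positivity) hs
    (fun n => esz_L_sum_norm f hf h0 s (by linarith) n) 0
  simpa using this

lemma esz_zeta1_crude (s : ℂ) (hs : 1 / 2 ≤ s.re) :
    ‖riemannZeta₁ s‖ ≤ 1 + ‖s - 1‖ * ‖s‖ * eszZ := by
  have := esz_tail _ _ (esz_zeta1_sum s (by linarith)) (‖s - 1‖ * ‖s‖) s.re (by positivity) hs
    (fun n => (esz_T_bound s (by linarith) ((n : ℝ) + 1) (by positivity)).trans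
      (le_of_eq (by ring))) 0
  simp only [Finset.range_zero, Finset.sum_empty, sub_zero, Nat.cast_zero, zero_add, Real.one_rpow,
    mul_one] at this
  calc _ = ‖(riemannZeta₁ s - 1) + 1‖ := by simp
    _ ≤ ‖riemannZeta₁ s - 1‖ + ‖(1 : ℂ)‖ := norm_add_le _ _
    _ ≤ _ := by rw [norm_one]; linarith


lemma esz_hsum (l σ : ℝ) (hl : 2 ≤ l) (hσ : 1 - 1 / l ≤ σ) (M : ℕ) (hM : (M : ℝ) ≤ Real.exp (20 * l)) :
    ∑ n ∈ Finset.range M, ((n : ℝ) + 1) ^ (-σ) ≤ Real.exp 20 * (21 * l) := by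
  have h1 : ∀ n ∈ Finset.range M, ((n : ℝ) + 1) ^ (-σ) ≤ Real.exp 20 * ((n : ℝ) + 1)⁻¹ := by
    intro n hn
    have hn' : n + 1 ≤ M := by simpa using hn
    have hn1 : (n : ℝ) + 1 ≤ Real.exp (20 * l) := le_trans (by exact_mod_cast hn') hM
    have hp : (0 : ℝ) < (n : ℝ) + 1 := by positivity
    have e1 : (1 : ℝ) ≤ (n : ℝ) + 1 := by linarith [(Nat.cast_nonneg n : (0:ℝ) ≤ n)]
    calc ((n : ℝ) + 1) ^ (-σ) ≤ ((n : ℝ) + 1) ^ (1 / l + -1) :=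
          Real.rpow_le_rpow_of_exponent_le e1 (by linarith)
      _ = ((n : ℝ) + 1) ^ (1 / l) * ((n : ℝ) + 1)⁻¹ := by
          rw [Real.rpow_add hp, Real.rpow_neg_one]
      _ ≤ (Real.exp (20 * l)) ^ (1 / l) * ((n : ℝ) + 1)⁻¹ := by gcongr
      _ = _ := by
          rw [← Real.exp_mul]; congr 2; field_simp
  refine (Finset.sum_le_sum h1).trans ?_
  rw [← Finset.mul_sum]
  have h2 := harmonic_le_one_add_log M
  have h3 : ((harmonic M : ℚ) : ℝ) = ∑ n ∈ Finset.range M, ((n : ℝ) + 1)⁻¹ := by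
    simp [harmonic]
  rw [← h3]
  gcongr
  refine h2.trans ?_
  have : Real.log M ≤ 20 * l := by
    rcases Nat.eq_zero_or_pos M with h | h
    · subst h; simp; linarith
    · rw [Real.log_le_iff_le_exp (by exact_mod_cast h)]; exact hM
  linarith

lemma esz_M_pow (l : ℝ) (k : ℝ) (hk : 0 ≤ k) :
    (((⌊Real.exp (20 * l)⌋₊ : ℕ) : ℝ) + 1) ^ (-k) ≤ Real.exp (-(20 * k) * l) := by
  calc _ ≤ (Real.exp (20 * l)) ^ (-k) :=
        Real.rpow_le_rpow_of_nonpos (Real.exp_pos _) (Nat.lt_floor_add_one _).le (by linarith)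
    _ = _ := by rw [← Real.exp_mul]; congr 1; ring

lemma esz_U_f : ∃ C : ℝ, 0 < C ∧ ∀ (l : ℝ) (m : ℕ) [NeZero m] (f : ZMod m → ℂ) (s : ℂ), 2 ≤ l →
    (m : ℝ) ≤ Real.exp l → (∀ j, ‖f j‖ ≤ 2) → ∑ j, f j = 0 → 1 - 1 / l ≤ s.re →
    ‖s‖ ≤ Real.exp (2 * l) → ‖ZMod.LFunction f s‖ ≤ C * l := by
  refine ⟨2 * Real.exp 20 * 21 + 2 + 2 * eszZ, by have := eszZ_nonneg; positivity, ?_⟩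
  intro l m _ f s hl hm hf h0 hs hs2
  have hl2 : 1 / l ≤ 1 / 2 := one_div_le_one_div_of_le (by norm_num) hl
  set M := ⌊Real.exp (20 * l)⌋₊ with hMd
  have hM : (M : ℝ) ≤ Real.exp (20 * l) := Nat.floor_le (Real.exp_pos _).le
  have ht := esz_tail _ _ (esz_L_sum f hf h0 s (by linarith)) (2 * m * ‖s‖) s.re (by positivity)
    (by linarith) (fun n => esz_L_sum_norm f hf h0 s (by linarith) n) M
  rw [esz_L_part] at ht
  have e1 : ‖∑ n ∈ Finset.range M, f ((n + 1 : ℕ) : ZMod m) * (((n : ℝ) + 1 : ℝ) : ℂ) ^ (-s)‖ ≤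
      2 * (Real.exp 20 * (21 * l)) := by
    refine (norm_sum_le _ _).trans ?_
    refine le_trans ?_ (mul_le_mul_of_nonneg_left (esz_hsum l s.re hl hs M hM) (by norm_num))
    rw [Finset.mul_sum]
    refine Finset.sum_le_sum fun n _ => ?_
    rw [norm_mul, Complex.norm_cpow_eq_rpow_re_of_pos (by positivity)]
    simp only [Complex.neg_re]
    gcongr
    exact hf _
  have e2 : ‖(∑ k ∈ Finset.range M, f ((k + 1 : ℕ) : ZMod m)) * (((M : ℝ) + 1 : ℝ) : ℂ) ^ (-s)‖ ≤ 2 := by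
    rw [norm_mul, Complex.norm_cpow_eq_rpow_re_of_pos (by positivity)]
    simp only [Complex.neg_re]
    have := esz_P_bound f hf h0 M
    have h3 : ((M : ℝ) + 1) ^ (-s.re) ≤ Real.exp (-l) :=
      (esz_M_pow l s.re (by linarith)).trans (Real.exp_le_exp.2 (by nlinarith))
    calc _ ≤ (2 * Real.exp l) * Real.exp (-l) := by gcongr; exact this.trans (by gcongr)
      _ = 2 := by rw [mul_assoc, ← Real.exp_add]; simp
  have e3 : 2 * m * ‖s‖ * ((M : ℝ) + 1) ^ (-(1 / 4) : ℝ) * eszZ ≤ 2 * eszZ := by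
    have h3 : ((M : ℝ) + 1) ^ (-(1 / 4) : ℝ) ≤ Real.exp (-(3 * l)) :=
      (esz_M_pow l (1/4) (by linarith)).trans (Real.exp_le_exp.2 (by linarith))
    have := eszZ_nonneg
    calc _ ≤ 2 * Real.exp l * Real.exp (2 * l) * Real.exp (-(3 * l)) * eszZ := by gcongr
      _ = 2 * (Real.exp l * Real.exp (2 * l) * Real.exp (-(3 * l))) * eszZ := by ring
      _ = 2 * eszZ := by rw [← Real.exp_add, ← Real.exp_add]; ring_nf; simp
  have key : ‖ZMod.LFunction f s‖ ≤ 2 * eszZ + (2 * (Real.exp 20 * (21 * l)) + 2) := by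
    have := norm_le_norm_add_norm_sub' (ZMod.LFunction f s) (∑ n ∈ Finset.range M, f ((n + 1 : ℕ) : ZMod m) * (((n : ℝ) + 1 : ℝ) : ℂ) ^ (-s)
        - (∑ k ∈ Finset.range M, f ((k + 1 : ℕ) : ZMod m)) * (((M : ℝ) + 1 : ℝ) : ℂ) ^ (-s))
    have h5 := norm_sub_le (∑ n ∈ Finset.range M, f ((n + 1 : ℕ) : ZMod m) * (((n : ℝ) + 1 : ℝ) : ℂ) ^ (-s))
        ((∑ k ∈ Finset.range M, f ((k + 1 : ℕ) : ZMod m)) * (((M : ℝ) + 1 : ℝ) : ℂ) ^ (-s))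
    linarith
  refine key.trans ?_
  nlinarith [eszZ_nonneg, Real.exp_pos 20]

lemma esz_zeta_part (s : ℂ) (M : ℕ) :
    ∑ n ∈ Finset.range M, ((s - 1) * (((n : ℝ) + 1 : ℝ) : ℂ) ^ (-s)
        + (((n : ℝ) + 1 + 1 : ℝ) : ℂ) ^ (1 - s) - (((n : ℝ) + 1 : ℝ) : ℂ) ^ (1 - s))
      = (s - 1) * ∑ n ∈ Finset.range M, (((n : ℝ) + 1 : ℝ) : ℂ) ^ (-s)
        + (((M : ℝ) + 1 : ℝ) : ℂ) ^ (1 - s) - 1 := by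
  induction M with
  | zero => simp
  | succ M ih =>
    rw [Finset.sum_range_succ, ih, Finset.sum_range_succ (n := M)]
    push_cast
    ring

lemma esz_U_zeta : ∃ C : ℝ, 0 < C ∧ ∀ (l : ℝ) (s : ℂ), 2 ≤ l → 1 - 1 / l ≤ s.re →
    ‖s‖ ≤ Real.exp (2 * l) → ‖riemannZeta₁ s‖ ≤ C * (l * ‖s - 1‖ + 1) := by
  refine ⟨Real.exp 20 * 21 + 2 * Real.exp 20 + eszZ, by have := eszZ_nonneg; positivity, ?_⟩
  intro l s hl hs hs2
  have hl2 : 1 / l ≤ 1 / 2 := one_div_le_one_div_of_le (by norm_num) hl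
  set M := ⌊Real.exp (20 * l)⌋₊ with hMd
  have hM : (M : ℝ) ≤ Real.exp (20 * l) := Nat.floor_le (Real.exp_pos _).le
  have ht := esz_tail _ _ (esz_zeta1_sum s (by linarith)) (‖s - 1‖ * ‖s‖) s.re (by positivity)
    (by linarith) (fun n => (esz_T_bound s (by linarith) ((n : ℝ) + 1) (by positivity)).trans
      (le_of_eq (by ring))) M
  rw [esz_zeta_part] at ht
  have e1 : ‖(s - 1) * ∑ n ∈ Finset.range M, (((n : ℝ) + 1 : ℝ) : ℂ) ^ (-s)‖ ≤
      ‖s - 1‖ * (Real.exp 20 * (21 * l)) := by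
    rw [norm_mul]
    gcongr
    refine (norm_sum_le _ _).trans ?_
    refine le_trans ?_ (esz_hsum l s.re hl hs M hM)
    refine Finset.sum_le_sum fun n _ => ?_
    rw [Complex.norm_cpow_eq_rpow_re_of_pos (by positivity)]
    simp only [Complex.neg_re]
    exact le_rfl
  have e2 : ‖(((M : ℝ) + 1 : ℝ) : ℂ) ^ (1 - s)‖ ≤ 2 * Real.exp 20 := by
    rw [Complex.norm_cpow_eq_rpow_re_of_pos (by positivity)]
    simp only [Complex.sub_re, Complex.one_re]
    have hM1 : (1 : ℝ) ≤ (M : ℝ) + 1 := by linarith [(Nat.cast_nonneg M : (0:ℝ) ≤ M)]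
    have he1 : 1 ≤ Real.exp (20 * l) := Real.one_le_exp (by linarith)
    calc ((M : ℝ) + 1) ^ (1 - s.re) ≤ ((M : ℝ) + 1) ^ (1 / l) :=
          Real.rpow_le_rpow_of_exponent_le hM1 (by linarith)
      _ ≤ (2 * Real.exp (20 * l)) ^ (1 / l) := by
          apply Real.rpow_le_rpow (by positivity) (by linarith) (by positivity)
      _ = 2 ^ (1 / l) * Real.exp 20 := by
          rw [Real.mul_rpow (by norm_num) (Real.exp_pos _).le, ← Real.exp_mul]; congr 2; field_simp
      _ ≤ 2 ^ (1 : ℝ) * Real.exp 20 := by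
          gcongr
          · norm_num
          · linarith
      _ = _ := by rw [Real.rpow_one]
  have e3 : ‖s - 1‖ * ‖s‖ * ((M : ℝ) + 1) ^ (-(1 / 4) : ℝ) * eszZ ≤ ‖s - 1‖ * eszZ := by
    have h3 : ((M : ℝ) + 1) ^ (-(1 / 4) : ℝ) ≤ Real.exp (-(2 * l)) :=
      (esz_M_pow l (1/4) (by linarith)).trans (Real.exp_le_exp.2 (by linarith))
    have := eszZ_nonneg
    calc _ ≤ ‖s - 1‖ * Real.exp (2 * l) * Real.exp (-(2 * l)) * eszZ := by gcongr
      _ = ‖s - 1‖ * (Real.exp (2 * l) * Real.exp (-(2 * l))) * eszZ := by ring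
      _ = _ := by rw [← Real.exp_add]; simp
  have key : ‖riemannZeta₁ s‖ ≤ ‖s - 1‖ * eszZ + (‖s - 1‖ * (Real.exp 20 * (21 * l)) + 2 * Real.exp 20) := by
    have := norm_le_norm_add_norm_sub' (riemannZeta₁ s) ((s - 1) * ∑ n ∈ Finset.range M, (((n : ℝ) + 1 : ℝ) : ℂ) ^ (-s) + (((M : ℝ) + 1 : ℝ) : ℂ) ^ (1 - s))
    have h5 := norm_add_le ((s - 1) * ∑ n ∈ Finset.range M, (((n : ℝ) + 1 : ℝ) : ℂ) ^ (-s)) ((((M : ℝ) + 1 : ℝ) : ℂ) ^ (1 - s))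
    rw [show ∀ A B D : ℂ, A - 1 - (B + D - 1) = A - (B + D) by intros; ring] at ht
    linarith
  refine key.trans ?_
  have hx := norm_nonneg (s - 1)
  have hz := eszZ_nonneg
  have he := Real.exp_pos 20
  have h6 : ‖s - 1‖ ≤ l * ‖s - 1‖ := by nlinarith
  nlinarith [mul_le_mul_of_nonneg_right h6 hz, mul_nonneg (mul_nonneg (by linarith : 0 ≤ l) hx) he.le]

lemma esz_LF_one (m : ℕ) [NeZero m] (s : ℂ) (hs : s ≠ 1) :
    ZMod.LFunction (fun _ : ZMod m => (1 : ℂ)) s = riemannZeta s := by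
  have hf : AnalyticOnNhd ℂ (ZMod.LFunction (fun _ : ZMod m => (1 : ℂ))) {1}ᶜ :=
    DifferentiableOn.analyticOnNhd (fun z hz => (ZMod.differentiableAt_LFunction _ z
      (Or.inl hz)).differentiableWithinAt) isOpen_compl_singleton
  have hg : AnalyticOnNhd ℂ riemannZeta {1}ᶜ :=
    DifferentiableOn.analyticOnNhd (fun z hz =>
      (differentiableAt_riemannZeta hz).differentiableWithinAt) isOpen_compl_singleton
  have hU : IsPreconnected ({1}ᶜ : Set ℂ) :=
    (isConnected_compl_singleton_of_one_lt_rank (by simp) (1 : ℂ)).isPreconnected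
  have h2 : (2 : ℂ) ∈ ({1}ᶜ : Set ℂ) := by simp
  refine hf.eqOn_of_preconnected_of_eventuallyEq hg hU h2 ?_ hs
  have : ∀ᶠ z : ℂ in nhds 2, 1 < z.re :=
    (Complex.continuous_re.isOpen_preimage _ isOpen_Ioi).mem_nhds (by simp)
  filter_upwards [this] with z hz
  rw [ZMod.LFunction_eq_LSeries _ hz, ← LSeries_one_eq_riemannZeta hz]
  rfl

lemma esz_LF_decomp {m : ℕ} [NeZero m] (f : ZMod m → ℂ) (κ s : ℂ) (hs : s ≠ 1) :
    ZMod.LFunction f s = ZMod.LFunction (fun j => f j - κ) s + κ * riemannZeta s := by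
  rw [← esz_LF_one m s hs]
  simp only [ZMod.LFunction, sub_mul, Finset.sum_sub_distrib, Finset.mul_sum, mul_sub]
  rw [← Finset.sum_sub_distrib, ← Finset.sum_add_distrib]
  exact Finset.sum_congr rfl fun j _ => by ring

lemma esz_U : ∃ C : ℝ, 1 ≤ C ∧ ∀ (l : ℝ) (m : ℕ) [NeZero m] (χ : DirichletCharacter ℂ m) (s : ℂ),
    2 ≤ l → (m : ℝ) ≤ Real.exp l → 1 - 1 / l ≤ s.re → ‖s‖ ≤ Real.exp (2 * l) →
    (χ ≠ 1 → ‖χ.LFunction s‖ ≤ C * l) ∧ (s ≠ 1 → ‖χ.LFunction s‖ ≤ C * (l + 1 / ‖s - 1‖)) := by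
  obtain ⟨C1, hC1, h1⟩ := esz_U_f
  obtain ⟨C2, hC2, h2⟩ := esz_U_zeta
  refine ⟨C1 + C2 + 1, by linarith, ?_⟩
  intro l m _ χ s hl hm hs hs2
  constructor
  · intro hχ
    have := h1 l m χ s hl hm (fun j => (χ.norm_le_one j).trans (by norm_num))
      (MulChar.sum_eq_zero_of_ne_one hχ) hs hs2
    refine this.trans ?_
    gcongr
    linarith
  · intro hs1
    have hm0 : (0 : ℝ) < m := by exact_mod_cast NeZero.pos m
    set κ : ℂ := (∑ j, χ j) / m with hκ
    have hκ1 : ‖κ‖ ≤ 1 := by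
      rw [hκ, norm_div, Complex.norm_natCast, div_le_one hm0]
      refine (norm_sum_le _ _).trans ((Finset.sum_le_sum fun j _ => χ.norm_le_one j).trans ?_)
      simp [ZMod.card]
    have e1 := h1 l m (fun j => χ j - κ) s hl hm
      (fun j => (norm_sub_le _ _).trans (by linarith [χ.norm_le_one j]))
      (by
        have hm0' : (m : ℂ) ≠ 0 := by exact_mod_cast NeZero.ne m
        rw [Finset.sum_sub_distrib]; simp [ZMod.card, hκ]; field_simp; ring) hs hs2
    have e2 := h2 l s hl hs hs2
    have hn : 0 < ‖s - 1‖ := norm_pos_iff.2 (sub_ne_zero.2 hs1)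
    have e3 : ‖riemannZeta s‖ ≤ C2 * (l + 1 / ‖s - 1‖) := by
      rw [riemannZeta_eq_inv_sub_mul hs1, norm_mul, norm_inv]
      calc _ ≤ ‖s - 1‖⁻¹ * (C2 * (l * ‖s - 1‖ + 1)) := by gcongr
        _ = _ := by field_simp
    have e4 : χ.LFunction s = _ := esz_LF_decomp (fun j => χ j) κ s hs1
    rw [e4]
    refine (norm_add_le _ _).trans ?_
    rw [norm_mul]
    have e5 : ‖κ‖ * ‖riemannZeta s‖ ≤ 1 * (C2 * (l + 1 / ‖s - 1‖)) := by gcongr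
    have : 0 < 1 / ‖s - 1‖ := by positivity
    nlinarith


lemma esz_exp_aux (l : ℝ) (hl : 2 ≤ l) : 3 + 2 * Real.exp l ≤ Real.exp (2 * l) := by
  have h1 : 3 ≤ Real.exp l := by linarith [Real.add_one_le_exp l]
  have : Real.exp (2 * l) = Real.exp l * Real.exp l := by rw [← Real.exp_add]; ring_nf
  nlinarith

lemma esz_deriv (a : ℝ) (ha : 0 < a) (ha1 : a ≤ 1) : ∃ C : ℝ, 1 ≤ C ∧
    ∀ (l : ℝ) (m : ℕ) [NeZero m] (χ : DirichletCharacter ℂ m) (s : ℂ),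
    2 ≤ l → (m : ℝ) ≤ Real.exp l → 1 - 1 / (2 * l) ≤ s.re → ‖s‖ + 1 ≤ Real.exp (2 * l) →
    (χ ≠ 1 ∨ a / l ≤ ‖s - 1‖) → ‖deriv χ.LFunction s‖ ≤ C * l ^ 2 := by
  obtain ⟨C, hC, hU⟩ := esz_U
  refine ⟨C * (1 + 2 / a) / (a / 2), ?_, ?_⟩
  · rw [le_div_iff₀ (by positivity)]
    have : 0 ≤ 2 / a := by positivity
    nlinarith
  intro l m _ χ s hl hm hs hs2 hχ
  have hl0 : 0 < l := by linarith
  set r : ℝ := a / (2 * l) with hr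
  have hr0 : 0 < r := by positivity
  have hrl : r ≤ 1 / (2 * l) := by rw [hr]; gcongr
  have hl2 : 1 / (2 * l) ≤ 1 := by rw [div_le_one (by positivity)]; linarith
  have hne : ∀ z ∈ Metric.closedBall s r, χ ≠ 1 ∨ a / (2 * l) ≤ ‖z - 1‖ := by
    intro z hz
    rcases hχ with h | h
    · exact Or.inl h
    · right
      rw [mem_closedBall_iff_norm] at hz
      have h1 : ‖s - 1‖ ≤ ‖z - 1‖ + ‖z - s‖ := by
        have := norm_sub_le (z - 1) (z - s)
        rwa [show z - 1 - (z - s) = s - 1 by ring] at this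
      have h2 : a / l = 2 * (a / (2 * l)) := by field_simp
      rw [hr] at hz
      linarith
  have hd : DiffContOnCl ℂ χ.LFunction (Metric.ball s r) := by
    apply DifferentiableOn.diffContOnCl
    intro z hz
    rw [closure_ball _ hr0.ne'] at hz
    refine (DirichletCharacter.differentiableAt_LFunction χ z ?_).differentiableWithinAt
    rcases hne z hz with h | h
    · exact Or.inr h
    · left
      rintro rfl
      simp at h
      have : 0 < a / (2 * l) := by positivity
      linarith
  have hb : ∀ z ∈ Metric.sphere s r, ‖χ.LFunction z‖ ≤ C * (1 + 2 / a) * l := by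
    intro z hz
    have hz' := hne z (Metric.sphere_subset_closedBall hz)
    rw [mem_sphere_iff_norm] at hz
    have h1 : |(z - s).re| ≤ r := (Complex.abs_re_le_norm _).trans hz.le
    have h2 : s.re - r ≤ z.re := by
      rw [Complex.sub_re, abs_le] at h1; linarith
    have h3 : 1 - 1 / l ≤ z.re := by
      have : 1 / l = 1 / (2 * l) + 1 / (2 * l) := by field_simp; norm_num
      linarith
    have h4 : ‖z‖ ≤ Real.exp (2 * l) := by
      have := norm_add_le (z - s) s
      rw [sub_add_cancel] at this
      linarith
    have := hU l m χ z hl hm h3 h4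
    rcases hz' with h | h
    · refine (this.1 h).trans ?_
      have : 0 ≤ 2 / a := by positivity
      gcongr
      nlinarith
    · have hn : 0 < ‖z - 1‖ := lt_of_lt_of_le (by positivity) h
      refine (this.2 (fun h => by simp [h] at hn)).trans ?_
      rw [mul_assoc]
      gcongr
      have h6 : 1 / ‖z - 1‖ ≤ 1 / (a / (2 * l)) := one_div_le_one_div_of_le (by positivity) h
      have h7 : 1 / (a / (2 * l)) = 2 / a * l := by field_simp
      linarith
  refine (Complex.norm_deriv_le_of_forall_mem_sphere_norm_le hr0 hd hb).trans (le_of_eq ?_)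
  rw [hr]; field_simp

/-- Lipschitz bound along convex sets. -/
lemma esz_lip (f : ℂ → ℂ) (K : ℝ) (x y : ℂ) (hf : ∀ z ∈ segment ℝ x y, DifferentiableAt ℂ f z ∧ ‖deriv f z‖ ≤ K) :
    ‖f y - f x‖ ≤ K * ‖y - x‖ :=
  (convex_segment (𝕜 := ℝ) x y).norm_image_sub_le_of_norm_deriv_le (fun z hz => (hf z hz).1)
    (fun z hz => (hf z hz).2) (left_mem_segment _ _ _) (right_mem_segment _ _ _)

lemma esz_norm_aux (s : ℂ) (T : ℝ) (h1 : |s.re - 1| ≤ 1) (h2 : |s.im| ≤ T) : ‖s‖ ≤ 2 + T := by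
  refine (Complex.norm_le_abs_re_add_abs_im s).trans ?_
  have : |s.re| ≤ 2 := by rw [abs_le] at h1 ⊢; constructor <;> linarith
  linarith

lemma esz_Z (a : ℝ) (ha : 0 < a) (ha1 : a ≤ 1) : ∃ c₂ c : ℝ, 0 < c₂ ∧ c₂ ≤ 1 ∧ 0 < c ∧
    ∀ (l : ℝ) (m : ℕ) [NeZero m] (χ : DirichletCharacter ℂ m) (s : ℂ),
    2 ≤ l → (m : ℝ) ≤ Real.exp l → |s.re - 1| ≤ c₂ / l ^ 9 → |s.im| ≤ Real.exp l →
    (χ ^ 2 ≠ 1 ∨ a / l ≤ |s.im|) → c / l ^ 7 ≤ ‖χ.LFunction s‖ := by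
  obtain ⟨C, hC, hU⟩ := esz_U
  obtain ⟨D, hD, hDer⟩ := esz_deriv a ha ha1
  set K : ℝ := (2 * C) ^ 3 * (C * (1 + 1 / a)) with hK
  have hC0 : 0 < C := by linarith
  have hD0 : 0 < D := by linarith
  have hK1 : 1 ≤ K := by
    have : 0 ≤ 1 / a := by positivity
    have h8 : 1 ≤ (2 * C) ^ 3 := one_le_pow₀ (by linarith)
    have h9 : 1 ≤ C * (1 + 1 / a) := by nlinarith
    rw [hK]; nlinarith
  have hD4 : 1 ≤ D ^ 4 := one_le_pow₀ hD
  have hKD : 1 ≤ K * D ^ 4 := by nlinarith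
  refine ⟨1 / (256 * K * D ^ 4), 2 * D * (1 / (256 * K * D ^ 4)), by positivity, ?_, by positivity, ?_⟩
  · rw [div_le_one (by positivity)]; nlinarith
  intro l m _ χ s hl hm hs hst hχ
  have hl0 : 0 < l := by linarith
  set η : ℝ := 1 / (256 * K * D ^ 4) / l ^ 9 with hη
  have hη0 : 0 < η := by positivity
  have hηl : η * l ^ 9 = 1 / (256 * K * D ^ 4) := by rw [hη]; field_simp
  have hc21 : 1 / (256 * K * D ^ 4) ≤ 1 := by rw [div_le_one (by positivity)]; nlinarith
  have hl9 : 2 * l ≤ l ^ 9 := by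
    have h : (2 : ℝ) ^ 8 ≤ l ^ 8 := by gcongr
    have : l ^ 9 = l * l ^ 8 := by ring
    nlinarith
  have hη2 : η ≤ 1 / (2 * l) := by
    rw [hη]
    calc _ ≤ 1 / l ^ 9 := by gcongr
      _ ≤ _ := one_div_le_one_div_of_le (by positivity) hl9
  have h2l : 1 / (2 * l) ≤ 1 / 4 := one_div_le_one_div_of_le (by norm_num) (by linarith)
  have hll : 1 / (2 * l) ≤ 1 / l := one_div_le_one_div_of_le hl0 (by linarith)
  have hE := esz_exp_aux l hl
  set t := s.im with ht
  have hχ1 : χ ≠ 1 ∨ a / l ≤ |t| := by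
    rcases hχ with h | h
    · left; rintro rfl; simp at h
    · exact Or.inr h
  set s' : ℂ := 1 + η + Complex.I * t with hs'
  have hs're : s'.re = 1 + η := by simp [hs']
  have hs'im : s'.im = t := by simp [hs']
  have hprod := DirichletCharacter.norm_LFunction_product_ge_one χ hη0 t
  have b1 : ‖DirichletCharacter.LFunctionTrivChar m (1 + η)‖ ≤ 2 * C / η := by
    have hre : ((1 : ℂ) + η).re = 1 + η := by simp
    have hsub : ‖(1 : ℂ) + η - 1‖ = η := by
      simp [abs_of_pos hη0]
    have := (hU l m 1 (1 + η) hl hm (by rw [hre]; have : 0 < 1 / l := by positivity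
                                        linarith) (by
      refine (esz_norm_aux _ 1 ?_ ?_).trans ?_
      · simp [abs_of_pos hη0]; linarith
      · simp
      · linarith [Real.exp_pos l])).2 (fun h => by rw [h] at hsub; simp at hsub; linarith)
    refine this.trans ?_
    rw [hsub]
    have : l ≤ 1 / η := by
      rw [le_div_iff₀ hη0]
      have : η * (2 * l) ≤ 1 := by rwa [le_div_iff₀ (by positivity)] at hη2
      nlinarith
    calc C * (l + 1 / η) ≤ C * (1 / η + 1 / η) := by gcongr
      _ = _ := by ring
  have b2 : ‖(χ ^ 2).LFunction (1 + η + 2 * Complex.I * t)‖ ≤ C * (1 + 1 / a) * l := by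
    set z : ℂ := 1 + η + 2 * Complex.I * t with hz
    have hzre : z.re = 1 + η := by simp [hz]
    have hzim : z.im = 2 * t := by simp [hz]
    have hUz := hU l m (χ ^ 2) z hl hm (by rw [hzre]; have : 0 < 1 / l := by positivity
                                           linarith) (by
      refine (esz_norm_aux _ (2 * Real.exp l) ?_ ?_).trans ?_
      · rw [hzre]; simp [abs_of_pos hη0]; linarith
      · rw [hzim, abs_mul]; simpa using hst
      · linarith)
    have hp : 0 ≤ 1 / a := by positivity
    rcases hχ with h | h
    · refine (hUz.1 h).trans ?_
      gcongr; nlinarith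
    · have hzn : a / l ≤ ‖z - 1‖ := by
        refine h.trans (le_trans ?_ (Complex.abs_im_le_norm _))
        rw [Complex.sub_im, hzim, Complex.one_im, sub_zero, abs_mul]
        simp; linarith [abs_nonneg t]
      have hn : 0 < ‖z - 1‖ := lt_of_lt_of_le (by positivity) hzn
      refine (hUz.2 (fun h => by simp [h] at hn)).trans ?_
      rw [mul_assoc]
      gcongr
      have h6 : 1 / ‖z - 1‖ ≤ 1 / (a / l) := one_div_le_one_div_of_le (by positivity) hzn
      have h7 : 1 / (a / l) = 1 / a * l := by field_simp
      linarith
  set V := ‖χ.LFunction s'‖ with hV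
  have hV4 : (4 * D * η * l ^ 2) ^ 4 ≤ V ^ 4 := by
    rw [norm_mul, norm_mul, norm_pow, norm_pow] at hprod
    have h1 : 1 ≤ (2 * C / η) ^ 3 * V ^ 4 * (C * (1 + 1 / a) * l) := by
      refine hprod.trans ?_
      gcongr
    have h2 : (2 * C / η) ^ 3 * V ^ 4 * (C * (1 + 1 / a) * l) = K * l * V ^ 4 / η ^ 3 := by
      rw [hK]; field_simp
    rw [h2, le_div_iff₀ (by positivity), one_mul] at h1
    have h3 : (4 * D * η * l ^ 2) ^ 4 * (K * l) = η ^ 3 * ((η * l ^ 9) * (256 * K * D ^ 4)) := by ring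
    have h4 : (4 * D * η * l ^ 2) ^ 4 * (K * l) = η ^ 3 := by
      rw [h3, hηl]; field_simp
    have h5 : (4 * D * η * l ^ 2) ^ 4 * (K * l) ≤ V ^ 4 * (K * l) := by rw [h4]; linarith
    exact le_of_mul_le_mul_right h5 (by positivity)
  have hV1 : 4 * D * η * l ^ 2 ≤ V := by
    rwa [pow_le_pow_iff_left₀ (by positivity) (norm_nonneg _) (by norm_num)] at hV4
  have hlip : ‖χ.LFunction s' - χ.LFunction s‖ ≤ D * l ^ 2 * ‖s' - s‖ := by
    apply esz_lip
    intro z hz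
    have hsre : 1 - η ≤ s.re ∧ s.re ≤ 1 + η := by rw [abs_le] at hs; constructor <;> linarith
    have hre : z.re ∈ Set.Icc (1 - η) (1 + η) := by
      have : Convex ℝ {w : ℂ | w.re ∈ Set.Icc (1 - η) (1 + η)} :=
        (convex_Icc _ _).linear_preimage Complex.reLm
      exact this.segment_subset (x := s) (y := s') ⟨hsre.1, hsre.2⟩ (by
        rw [Set.mem_setOf_eq, hs're]; constructor <;> linarith) hz
    have him : z.im = t := by
      have : Convex ℝ {w : ℂ | w.im ∈ ({t} : Set ℝ)} :=
        (convex_singleton t).linear_preimage Complex.imLm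
      have := this.segment_subset (x := s) (y := s') rfl hs'im hz
      simpa using this
    have hc : χ ≠ 1 ∨ a / l ≤ ‖z - 1‖ := by
      rcases hχ1 with h | h
      · exact Or.inl h
      · right
        refine h.trans (le_trans ?_ (Complex.abs_im_le_norm _))
        simp [him]
    refine ⟨DirichletCharacter.differentiableAt_LFunction χ z ?_, ?_⟩
    · rcases hc with h | h
      · exact Or.inr h
      · left
        rintro rfl
        simp at h
        have : 0 < a / l := by positivity
        linarith
    · refine hDer l m χ z hl hm (by linarith [hre.1]) ?_ hc
      have := esz_norm_aux z (Real.exp l) (by rw [abs_le]; constructor <;> linarith [hre.1, hre.2]) (by rw [him]; exact hst)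
      linarith [Real.exp_pos l]
  have hdist : ‖s' - s‖ ≤ 2 * η := by
    have : s' - s = ((1 + η - s.re : ℝ) : ℂ) := by
      apply Complex.ext
      · simp [hs're]
      · simp [hs'im, ht]
    rw [this, Complex.norm_real, Real.norm_eq_abs]
    rw [abs_le] at hs ⊢; constructor <;> linarith
  have h9 : V ≤ ‖χ.LFunction s‖ + ‖χ.LFunction s' - χ.LFunction s‖ := norm_le_norm_add_norm_sub' _ _
  have h10 : D * l ^ 2 * ‖s' - s‖ ≤ D * l ^ 2 * (2 * η) := by gcongr
  have h11 : 2 * D * (1 / (256 * K * D ^ 4)) / l ^ 7 = 2 * D * η * l ^ 2 := by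
    rw [hη]; field_simp
  rw [h11]
  linarith


lemma esz_f_eq {m : ℕ} [NeZero m] (χ : DirichletCharacter ℂ m) {s : ℂ} (hs : 1 < s.re) :
    riemannZeta s * χ.LFunction s = LSeries χ.zetaMul s := by
  rw [DirichletCharacter.zetaMul, ← ArithmeticFunction.coe_mul, LSeries_convolution']
  · simp only [χ.LFunction_eq_LSeries hs]
    congr 1
    · simp_rw [← ArithmeticFunction.LSeries_zeta_eq_riemannZeta hs, ← ArithmeticFunction.natCoe_apply]
    · exact LSeries_congr χ.apply_eq_toArithmeticFunction_apply s
  · exact ArithmeticFunction.LSeriesSummable_zeta_iff.mpr hs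
  · exact (LSeriesSummable_congr _ fun h ↦ (χ.apply_eq_toArithmeticFunction_apply h).symm).mpr <|
      ZMod.LSeriesSummable_of_one_lt_re χ hs

open ComplexOrder in
lemma esz_alpha {m : ℕ} [NeZero m] (χ : DirichletCharacter ℂ m) (hχ : χ ^ 2 = 1) (k : ℕ) :
    ∃ α : ℝ, 0 ≤ α ∧ (-1) ^ k * iteratedDeriv k (LSeries χ.zetaMul) 2 = (α : ℂ) := by
  have h1 : LSeries.abscissaOfAbsConv χ.zetaMul < ((2 : ℝ) : EReal) := by
    refine lt_of_le_of_lt (LSeries.abscissaOfAbsConv_le_of_forall_lt_LSeriesSummable (x := (3 / 2 : ℝ)) ?_) ?_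
    · intro y hy
      exact χ.LSeriesSummable_zetaMul (by simp; linarith)
    · exact_mod_cast (by norm_num : (3 / 2 : ℝ) < 2)
  have h2 := LSeries.iteratedDeriv_alternating (a := χ.zetaMul) (fun n => χ.zetaMul_nonneg hχ n) h1 k
  rw [Complex.ofReal_ofNat] at h2
  refine ⟨((-1) ^ k * iteratedDeriv k (LSeries χ.zetaMul) 2).re, (Complex.nonneg_iff.1 h2).1, ?_⟩
  exact Complex.ext (by simp only [Complex.ofReal_re]) (by rw [Complex.ofReal_im]; exact (Complex.nonneg_iff.1 h2).2.symm)

open ComplexOrder in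
lemma esz_alpha0 {m : ℕ} [NeZero m] (χ : DirichletCharacter ℂ m) (hχ : χ ^ 2 = 1) :
    1 ≤ (LSeries χ.zetaMul 2).re := by
  have hs : LSeriesSummable χ.zetaMul 2 := χ.LSeriesSummable_zetaMul (by simp)
  have hs' : Summable (LSeries.term χ.zetaMul 2) := hs
  rw [LSeries, Complex.re_tsum hs']
  have h1 : (LSeries.term χ.zetaMul 2 1).re = 1 := by
    rw [LSeries.term_of_ne_zero one_ne_zero]
    simp [χ.isMultiplicative_zetaMul.map_one]
  have hnn : ∀ n, 0 ≤ (LSeries.term χ.zetaMul 2 n).re := by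
    intro n
    have : 0 ≤ LSeries.term χ.zetaMul ((2 : ℝ) : ℂ) n := by
      rw [LSeries.term_def]
      split_ifs with h
      · exact le_rfl
      · exact mul_nonneg (χ.zetaMul_nonneg hχ n) (Complex.inv_natCast_cpow_ofReal_pos h 2).le
    rw [Complex.ofReal_ofNat] at this
    exact (Complex.nonneg_iff.1 this).1
  have hsre : Summable fun n => (LSeries.term χ.zetaMul 2 n).re := (Complex.hasSum_re hs'.hasSum).summable
  have := hsre.le_tsum 1 (fun j _ => hnn j)
  linarith

lemma esz_chi_real {m : ℕ} (χ : DirichletCharacter ℂ m) (hχ : χ ^ 2 = 1) (n : ZMod m) :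
    (starRingEnd ℂ) (χ n) = χ n := by
  have h1 : χ⁻¹ = χ := by
    rw [inv_eq_iff_mul_eq_one, ← sq, hχ]
  have h2 := MulChar.star_apply' χ n
  rw [h1] at h2
  simpa using h2

lemma esz_L_real {m : ℕ} [NeZero m] (χ : DirichletCharacter ℂ m) (hχ : χ ^ 2 = 1) (hχ1 : χ ≠ 1)
    (x : ℝ) (hx : 1 / 4 < x) : (χ.LFunction x).im = 0 := by
  have h := esz_L_sum (fun j => χ j) (fun j => (χ.norm_le_one j).trans (by norm_num))
    (MulChar.sum_eq_zero_of_ne_one hχ1) (x : ℂ) (by simpa using hx)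
  have h2 := Complex.hasSum_im h
  have him : ∀ j, (χ j).im = 0 := fun j => Complex.conj_eq_iff_im.1 (esz_chi_real χ hχ j)
  refine h2.unique ?_
  convert hasSum_zero with n
  rw [← Complex.ofReal_neg, ← Complex.ofReal_cpow (by positivity), ← Complex.ofReal_cpow (by positivity),
    ← Complex.ofReal_sub, Complex.mul_im]
  simp only [Complex.ofReal_im, mul_zero, zero_add, Complex.im_sum, him, Finset.sum_const_zero, zero_mul]

lemma esz_R0 : ∃ A : ℝ, 1 ≤ A ∧ ∀ (l : ℝ) (m : ℕ) [NeZero m] (χ : DirichletCharacter ℂ m),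
    2 ≤ l → (m : ℝ) ≤ Real.exp l → χ ≠ 1 → χ ^ 2 = 1 →
    ∃ (α : ℕ → ℝ) (K : ℕ), (K : ℝ) ≤ A * l ∧ 1 ≤ K ∧ (∀ k, 0 ≤ α k) ∧ 1 ≤ α 0 ∧
      ∀ s : ℂ, s ≠ 1 → ‖s - 2‖ ≤ 9 / 8 →
      ‖riemannZeta s * χ.LFunction s - ∑ k ∈ Finset.range K, (α k : ℂ) * (2 - s) ^ k
        - χ.LFunction 1 * (2 - s) ^ K / (s - 1)‖ ≤ 1 / 16 := by
  have hZ := eszZ_nonneg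
  set B0 : ℝ := 4 * ((1 + 12 * eszZ) * (8 * eszZ) + 2 * eszZ) + 1 with hB0
  have hB0p : 1 ≤ B0 := by
    have : 0 ≤ (1 + 12 * eszZ) * (8 * eszZ) + 2 * eszZ := by positivity
    linarith
  refine ⟨11 + 1600 * B0, by linarith, ?_⟩
  intro l m _ χ hl hm hχ1 hχ2
  have hm0 : (0 : ℝ) ≤ m := Nat.cast_nonneg m
  have hLd := DirichletCharacter.differentiable_LFunction hχ1
  set L1 := χ.LFunction 1 with hL1
  set G : ℂ → ℂ := fun s => riemannZeta₁ s * χ.LFunction s with hG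
  have hGd : Differentiable ℂ G := differentiable_riemannZeta₁.mul hLd
  have hG1 : G 1 = L1 := by simp [hG, riemannZeta₁_one, hL1]
  set F : ℂ → ℂ := dslope G 1 with hF
  have hFd : Differentiable ℂ F := by
    rw [← differentiableOn_univ]
    exact (Complex.differentiableOn_dslope Filter.univ_mem).2 hGd.differentiableOn
  have hFs : ∀ s : ℂ, s ≠ 1 → F s = riemannZeta s * χ.LFunction s - L1 * (s - 1)⁻¹ := by
    intro s hs
    rw [hF, dslope_of_ne _ hs, slope_def_field, hG1, riemannZeta_eq_inv_sub_mul hs, hG]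
    field_simp
  have hcr : ∀ z : ℂ, 1 / 2 ≤ z.re → ‖χ.LFunction z‖ ≤ 2 * m * ‖z‖ * eszZ := fun z hz =>
    esz_L_crude (fun j => χ j) (fun j => (χ.norm_le_one j).trans (by norm_num))
      (MulChar.sum_eq_zero_of_ne_one hχ1) z hz
  have hB : ∀ z ∈ Metric.sphere (2 : ℂ) (5 / 4), ‖F z‖ ≤ B0 * Real.exp l := by
    intro z hz
    rw [mem_sphere_iff_norm] at hz
    have hre : 3 / 4 ≤ z.re := by
      have := (Complex.abs_re_le_norm (z - 2)).trans hz.le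
      rw [Complex.sub_re, abs_le] at this
      have h2 : (2 : ℂ).re = 2 := rfl
      linarith [this.1]
    have hz1 : 1 / 4 ≤ ‖z - 1‖ := by
      have := norm_sub_le (z - 1) 1
      rw [show z - 1 - 1 = z - 2 by ring, hz, norm_one] at this
      linarith
    have hz3 : ‖z - 1‖ ≤ 3 := by
      have := norm_add_le (z - 2) 1
      rw [show z - 2 + 1 = z - 1 by ring, hz, norm_one] at this
      linarith
    have hz4 : ‖z‖ ≤ 4 := by
      have := norm_add_le (z - 2) 2
      rw [sub_add_cancel, hz] at this
      have h2 : ‖(2 : ℂ)‖ = 2 := by simp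
      linarith
    have hne : z ≠ 1 := by rintro rfl; simp at hz1; linarith
    have h1 := (esz_zeta1_crude z (by linarith))
    have h1' : ‖riemannZeta₁ z‖ ≤ 1 + 12 * eszZ := by
      refine h1.trans ?_
      have : ‖z - 1‖ * ‖z‖ ≤ 3 * 4 := by gcongr
      nlinarith
    have h2 : ‖χ.LFunction z‖ ≤ 8 * eszZ * Real.exp l := by
      refine (hcr z (by linarith)).trans ?_
      calc _ ≤ 2 * Real.exp l * 4 * eszZ := by gcongr
        _ = _ := by ring
    have h3 : ‖L1‖ ≤ 2 * eszZ * Real.exp l := by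
      refine (hcr 1 (by norm_num)).trans ?_
      rw [norm_one]
      calc _ ≤ 2 * Real.exp l * 1 * eszZ := by gcongr
        _ = _ := by ring
    rw [hF, dslope_of_ne _ hne, slope_def_field, hG1, norm_div, div_le_iff₀ (by linarith)]
    have h4 : ‖G z - L1‖ ≤ (1 + 12 * eszZ) * (8 * eszZ * Real.exp l) + 2 * eszZ * Real.exp l := by
      refine (norm_sub_le _ _).trans ?_
      rw [hG, norm_mul]
      gcongr
    have hBe : 0 ≤ B0 * Real.exp l := by positivity
    have h5 : B0 * Real.exp l * (1 / 4) ≤ B0 * Real.exp l * ‖z - 1‖ := by gcongr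
    refine h4.trans (le_trans ?_ h5)
    rw [hB0]
    nlinarith [Real.exp_pos l]
  have hder : ∀ k, ‖iteratedDeriv k F 2‖ ≤ k.factorial * (B0 * Real.exp l) / (5 / 4) ^ k := fun k =>
    Complex.norm_iteratedDeriv_le_of_forall_mem_sphere_norm_le k (by norm_num) hFd.diffContOnCl hB
  choose α' hα0 hα using fun k => esz_alpha χ hχ2 k
  have hrel : ∀ k, iteratedDeriv k F 2 = (-1) ^ k * (α' k : ℂ) - (-1) ^ k * k.factorial * L1 := by
    intro k
    have hev : F =ᶠ[nhds 2] fun s => LSeries χ.zetaMul s - L1 * (s - 1)⁻¹ := by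
      have : ∀ᶠ z : ℂ in nhds 2, 1 < z.re :=
        (Complex.continuous_re.isOpen_preimage _ isOpen_Ioi).mem_nhds (by simp)
      filter_upwards [this] with z hz
      rw [hFs z (by rintro rfl; simp at hz), esz_f_eq χ hz]
    have hcd1 : ContDiffAt ℂ k (fun s : ℂ => L1 * (s - 1)⁻¹) 2 :=
      contDiffAt_const.mul ((contDiffAt_id.sub contDiffAt_const).inv (by norm_num))
    have hcd2 : ContDiffAt ℂ k (LSeries χ.zetaMul) 2 := by
      have : LSeries χ.zetaMul =ᶠ[nhds 2] fun s => F s + L1 * (s - 1)⁻¹ := by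
        filter_upwards [hev] with z hz
        rw [hz]; ring
      exact (hFd.contDiff.contDiffAt.add hcd1).congr_of_eventuallyEq this
    rw [hev.iteratedDeriv_eq, iteratedDeriv_fun_sub hcd2 hcd1]
    congr 1
    · rw [← hα k, ← mul_assoc, ← pow_add, Even.neg_one_pow ⟨k, rfl⟩, one_mul]
    · have h1 := iter_deriv_inv_linear_sub k (1 : ℂ) 1
      rw [iteratedDeriv_const_mul_field, iteratedDeriv_eq_iterate]
      simp only [one_mul, one_pow, mul_one] at h1
      rw [h1]
      norm_num
      ring
  set K : ℕ := ⌈10 * l + 1600 * B0⌉₊ with hK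
  have hKl : 10 * l + 1600 * B0 ≤ K := Nat.le_ceil _
  refine ⟨fun k => α' k / k.factorial, K, ?_, ?_, fun k => div_nonneg (hα0 k) (by positivity), ?_, ?_⟩
  · have := (Nat.ceil_lt_add_one (by positivity : 0 ≤ 10 * l + 1600 * B0)).le
    rw [← hK] at this
    nlinarith
  · rw [hK, Nat.one_le_ceil_iff]; positivity
  · have h1 := hα 0
    simp at h1
    have h2 := esz_alpha0 χ hχ2
    rw [h1] at h2
    simpa using h2
  intro s hs hs2
  have hts := Complex.hasSum_taylorSeries_of_entire hFd 2 s
  have hbnd : ∀ k : ℕ, ‖((k + K).factorial : ℂ)⁻¹ • (s - 2) ^ (k + K) • iteratedDeriv (k + K) F 2‖ ≤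
      B0 * Real.exp l * (9 / 10) ^ K * (9 / 10) ^ k := by
    intro k
    rw [norm_smul, norm_smul, norm_inv, norm_pow, Complex.norm_natCast]
    have hf0 : (0 : ℝ) < ((k + K).factorial : ℝ) := by exact_mod_cast Nat.factorial_pos _
    calc _ ≤ ((k + K).factorial : ℝ)⁻¹ * ((9 / 8) ^ (k + K) * ((k + K).factorial * (B0 * Real.exp l) / (5 / 4) ^ (k + K))) := by
          gcongr
          exact hder _
      _ = B0 * Real.exp l * ((9 / 8) ^ (k + K) / (5 / 4) ^ (k + K)) := by field_simp
      _ = B0 * Real.exp l * (9 / 10) ^ (k + K) := by rw [← div_pow]; norm_num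
      _ = _ := by rw [pow_add]; ring
  have hsum := (hasSum_nat_add_iff' K).2 hts
  have hgeo : HasSum (fun k : ℕ => B0 * Real.exp l * (9 / 10) ^ K * (9 / 10) ^ k)
      (B0 * Real.exp l * (9 / 10) ^ K * (1 - 9 / 10)⁻¹) :=
    (hasSum_geometric_of_lt_one (by norm_num) (by norm_num)).mul_left _
  have htail := tsum_of_norm_bounded hgeo hbnd
  rw [hsum.tsum_eq] at htail
  have hsmall : B0 * Real.exp l * (9 / 10) ^ K * (1 - 9 / 10)⁻¹ ≤ 1 / 16 := by
    have h1 : (9 / 10 : ℝ) ^ K ≤ Real.exp (-(l + 160 * B0)) := by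
      have : (9 / 10 : ℝ) ≤ Real.exp (-(1 / 10)) := by
        have := Real.add_one_le_exp (-(1 / 10) : ℝ); linarith
      calc (9 / 10 : ℝ) ^ K ≤ (Real.exp (-(1 / 10))) ^ K := by gcongr
        _ = Real.exp (-(K / 10)) := by rw [← Real.exp_nat_mul]; ring_nf
        _ ≤ _ := Real.exp_le_exp.2 (by linarith)
    have h2 : B0 * 160 ≤ Real.exp (160 * B0) := by linarith [Real.add_one_le_exp (160 * B0)]
    calc B0 * Real.exp l * (9 / 10) ^ K * (1 - 9 / 10)⁻¹
        ≤ B0 * Real.exp l * Real.exp (-(l + 160 * B0)) * (1 - 9 / 10)⁻¹ := by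
          gcongr
      _ = B0 * 160 * (Real.exp l * Real.exp (-(l + 160 * B0))) / 16 := by norm_num; ring
      _ = B0 * 160 * Real.exp (-(160 * B0)) / 16 := by rw [← Real.exp_add]; ring_nf
      _ ≤ Real.exp (160 * B0) * Real.exp (-(160 * B0)) / 16 := by gcongr
      _ = 1 / 16 := by rw [← Real.exp_add]; simp
  refine le_trans (le_of_eq ?_) (htail.trans hsmall)
  congr 1
  have hs1 : s - 1 ≠ 0 := sub_ne_zero.2 hs
  rw [hFs s hs]
  have hterm : ∀ k : ℕ, ((k.factorial : ℂ)⁻¹ • (s - 2) ^ k • iteratedDeriv k F 2) =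
      ((α' k / k.factorial : ℝ) : ℂ) * (2 - s) ^ k - L1 * (2 - s) ^ k := by
    intro k
    have hf0 : (k.factorial : ℂ) ≠ 0 := by exact_mod_cast Nat.factorial_ne_zero _
    rw [hrel k, smul_eq_mul, smul_eq_mul, show (2 - s) = (-1) * (s - 2) by ring, mul_pow]
    push_cast
    field_simp
  simp only [hterm, Finset.sum_sub_distrib, ← Finset.mul_sum]
  have hgs : (∑ k ∈ Finset.range K, (2 - s) ^ k) = (1 - (2 - s) ^ K) / (s - 1) := by
    rw [eq_div_iff hs1]
    have := geom_sum_mul (2 - s) K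
    linear_combination -this
  rw [hgs]
  field_simp
  ring


lemma esz_pow_sub (w : ℂ) (k : ℕ) : ‖(1 - w) ^ k - 1‖ ≤ (1 + ‖w‖) ^ k - 1 := by
  induction k with
  | zero => simp
  | succ k ih =>
    have h1 : (1 - w) ^ (k + 1) - 1 = (1 - w) * ((1 - w) ^ k - 1) - w := by ring
    rw [h1]
    refine (norm_sub_le _ _).trans ?_
    rw [norm_mul]
    have h2 : ‖1 - w‖ ≤ 1 + ‖w‖ := (norm_sub_le _ _).trans (by simp)
    have h3 : ‖1 - w‖ * ‖(1 - w) ^ k - 1‖ ≤ (1 + ‖w‖) * ((1 + ‖w‖) ^ k - 1) := by gcongr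
    calc _ ≤ (1 + ‖w‖) * ((1 + ‖w‖) ^ k - 1) + ‖w‖ := by linarith
      _ = _ := by ring

lemma esz_R01 : ∃ a' : ℝ, 0 < a' ∧ a' ≤ 1 / 20 ∧ ∀ (l : ℝ) (m : ℕ) [NeZero m]
    (χ : DirichletCharacter ℂ m), 2 ≤ l → (m : ℝ) ≤ Real.exp l → χ ≠ 1 → χ ^ 2 = 1 →
    ∃ S : ℝ, 1 ≤ S ∧ ∀ s : ℂ, ‖s - 1‖ ≤ a' / l →
      ‖riemannZeta₁ s * χ.LFunction s - (S * (s - 1) + χ.LFunction 1)‖ ≤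
        (S * ‖s - 1‖ + ‖χ.LFunction 1‖) / 10 + ‖s - 1‖ / 16 := by
  obtain ⟨A, hA, hR⟩ := esz_R0
  refine ⟨1 / (20 * A), by positivity, one_div_le_one_div_of_le (by norm_num) (by linarith), ?_⟩
  intro l m _ χ hl hm hχ1 hχ2
  obtain ⟨α, K, hK, hK1, hα, hα0, h⟩ := hR l m χ hl hm hχ1 hχ2
  refine ⟨∑ k ∈ Finset.range K, α k, ?_, ?_⟩
  · exact hα0.trans (Finset.single_le_sum (fun k _ => hα k) (Finset.mem_range.2 hK1))
  intro s hs
  by_cases hs1 : s = 1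
  · subst hs1; simp [riemannZeta₁_one]; positivity
  have h20 : 1 / (20 * A) / l ≤ 1 / 8 := by
    rw [div_div]
    exact one_div_le_one_div_of_le (by norm_num) (by nlinarith)
  have hs2 : ‖s - 2‖ ≤ 9 / 8 := by
    have := norm_sub_le (s - 1) 1
    rw [show s - 1 - 1 = s - 2 by ring, norm_one] at this
    linarith
  have hh := h s hs1 hs2
  set w := s - 1 with hw
  have hw0 : w ≠ 0 := sub_ne_zero.2 hs1
  have hwn : 0 < ‖w‖ := norm_pos_iff.2 hw0
  have h2s : 2 - s = 1 - w := by rw [hw]; ring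
  have hpow : ∀ k ≤ K, ‖(1 - w) ^ k - 1‖ ≤ 1 / 10 := by
    intro k hk
    refine (esz_pow_sub w k).trans ?_
    have h1 : (1 + ‖w‖) ^ k ≤ Real.exp (1 / 20) := by
      calc (1 + ‖w‖) ^ k ≤ (Real.exp ‖w‖) ^ k := by
            gcongr; linarith [Real.add_one_le_exp ‖w‖]
        _ = Real.exp (k * ‖w‖) := by rw [← Real.exp_nat_mul]
        _ ≤ _ := by
          apply Real.exp_le_exp.2
          have hkK : (k : ℝ) ≤ A * l := le_trans (by exact_mod_cast hk) hK
          calc (k : ℝ) * ‖w‖ ≤ (A * l) * (1 / (20 * A) / l) := by gcongr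
            _ = 1 / 20 := by field_simp
    have h2 : Real.exp (1 / 20) ≤ 1.1 := by
      have h3 := Real.add_one_le_exp (-(1 / 20) : ℝ)
      have h4 : Real.exp (1 / 20) * Real.exp (-(1 / 20)) = 1 := by rw [← Real.exp_add]; simp
      nlinarith [Real.exp_pos (1 / 20 : ℝ)]
    norm_num at h2 ⊢
    linarith
  rw [h2s, riemannZeta_eq_inv_sub_mul hs1, ← hw] at hh
  have e1 : riemannZeta₁ s * χ.LFunction s - ((∑ k ∈ Finset.range K, α k : ℝ) * w + χ.LFunction 1) =
      w * (w⁻¹ * riemannZeta₁ s * χ.LFunction s - ∑ k ∈ Finset.range K, (α k : ℂ) * (1 - w) ^ k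
        - χ.LFunction 1 * (1 - w) ^ K / w) + (w * ∑ k ∈ Finset.range K, (α k : ℂ) * ((1 - w) ^ k - 1)
        + χ.LFunction 1 * ((1 - w) ^ K - 1)) := by
    simp only [mul_sub, Finset.sum_sub_distrib, mul_one]
    push_cast
    field_simp
    ring
  rw [e1]
  refine (norm_add_le _ _).trans ?_
  have e2 : ‖w * (w⁻¹ * riemannZeta₁ s * χ.LFunction s - ∑ k ∈ Finset.range K, (α k : ℂ) * (1 - w) ^ k
        - χ.LFunction 1 * (1 - w) ^ K / w)‖ ≤ ‖w‖ * (1 / 16) := by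
    rw [norm_mul]; gcongr
  have e3 : ‖∑ k ∈ Finset.range K, (α k : ℂ) * ((1 - w) ^ k - 1)‖ ≤ (∑ k ∈ Finset.range K, α k) * (1 / 10) := by
    refine (norm_sum_le _ _).trans ?_
    rw [Finset.sum_mul]
    refine Finset.sum_le_sum fun k hk => ?_
    rw [norm_mul, Complex.norm_real, Real.norm_of_nonneg (hα k)]
    exact mul_le_mul_of_nonneg_left (hpow k (Finset.mem_range.1 hk).le) (hα k)
  have e4 : ‖w * ∑ k ∈ Finset.range K, (α k : ℂ) * ((1 - w) ^ k - 1) + χ.LFunction 1 * ((1 - w) ^ K - 1)‖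
      ≤ ‖w‖ * ((∑ k ∈ Finset.range K, α k) * (1 / 10)) + ‖χ.LFunction 1‖ * (1 / 10) := by
    refine (norm_add_le _ _).trans ?_
    rw [norm_mul, norm_mul]
    gcongr
    exact hpow K le_rfl
  calc _ ≤ _ := add_le_add e2 e4
    _ = _ := by ring

lemma esz_zeta1_near : ∃ r : ℝ, 0 < r ∧ r ≤ 1 ∧ ∀ s : ℂ, ‖s - 1‖ ≤ r → ‖riemannZeta₁ s - 1‖ ≤ 1 / 2 := by
  have hc := differentiable_riemannZeta₁.continuous.continuousAt (x := 1)
  rw [Metric.continuousAt_iff] at hc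
  obtain ⟨d, hd, h⟩ := hc (1 / 2) (by norm_num)
  refine ⟨min (d / 2) 1, by positivity, min_le_right _ _, fun s hs => ?_⟩
  have := h (x := s) (by rw [dist_eq_norm]; exact lt_of_le_of_lt (hs.trans (min_le_left _ _)) (by linarith))
  rw [dist_eq_norm, riemannZeta₁_one] at this
  exact this.le

lemma esz_L_pos {m : ℕ} [NeZero m] (χ : DirichletCharacter ℂ m) (hχ : χ ^ 2 = 1) (hχ1 : χ ≠ 1)
    (b : ℝ) (hb : 1 / 4 < b) (hb1 : b < 1)
    (H : ∀ β : ℝ, b ≤ β → β < 1 → χ.LFunction β ≠ 0) :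
    ∀ x : ℝ, b ≤ x → x ≤ 2 → 0 < (χ.LFunction x).re := by
  have hne : ∀ x : ℝ, b ≤ x → (χ.LFunction x).re ≠ 0 := by
    intro x hx h0
    have : χ.LFunction x = 0 := Complex.ext h0 (esz_L_real χ hχ hχ1 x (by linarith))
    by_cases h1 : x < 1
    · exact H x hx h1 this
    · exact DirichletCharacter.LFunction_ne_zero_of_one_le_re χ (Or.inl hχ1) (by simpa using h1) this
  have h2 : 0 < (χ.LFunction (2 : ℝ)).re := by
    have h1 := esz_alpha0 χ hχ
    rw [← esz_f_eq χ (by simp)] at h1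
    have h3 := riemannZeta_re_pos_of_one_lt (x := 2) (by norm_num)
    have h4 := riemannZeta_im_eq_zero_of_one_lt (x := 2) (by norm_num)
    rw [Complex.mul_re] at h1
    rw [Complex.ofReal_ofNat] at h3 h4 ⊢
    rw [h4] at h1
    by_contra hcon
    push Not at hcon
    nlinarith
  intro x hx hx2
  by_contra hcon
  push Not at hcon
  have hcont : ContinuousOn (fun x : ℝ => (χ.LFunction x).re) (Set.Icc x 2) :=
    (Complex.continuous_re.comp ((DirichletCharacter.differentiable_LFunction hχ1).continuous.comp
      Complex.continuous_ofReal)).continuousOn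
  obtain ⟨y, hy, hy0⟩ := intermediate_value_Icc hx2 hcont ⟨hcon, h2.le⟩
  exact hne y (hx.trans hy.1) hy0

lemma esz_hsq_aux (x y r : ℝ) (hx : 0 ≤ x) (hy : 0 ≤ y) (hr : -(x * y / 5) ≤ r) :
    ((67 / 100) * (x + y)) ^ 2 ≤ x ^ 2 + r + y ^ 2 := by
  nlinarith [sq_nonneg (x - y), mul_nonneg hx hy]

lemma esz_hsq (S L1 : ℝ) (w : ℂ) (hS : 0 ≤ S) (hL : 0 ≤ L1) (hre : -(‖w‖ / 10) ≤ w.re) :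
    ((67 / 100) * (S * ‖w‖ + L1)) ^ 2 ≤ ‖(S : ℂ) * w + (L1 : ℂ)‖ ^ 2 := by
  rw [← Complex.normSq_eq_norm_sq, Complex.normSq_apply]
  have hn2 : ‖w‖ ^ 2 = w.re * w.re + w.im * w.im := by
    rw [← Complex.normSq_eq_norm_sq, Complex.normSq_apply]
  simp only [Complex.add_re, Complex.re_ofReal_mul, Complex.ofReal_re, Complex.add_im,
    Complex.im_ofReal_mul, Complex.ofReal_im, add_zero]
  have e1 : (S * w.re + L1) * (S * w.re + L1) + S * w.im * (S * w.im) =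
      (S * ‖w‖) ^ 2 + 2 * (S * L1) * w.re + L1 ^ 2 := by rw [mul_pow, hn2]; ring
  rw [e1]
  apply esz_hsq_aux _ _ _ (by positivity) hL
  have e2 : 2 * (S * L1) * (-(‖w‖ / 10)) ≤ 2 * (S * L1) * w.re := by gcongr
  linarith

set_option maxHeartbeats 1000000 in
lemma esz_R : ∃ a c₂ c l₀ : ℝ, 0 < a ∧ a ≤ 1 ∧ 0 < c₂ ∧ 0 < c ∧ 2 ≤ l₀ ∧
    ∀ (l : ℝ) (m : ℕ) [NeZero m] (χ : DirichletCharacter ℂ m) (s : ℂ), l₀ ≤ l →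
    (m : ℝ) ≤ Real.exp l → χ ≠ 1 → χ ^ 2 = 1 →
    (∀ β : ℝ, 1 - 1 / l < β → β < 1 → χ.LFunction β ≠ 0) →
    |s.re - 1| ≤ c₂ / l ^ 9 → |s.im| ≤ a / l → c / l ^ 3 ≤ ‖χ.LFunction s‖ := by
  obtain ⟨a', ha', ha'1, hR⟩ := esz_R01
  obtain ⟨r, hr, hr1, hnear⟩ := esz_zeta1_near
  obtain ⟨D, hD, hDer⟩ := esz_deriv 1 one_pos le_rfl
  have hD0 : 0 < D := by linarith
  set c1 : ℝ := a' / 2 with hc1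
  set b : ℝ := c1 / (2 * D) with hb
  have hb0 : 0 < b := by positivity
  refine ⟨a' / 2, min (a' / 2) (b / 10), min (c1 / 2) (b / 3), 2 + 1 / r, by positivity, by linarith,
    by positivity, by positivity, by have : 0 < 1 / r := by positivity
                                     linarith, ?_⟩
  intro l m _ χ s hl hm hχ1 hχ2 H hs1 hs2
  have hl2 : 2 ≤ l := by have : 0 < 1 / r := by positivity
                         linarith
  have hl0 : 0 < l := by linarith
  have hrl : a' / l ≤ r := by
    have : 1 / r ≤ l := by linarith
    rw [div_le_iff₀ hr] at this
    rw [div_le_iff₀ hl0]; linarith [mul_comm l r]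
  have hal8 : a' / l ≤ 1 / 8 := by
    rw [div_le_iff₀ hl0]; linarith
  obtain ⟨S, hS, hRS⟩ := hR l m χ hl2 hm hχ1 hχ2
  have hpos := esz_L_pos χ hχ2 hχ1 (1 - a' / l) (by linarith) (by have : 0 < a' / l := by positivity
                                                                  linarith)
    (fun β hβ hβ1 => H β (by
      have : a' / l < 1 / l := by gcongr; linarith
      linarith) hβ1)
  set u := a' / l with hu
  have hu0 : 0 < u := by positivity
  have hL1im : (χ.LFunction 1).im = 0 := by
    have := esz_L_real χ hχ2 hχ1 1 (by norm_num); simpa using this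
  have hL1p : 0 < (χ.LFunction 1).re := by
    have := hpos 1 (by linarith) (by norm_num); simpa using this
  set L1 := (χ.LFunction 1).re with hL1
  have hL1e : χ.LFunction 1 = (L1 : ℂ) := Complex.ext rfl hL1im
  have hL1n : ‖χ.LFunction 1‖ = L1 := by rw [hL1e, Complex.norm_real, Real.norm_of_nonneg hL1p.le]
  -- lower bound for L(1)
  have hlow : c1 / l ≤ L1 := by
    have hβ := hpos (1 - u) le_rfl (by linarith)
    have hβi := esz_L_real χ hχ2 hχ1 (1 - u) (by linarith)
    have hw : (((1 - u : ℝ) : ℂ) - 1) = ((-u : ℝ) : ℂ) := by push_cast; ring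
    have hwn : ‖(((1 - u : ℝ) : ℂ) - 1)‖ = u := by
      rw [hw, Complex.norm_real, Real.norm_eq_abs, abs_neg, abs_of_pos hu0]
    have h1 := hRS ((1 - u : ℝ) : ℂ) hwn.le
    rw [hwn, hL1n] at h1
    have h2 := (Complex.abs_re_le_norm _).trans h1
    have h3 := hnear ((1 - u : ℝ) : ℂ) (by rw [hwn]; exact hrl)
    have h4 : 1 / 2 ≤ (riemannZeta₁ ((1 - u : ℝ) : ℂ)).re := by
      have := (Complex.abs_re_le_norm _).trans h3
      rw [Complex.sub_re, Complex.one_re, abs_le] at this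
      linarith [this.1]
    rw [hw, hL1e, Complex.sub_re, Complex.mul_re, hβi, Complex.add_re, Complex.re_ofReal_mul,
      Complex.ofReal_re, Complex.ofReal_re, mul_zero, sub_zero, abs_le] at h2
    have h5 : 0 < (riemannZeta₁ ((1 - u : ℝ) : ℂ)).re * (χ.LFunction ((1 - u : ℝ) : ℂ)).re := by
      apply mul_pos _ hβ; linarith
    have h6 : c1 / l = u / 2 := by rw [hc1, hu]; ring
    rw [h6]
    have hSu : u ≤ S * u := le_mul_of_one_le_left hu0.le hS
    have h7 := h2.2
    have h8 : S * -u = -(S * u) := by ring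
    linarith
  set w := s - 1 with hw
  have hwre : |w.re| ≤ min (a' / 2) (b / 10) / l ^ 9 := by simpa [hw] using hs1
  have hwim : |w.im| ≤ a' / 2 / l := by simpa [hw] using hs2
  have hl91 : (1 : ℝ) ≤ l ^ 6 := one_le_pow₀ (by linarith)
  have hl81 : (1 : ℝ) ≤ l ^ 8 := one_le_pow₀ (by linarith)
  have hwn : ‖w‖ ≤ a' / l := by
    refine (Complex.norm_le_abs_re_add_abs_im w).trans ?_
    have h1 : min (a' / 2) (b / 10) / l ^ 9 ≤ a' / 2 / l := by
      have : l ≤ l ^ 9 := le_self_pow₀ (by linarith) (by norm_num)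
      gcongr
      exact min_le_left _ _
    have : a' / l = a' / 2 / l + a' / 2 / l := by ring
    linarith
  by_cases hcase : ‖w‖ ≤ b / l ^ 3
  · have hlip : ‖χ.LFunction s - χ.LFunction 1‖ ≤ D * l ^ 2 * ‖s - 1‖ := by
      apply esz_lip
      intro z hz
      have hzb : ‖z - 1‖ ≤ a' / l := by
        have : segment ℝ 1 s ⊆ Metric.closedBall (1 : ℂ) (a' / l) :=
          (convex_closedBall _ _).segment_subset (by simp; positivity) (by
            rw [mem_closedBall_iff_norm]; exact hwn)
        exact mem_closedBall_iff_norm.1 (this hz)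
      refine ⟨DirichletCharacter.differentiable_LFunction hχ1 z, hDer l m χ z hl2 hm ?_ ?_ (Or.inl hχ1)⟩
      · have h1 := (Complex.abs_re_le_norm _).trans hzb
        rw [Complex.sub_re, Complex.one_re, abs_le] at h1
        have h2 : a' / l ≤ 1 / (2 * l) := by
          rw [div_le_div_iff₀ hl0 (by positivity)]; nlinarith
        linarith [h1.1]
      · have h1 := norm_add_le (z - 1) 1
        rw [sub_add_cancel, norm_one] at h1
        have := esz_exp_aux l hl2
        linarith [Real.exp_pos l]
    have h1 : D * l ^ 2 * ‖s - 1‖ ≤ D * l ^ 2 * (b / l ^ 3) := by gcongr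
    have h2 : D * l ^ 2 * (b / l ^ 3) = c1 / l / 2 := by rw [hb]; field_simp
    have h3 : ‖χ.LFunction 1‖ ≤ ‖χ.LFunction s‖ + ‖χ.LFunction s - χ.LFunction 1‖ := by
      rw [← norm_sub_rev]; exact norm_le_norm_add_norm_sub' _ _
    have h4 : min (c1 / 2) (b / 3) / l ^ 3 ≤ c1 / l / 2 := by
      have : l ≤ l ^ 3 := le_self_pow₀ (by linarith) (by norm_num)
      calc _ ≤ c1 / 2 / l := by gcongr; exact min_le_left _ _
        _ = _ := by ring
    linarith
  · push Not at hcase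
    have hP : 0 < ‖w‖ := lt_trans (by positivity) hcase
    have hre : -(‖w‖ / 10) ≤ w.re := by
      have h1 : min (a' / 2) (b / 10) / l ^ 9 ≤ b / l ^ 3 / 10 := by
        have : l ^ 3 ≤ l ^ 9 := pow_le_pow_right₀ (by linarith) (by norm_num)
        calc _ ≤ b / 10 / l ^ 3 := by gcongr; exact min_le_right _ _
          _ = _ := by ring
      have := (abs_le.1 hwre).1
      linarith
    have h1 := hRS s hwn
    rw [hL1n, hL1e, ← hw] at h1
    have hsq := esz_hsq S L1 w (by linarith) hL1p.le hre
    have h2 : (67 / 100) * (S * ‖w‖ + L1) ≤ ‖(S : ℂ) * w + (L1 : ℂ)‖ :=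
      (pow_le_pow_iff_left₀ (by positivity) (norm_nonneg _) (by norm_num)).1 hsq
    have h3 : ‖(S : ℂ) * w + (L1 : ℂ)‖ ≤ ‖riemannZeta₁ s * χ.LFunction s‖ +
        ‖riemannZeta₁ s * χ.LFunction s - ((S : ℂ) * w + (L1 : ℂ))‖ := by
      rw [norm_sub_rev (riemannZeta₁ s * χ.LFunction s)]; exact norm_le_norm_add_norm_sub' _ _
    have h4 : ‖w‖ / 2 ≤ ‖riemannZeta₁ s * χ.LFunction s‖ := by
      have hSw : ‖w‖ ≤ S * ‖w‖ := le_mul_of_one_le_left hP.le hS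
      linarith
    have h5 : ‖riemannZeta₁ s‖ ≤ 3 / 2 := by
      have h6 := hnear s (hwn.trans hrl)
      have := norm_add_le (riemannZeta₁ s - 1) 1
      rw [sub_add_cancel, norm_one] at this
      linarith
    rw [norm_mul] at h4
    have h7 : ‖riemannZeta₁ s‖ * ‖χ.LFunction s‖ ≤ 3 / 2 * ‖χ.LFunction s‖ := by gcongr
    have h8 : min (c1 / 2) (b / 3) / l ^ 3 ≤ b / l ^ 3 / 3 := by
      calc _ ≤ b / 3 / l ^ 3 := by gcongr; exact min_le_right _ _
        _ = _ := by ring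
    linarith


def eszH (l : ℝ) : Prop := ∀ (q : ℕ) [NeZero q] (χ : DirichletCharacter ℂ q), (q : ℝ) < Real.exp l →
        χ.IsPrimitive → (∀ n : ZMod q, (starRingEnd ℂ) (χ n) = χ n) →
        ∀ β : ℝ, 1 - 1 / l < β → β < 1 → DirichletCharacter.LFunction χ (β : ℂ) ≠ 0

lemma esz_factor_ne (p : ℕ) (hp : p.Prime) (z s : ℂ) (hz : ‖z‖ ≤ 1) (hs : 0 < s.re) :
    1 - z * (p : ℂ) ^ (-s) ≠ 0 := by
  intro h
  have h1 : z * (p : ℂ) ^ (-s) = 1 := (sub_eq_zero.mp h).symm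
  have h2 : ‖(p : ℂ) ^ (-s)‖ < 1 := by
    rw [Complex.norm_natCast_cpow_of_pos hp.pos]
    apply Real.rpow_lt_one_of_one_lt_of_neg
    · exact_mod_cast hp.one_lt
    · simpa using hs
  have h3 : ‖z * (p : ℂ) ^ (-s)‖ < 1 := by
    rw [norm_mul]
    nlinarith [norm_nonneg ((p : ℂ) ^ (-s)), norm_nonneg z]
  rw [h1] at h3
  simp at h3

lemma esz_transfer (l : ℝ) (hl : 2 ≤ l) (H : eszH l) (m : ℕ) [NeZero m] (χ : DirichletCharacter ℂ m)
    (hm : (m : ℝ) < Real.exp l) (h2 : χ ^ 2 = 1) (h1 : χ ≠ 1) (β : ℝ) (hβ : 1 - 1 / l < β)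
    (hβ1 : β < 1) : χ.LFunction β ≠ 0 := by
  have hd := χ.conductor_dvd_level
  have hc0 : χ.conductor ≠ 0 := fun h => by
    rw [h] at hd
    exact (NeZero.ne m) (Nat.eq_zero_of_zero_dvd hd)
  haveI : NeZero χ.conductor := ⟨hc0⟩
  set ψ := χ.primitiveCharacter with hψ
  have hch : DirichletCharacter.changeLevel hd ψ = χ := χ.changeLevel_primitiveCharacter
  have hψ2 : ψ ^ 2 = 1 := by
    apply DirichletCharacter.changeLevel_injective hd
    rw [map_pow, hch, h2, map_one]
  have hle : (χ.conductor : ℝ) < Real.exp l := by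
    refine lt_of_le_of_lt ?_ hm
    exact_mod_cast Nat.le_of_dvd (Nat.pos_of_ne_zero (NeZero.ne m)) hd
  have hβ0 : 0 < β := by
    have : 1 / l ≤ 1 / 2 := by gcongr
    linarith
  have hnz := H χ.conductor ψ hle χ.primitiveCharacter_isPrimitive
    (fun n => esz_chi_real ψ hψ2 n) β hβ hβ1
  rw [← hch, DirichletCharacter.LFunction_changeLevel hd ψ (Or.inr (by
    intro h; exact absurd (Complex.ofReal_eq_one.mp h) hβ1.ne))]
  refine mul_ne_zero hnz (Finset.prod_ne_zero_iff.mpr fun p hp => ?_)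
  exact esz_factor_ne p (Nat.prime_of_mem_primeFactors hp) _ _ (ψ.norm_le_one _) (by simpa using hβ0)

lemma esz_LB : ∃ c₂ c l₀ : ℝ, 0 < c₂ ∧ c₂ ≤ 1 ∧ 0 < c ∧ 2 ≤ l₀ ∧ ∀ (l : ℝ), l₀ ≤ l → eszH l →
    ∀ (m : ℕ) [NeZero m] (χ : DirichletCharacter ℂ m) (s : ℂ), (m : ℝ) < Real.exp l → χ ≠ 1 →
    |s.re - 1| ≤ c₂ / l ^ 9 → |s.im| ≤ Real.exp l → c / l ^ 7 ≤ ‖χ.LFunction s‖ := by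
  obtain ⟨a, d₂, d, l₀, ha, ha1, hd₂, hd, hl₀, hR⟩ := esz_R
  obtain ⟨e₂, e, he₂, he21, he, hZ⟩ := esz_Z a ha ha1
  refine ⟨min d₂ e₂, min d e, l₀, by positivity, (min_le_right _ _).trans he21, by positivity, hl₀, ?_⟩
  intro l hl H m _ χ s hm hχ hre him
  have hl2 : 2 ≤ l := hl₀.trans hl
  have hl0 : 0 < l := by linarith
  by_cases hc : χ ^ 2 ≠ 1 ∨ a / l ≤ |s.im|
  · refine le_trans ?_ (hZ l m χ s hl2 hm.le (hre.trans ?_) him hc)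
    · gcongr; exact min_le_right _ _
    · gcongr; exact min_le_right _ _
  · push Not at hc
    refine le_trans ?_ (hR l m χ s hl hm.le hχ hc.1
      (fun β h1 h2 => esz_transfer l hl2 H m χ hm hc.1 hχ β h1 h2) (hre.trans ?_) hc.2.le)
    · have : l ^ 3 ≤ l ^ 7 := pow_le_pow_right₀ (by linarith) (by norm_num)
      calc min d e / l ^ 7 ≤ d / l ^ 7 := by gcongr; exact min_le_left _ _
        _ ≤ d / l ^ 3 := by gcongr
    · gcongr; exact min_le_left _ _

lemma esz_zlb : ∃ c₂ c l₀ : ℝ, 0 < c₂ ∧ c₂ ≤ 1 ∧ 0 < c ∧ c ≤ 1 ∧ 2 ≤ l₀ ∧ ∀ (l : ℝ), l₀ ≤ l →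
    ∀ (s : ℂ), |s.re - 1| ≤ c₂ / l ^ 9 → |s.im| ≤ Real.exp l →
    c / l ^ 7 * ‖s - 1‖ ≤ ‖riemannZeta₁ s‖ ∧ c / l ^ 8 ≤ ‖riemannZeta₁ s‖ := by
  obtain ⟨r, hr, hr1, hnear⟩ := esz_zeta1_near
  obtain ⟨e₂, e, he₂, he21, he, hZ⟩ := esz_Z 1 one_pos le_rfl
  refine ⟨e₂, min e (1/2), max 2 (2 / r), he₂, he21, by positivity, (min_le_right _ _).trans (by norm_num), le_max_left _ _, ?_⟩
  intro l hl s hre him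
  have hl2 : 2 ≤ l := (le_max_left _ _).trans hl
  have hl0 : 0 < l := by linarith
  have hlr : 2 / l ≤ r := by
    have := (le_max_right _ _).trans hl
    rw [div_le_iff₀ hr] at this
    rw [div_le_iff₀ hl0]; linarith
  have hpow : ∀ k : ℕ, 1 ≤ l ^ k := fun k => one_le_pow₀ (by linarith)
  have hcm : 0 < min e (1/2) := by positivity
  have hsn : ‖s - 1‖ ≤ |s.re - 1| + |s.im| := by
    simpa using Complex.norm_le_abs_re_add_abs_im (s - 1)
  by_cases hc : 1 / l ≤ |s.im|
  · have h := hZ l 1 1 s hl2 (by simpa using hl0.le) hre him (Or.inr hc)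
    have hs1 : s ≠ 1 := by
      rintro rfl
      have : 0 < 1 / l := by positivity
      simp at hc; linarith
    have hn1 : 1 / l ≤ ‖s - 1‖ := hc.trans (by simpa using Complex.abs_im_le_norm (s - 1))
    have hk : ‖riemannZeta₁ s‖ = ‖s - 1‖ * ‖(1 : DirichletCharacter ℂ 1).LFunction s‖ := by
      rw [DirichletCharacter.LFunction_modOne_eq, riemannZeta_eq_inv_sub_mul hs1, norm_mul, norm_inv,
        mul_inv_cancel_left₀ (norm_ne_zero_iff.mpr (sub_ne_zero.mpr hs1))]
    have h1 : min e (1/2) / l ^ 7 * ‖s - 1‖ ≤ ‖riemannZeta₁ s‖ := by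
      rw [hk, mul_comm]
      gcongr
      refine le_trans ?_ h
      gcongr; exact min_le_left _ _
    refine ⟨h1, le_trans ?_ h1⟩
    calc min e (1/2) / l ^ 8 = min e (1/2) / l ^ 7 * (1 / l) := by field_simp
      _ ≤ _ := by gcongr
  · push Not at hc
    have h9 : e₂ / l ^ 9 ≤ 1 / l := by
      gcongr
      calc l = l ^ 1 := (pow_one l).symm
        _ ≤ l ^ 9 := pow_le_pow_right₀ (by linarith) (by norm_num)
    have hsr : ‖s - 1‖ ≤ r := by
      have : 2 / l = 1 / l + 1 / l := by ring
      linarith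
    have h12 : 1 / 2 ≤ ‖riemannZeta₁ s‖ := by
      have h3 := hnear s hsr
      have h4 : ‖(1 : ℂ)‖ ≤ ‖riemannZeta₁ s‖ + ‖riemannZeta₁ s - 1‖ := by
        rw [norm_sub_rev]
        calc ‖(1 : ℂ)‖ = ‖riemannZeta₁ s + (1 - riemannZeta₁ s)‖ := by ring_nf
          _ ≤ _ := norm_add_le _ _
      rw [norm_one] at h4; linarith
    have hb : ∀ k : ℕ, min e (1/2) / l ^ k ≤ 1 / 2 := fun k => by
      rw [div_le_iff₀ (by positivity)]
      have := min_le_right e (1/2)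
      nlinarith [hpow k]
    refine ⟨le_trans ?_ h12, (hb 8).trans h12⟩
    have := hb 7
    have h0 : 0 ≤ min e (1/2) / l ^ 7 := by positivity
    nlinarith [norm_nonneg (s - 1)]


lemma esz_ker_bound (s : ℂ) (hs : 1 / 2 ≤ s.re) : ‖1 / (s * (s + 1))‖ ≤ 4 * (1 + s.im ^ 2)⁻¹ := by
  have h1 : ‖s‖ ^ 2 = s.re ^ 2 + s.im ^ 2 := by
    rw [← Complex.normSq_eq_norm_sq, Complex.normSq_apply]; ring
  have h2 : ‖s‖ ≤ ‖s + 1‖ := by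
    have h3 : ‖s + 1‖ ^ 2 = (s.re + 1) ^ 2 + s.im ^ 2 := by
      rw [← Complex.normSq_eq_norm_sq, Complex.normSq_apply]; simp; ring
    apply le_of_sq_le_sq _ (norm_nonneg _)
    rw [h1, h3]; nlinarith
  have h4 : (1 + s.im ^ 2) / 4 ≤ ‖s * (s + 1)‖ := by
    rw [norm_mul]
    nlinarith [norm_nonneg s]
  rw [norm_div, norm_one, ← div_eq_mul_inv, div_le_div_iff₀ (lt_of_lt_of_le (by positivity) h4) (by positivity)]
  linarith

lemma esz_ker_cont (σ : ℝ) (hσ : 1 / 2 ≤ σ) :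
    Continuous (fun y : ℝ => 1 / (((σ : ℂ) + y * Complex.I) * ((σ : ℂ) + y * Complex.I + 1))) := by
  refine Continuous.div continuous_const (by fun_prop) fun y => ?_
  have h1 : ((σ : ℂ) + y * Complex.I) ≠ 0 := fun h => by
    have := congrArg Complex.re h; simp at this; linarith
  have h2 : ((σ : ℂ) + y * Complex.I + 1) ≠ 0 := fun h => by
    have := congrArg Complex.re h; simp at this; linarith
  exact mul_ne_zero h1 h2

lemma esz_ker_int (σ : ℝ) (hσ : 1 / 2 ≤ σ) :
    MeasureTheory.Integrable (fun y : ℝ => 1 / (((σ : ℂ) + y * Complex.I) * ((σ : ℂ) + y * Complex.I + 1))) := by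
  refine MeasureTheory.Integrable.mono' (integrable_inv_one_add_sq.const_mul 4)
    (esz_ker_cont σ hσ).aestronglyMeasurable (Filter.Eventually.of_forall fun y => ?_)
  simpa using esz_ker_bound ((σ : ℂ) + y * Complex.I) (by simpa using hσ)

noncomputable def eszPhi : ℝ → ℂ := fun t => Set.indicator (Set.Ioc 0 1) (fun _ => (1 : ℂ)) t -
  Set.indicator (Set.Ioc 0 1) (fun t : ℝ => (t : ℂ) ^ (1 : ℂ)) t

lemma eszPhi_eq (t : ℝ) (ht : 0 < t) : eszPhi t = ((max 0 (1 - t) : ℝ) : ℂ) := by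
  unfold eszPhi
  by_cases h : t ≤ 1
  · have hm : t ∈ Set.Ioc (0 : ℝ) 1 := ⟨ht, h⟩
    rw [Set.indicator_of_mem hm, Set.indicator_of_mem hm, max_eq_right (by linarith)]
    simp
  · rw [Set.indicator_of_notMem (fun h' => h h'.2), Set.indicator_of_notMem (fun h' => h h'.2), max_eq_left (by linarith)]
    simp

lemma eszPhi_mellin (s : ℂ) (hs : 0 < s.re) : HasMellin eszPhi s (1 / (s * (s + 1))) := by
  have h := hasMellin_sub (hasMellin_one_Ioc hs).1 (hasMellin_cpow_Ioc 1 (s := s) (by simp; linarith)).1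
  rw [(hasMellin_one_Ioc hs).2, (hasMellin_cpow_Ioc 1 (s := s) (by simp; linarith)).2] at h
  have h0 : s ≠ 0 := fun h => by rw [h] at hs; simp at hs
  have h1 : s + 1 ≠ 0 := fun h => by
    have := congrArg Complex.re h; simp at this; linarith
  have : 1 / s - 1 / (s + 1) = 1 / (s * (s + 1)) := by field_simp; ring
  rw [this] at h
  exact h

lemma esz_perron0 (σ u : ℝ) (hσ : 1 / 2 ≤ σ) (hu : 0 < u) :
    ∫ y : ℝ, (u : ℂ) ^ (-((σ : ℂ) + y * Complex.I)) *
      (1 / (((σ : ℂ) + y * Complex.I) * ((σ : ℂ) + y * Complex.I + 1))) =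
      2 * Real.pi * ((max 0 (1 - u) : ℝ) : ℂ) := by
  have hm : ∀ y : ℝ, mellin eszPhi ((σ : ℂ) + y * Complex.I) =
      1 / (((σ : ℂ) + y * Complex.I) * ((σ : ℂ) + y * Complex.I + 1)) := fun y =>
    (eszPhi_mellin _ (by simp; linarith)).2
  have hc : ContinuousAt eszPhi u := by
    have : ContinuousAt (fun t : ℝ => ((max 0 (1 - t) : ℝ) : ℂ)) u := by fun_prop
    refine this.congr ?_
    filter_upwards [lt_mem_nhds hu] with t ht using (eszPhi_eq t ht).symm
  have h := mellinInv_mellin_eq σ eszPhi hu (eszPhi_mellin _ (by simp; linarith)).1 (by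
    unfold Complex.VerticalIntegrable
    simp_rw [hm]
    exact esz_ker_int σ hσ) hc
  unfold mellinInv at h
  simp_rw [hm, smul_eq_mul] at h
  rw [eszPhi_eq u hu] at h
  rw [← h]
  have : (Real.pi : ℂ) ≠ 0 := by exact_mod_cast Real.pi_ne_zero
  rw [Complex.real_smul]
  generalize (∫ y : ℝ, (u : ℂ) ^ (-((σ : ℂ) + y * Complex.I)) *
      (1 / (((σ : ℂ) + y * Complex.I) * ((σ : ℂ) + y * Complex.I + 1)))) = J
  push_cast
  field_simp

lemma esz_term_norm (a : ℕ → ℂ) (σ y : ℝ) (n : ℕ) :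
    ‖LSeries.term a ((σ : ℂ) + y * Complex.I) n‖ = ‖LSeries.term a (σ : ℂ) n‖ := by
  rw [LSeries.norm_term_eq, LSeries.norm_term_eq]; simp

lemma esz_LSeries_cont (a : ℕ → ℂ) (σ : ℝ) (h : LSeriesSummable a σ) :
    Continuous (fun y : ℝ => LSeries a ((σ : ℂ) + y * Complex.I)) := by
  unfold LSeries
  refine continuous_tsum (u := fun n => ‖LSeries.term a (σ : ℂ) n‖) (fun n => ?_) h.norm
    (fun n y => (esz_term_norm a σ y n).le)
  rcases eq_or_ne n 0 with rfl | hn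
  · simp [LSeries.term_zero]; fun_prop
  · simp_rw [LSeries.term_of_ne_zero hn]
    have hn' : (n : ℂ) ≠ 0 := by exact_mod_cast hn
    refine Continuous.div continuous_const ?_ fun y => ?_
    · exact Continuous.const_cpow (by fun_prop) (Or.inl hn')
    · simp [Complex.cpow_eq_zero_iff, hn']

lemma esz_LSeries_le (a : ℕ → ℂ) (σ y : ℝ) (h : LSeriesSummable a σ) :
    ‖LSeries a ((σ : ℂ) + y * Complex.I)‖ ≤ ∑' n, ‖LSeries.term a (σ : ℂ) n‖ := by
  unfold LSeries
  refine tsum_of_norm_bounded (h.norm.hasSum) (fun n => (esz_term_norm a σ y n).le)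

lemma esz_perron (a : ℕ → ℂ) (σ x : ℝ) (hσ : 1 / 2 ≤ σ) (hx : 0 < x) (h : LSeriesSummable a σ) :
    ∫ y : ℝ, LSeries a ((σ : ℂ) + y * Complex.I) * (x : ℂ) ^ ((σ : ℂ) + y * Complex.I) *
      (1 / (((σ : ℂ) + y * Complex.I) * ((σ : ℂ) + y * Complex.I + 1))) =
      2 * Real.pi * ∑ n ∈ Finset.Icc 1 ⌊x⌋₊, a n * (1 - n / x : ℝ) := by
  set F : ℕ → ℝ → ℂ := fun n y => LSeries.term a ((σ : ℂ) + y * Complex.I) n *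
    (x : ℂ) ^ ((σ : ℂ) + y * Complex.I) *
      (1 / (((σ : ℂ) + y * Complex.I) * ((σ : ℂ) + y * Complex.I + 1))) with hF
  have hxc : (x : ℂ) ≠ 0 := by exact_mod_cast hx.ne'
  have hFeq : ∀ n, n ≠ 0 → ∀ y : ℝ, F n y = a n * ((((n : ℝ) / x : ℝ) : ℂ) ^ (-((σ : ℂ) + y * Complex.I)) *
      (1 / (((σ : ℂ) + y * Complex.I) * ((σ : ℂ) + y * Complex.I + 1)))) := by
    intro n hn y
    have hn' : (n : ℂ) ≠ 0 := by exact_mod_cast hn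
    rw [hF]
    simp only
    rw [LSeries.term_of_ne_zero hn, Complex.ofReal_div, Complex.div_cpow_ofReal_nonneg (by positivity) hx.le,
      Complex.cpow_neg, Complex.cpow_neg, Complex.ofReal_natCast]
    have : (x : ℂ) ^ ((σ : ℂ) + y * Complex.I) ≠ 0 := by simp [Complex.cpow_eq_zero_iff, hxc]
    have : (n : ℂ) ^ ((σ : ℂ) + y * Complex.I) ≠ 0 := by simp [Complex.cpow_eq_zero_iff, hn']
    field_simp
  have hFn : ∀ n y, ‖F n y‖ = ‖LSeries.term a (σ : ℂ) n‖ * (x ^ σ *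
      ‖1 / (((σ : ℂ) + y * Complex.I) * ((σ : ℂ) + y * Complex.I + 1))‖) := by
    intro n y
    rw [hF]
    simp only
    rw [norm_mul, norm_mul, esz_term_norm, Complex.norm_cpow_eq_rpow_re_of_pos hx]
    simp [mul_assoc]
  have hFint : ∀ n, MeasureTheory.Integrable (F n) := by
    intro n
    refine MeasureTheory.Integrable.mono' (g := fun y => ‖LSeries.term a (σ : ℂ) n‖ * (x ^ σ *
      ‖1 / (((σ : ℂ) + y * Complex.I) * ((σ : ℂ) + y * Complex.I + 1))‖)) (((esz_ker_int σ hσ).norm.const_mul _).const_mul _) ?_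
      (Filter.Eventually.of_forall fun y => (hFn n y).le)
    apply Continuous.aestronglyMeasurable
    rcases eq_or_ne n 0 with rfl | hn
    · have : F 0 = fun y => 0 := by funext y; simp [hF]
      rw [this]; fun_prop
    · rw [funext (hFeq n hn)]
      have hnx : (((n : ℝ) / x : ℝ) : ℂ) ≠ 0 := by
        have : ((n : ℝ) / x) ≠ 0 := div_ne_zero (by exact_mod_cast hn) hx.ne'
        exact_mod_cast this
      exact continuous_const.mul ((Continuous.const_cpow (by fun_prop) (Or.inl hnx)).mul (esz_ker_cont σ hσ))
  have key := MeasureTheory.hasSum_integral_of_summable_integral_norm hFint (by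
    simp_rw [hFn, MeasureTheory.integral_const_mul]
    exact h.norm.mul_right _)
  have hval : ∀ n, ∫ y, F n y = if n ∈ Finset.Icc 1 ⌊x⌋₊ then 2 * Real.pi * (a n * (1 - n / x : ℝ)) else 0 := by
    intro n
    rcases eq_or_ne n 0 with rfl | hn
    · simp [hF]
    · simp_rw [hFeq n hn, MeasureTheory.integral_const_mul]
      rw [esz_perron0 σ _ hσ (by positivity)]
      split_ifs with hm
      · rw [Finset.mem_Icc] at hm
        have : (n : ℝ) ≤ x := (Nat.le_floor_iff hx.le).mp hm.2
        rw [max_eq_right]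
        · ring
        · rw [sub_nonneg, div_le_one hx]; exact this
      · have : x < n := by
          by_contra hc
          push Not at hc
          exact hm (Finset.mem_Icc.mpr ⟨Nat.one_le_iff_ne_zero.mpr hn, Nat.le_floor hc⟩)
        rw [max_eq_left]
        · simp
        · rw [sub_nonpos, one_le_div hx]; exact this.le
  simp_rw [hval] at key
  have hts : ∀ y : ℝ, LSeries a ((σ : ℂ) + y * Complex.I) * (x : ℂ) ^ ((σ : ℂ) + y * Complex.I) *
      (1 / (((σ : ℂ) + y * Complex.I) * ((σ : ℂ) + y * Complex.I + 1))) = ∑' n, F n y := by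
    intro y
    rw [hF]
    simp only
    rw [tsum_mul_right, tsum_mul_right]; rfl
  simp_rw [hts]
  rw [← key.tsum_eq, tsum_eq_sum (s := Finset.Icc 1 ⌊x⌋₊) (fun n hn => by rw [if_neg hn]), Finset.mul_sum]
  exact Finset.sum_congr rfl fun n hn => by rw [if_pos hn]

open MeasureTheory in
lemma esz_tail_int (T : ℝ) (hT : 1 ≤ T) :
    ∫ y in Set.Ioi T, (1 + y ^ 2)⁻¹ ≤ 1 / T := by
  have h1 := integral_Ioi_rpow_of_lt (show (-2 : ℝ) < -1 by norm_num) (show 0 < T by linarith)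
  have h2 : ∫ y in Set.Ioi T, (1 + y ^ 2)⁻¹ ≤ ∫ y in Set.Ioi T, y ^ (-2 : ℝ) := by
    refine setIntegral_mono_on integrable_inv_one_add_sq.integrableOn
      (integrableOn_Ioi_rpow_of_lt (show (-2 : ℝ) < -1 by norm_num) (show 0 < T by linarith))
      measurableSet_Ioi fun y hy => ?_
    have hy0 : 0 < y := lt_of_lt_of_le (by linarith) (le_of_lt hy)
    rw [Real.rpow_neg hy0.le, Real.rpow_two]
    gcongr
    linarith
  refine h2.trans (le_of_eq ?_)
  rw [h1]
  norm_num
  rw [Real.rpow_neg_one]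

open MeasureTheory in
lemma esz_split (f : ℝ → ℂ) (hf : Integrable f) (K T : ℝ) (hT : 1 ≤ T) (hK : 0 ≤ K)
    (hb : ∀ y, ‖f y‖ ≤ K * (1 + y ^ 2)⁻¹) :
    ‖∫ y, f y‖ ≤ ‖∫ y in (-T)..T, f y‖ + 2 * K / T := by
  have h1 : ∫ y, f y = (∫ y in Set.Iic (-T), f y) + (∫ y in Set.Ioi (-T), f y) :=
    (intervalIntegral.integral_Iic_add_Ioi hf.integrableOn hf.integrableOn).symm
  have h2 : ∫ y in Set.Ioi (-T), f y = (∫ y in (-T)..T, f y) + ∫ y in Set.Ioi T, f y :=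
    (intervalIntegral.integral_interval_add_Ioi hf.integrableOn hf.integrableOn).symm
  have hI := integrable_inv_one_add_sq
  have h3 : ‖∫ y in Set.Ioi T, f y‖ ≤ K / T := by
    calc ‖∫ y in Set.Ioi T, f y‖ ≤ ∫ y in Set.Ioi T, K * (1 + y ^ 2)⁻¹ :=
          norm_integral_le_of_norm_le (hI.const_mul K).integrableOn (Filter.Eventually.of_forall hb)
      _ = K * ∫ y in Set.Ioi T, (1 + y ^ 2)⁻¹ := integral_const_mul _ _
      _ ≤ K * (1 / T) := by gcongr; exact esz_tail_int T hT
      _ = K / T := by ring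
  have h4 : ‖∫ y in Set.Iic (-T), f y‖ ≤ K / T := by
    rw [← integral_comp_neg_Ioi]
    calc ‖∫ y in Set.Ioi T, f (-y)‖ ≤ ∫ y in Set.Ioi T, K * (1 + y ^ 2)⁻¹ :=
          norm_integral_le_of_norm_le (hI.const_mul K).integrableOn
            (Filter.Eventually.of_forall fun y => by simpa using hb (-y))
      _ = K * ∫ y in Set.Ioi T, (1 + y ^ 2)⁻¹ := integral_const_mul _ _
      _ ≤ K * (1 / T) := by gcongr; exact esz_tail_int T hT
      _ = K / T := by ring
  rw [h1, h2]
  calc _ ≤ ‖∫ y in Set.Iic (-T), f y‖ + (‖∫ y in (-T)..T, f y‖ + ‖∫ y in Set.Ioi T, f y‖) :=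
        (norm_add_le _ _).trans (by gcongr; exact norm_add_le _ _)
    _ ≤ _ := by
      have : 2 * K / T = K / T + K / T := by ring
      linarith

open MeasureTheory in
lemma esz_int_pi (K T : ℝ) (hT : 0 ≤ T) (hK : 0 ≤ K) (f : ℝ → ℂ)
    (hb : ∀ y ∈ Set.Icc (-T) T, ‖f y‖ ≤ K * (1 + y ^ 2)⁻¹) :
    ‖∫ y in (-T)..T, f y‖ ≤ K * Real.pi := by
  have hI := integrable_inv_one_add_sq
  calc ‖∫ y in (-T)..T, f y‖ ≤ ∫ y in (-T)..T, K * (1 + y ^ 2)⁻¹ := by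
        refine intervalIntegral.norm_integral_le_of_norm_le (by linarith)
          (Filter.Eventually.of_forall fun y hy => hb y ⟨hy.1.le, hy.2⟩) ?_
        exact (hI.const_mul K).intervalIntegrable
    _ = K * ∫ y in (-T)..T, (1 + y ^ 2)⁻¹ := intervalIntegral.integral_const_mul _ _
    _ ≤ K * Real.pi := by
      gcongr
      rw [integral_inv_one_add_sq]
      have h1 := Real.arctan_lt_pi_div_two T
      have h2 := Real.neg_pi_div_two_lt_arctan (-T)
      linarith

lemma esz_contour (a : ℕ → ℂ) (F : ℂ → ℂ) (x δ σ T A B : ℝ) (hx : 1 < x)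
    (hδ : 0 < δ) (hδ2 : δ ≤ 1 / 2) (hσ : σ = 1 + 1 / Real.log x) (hσ2 : σ ≤ 3 / 2) (hT : 1 ≤ T)
    (hsum : LSeriesSummable a σ) (hA : ∑' n, ‖LSeries.term a (σ : ℂ) n‖ ≤ A)
    (hFd : ∀ s : ℂ, 1 - δ ≤ s.re → s.re ≤ σ → |s.im| ≤ T → DifferentiableAt ℂ F s)
    (hFb : ∀ s : ℂ, 1 - δ ≤ s.re → s.re ≤ σ → |s.im| ≤ T → ‖F s‖ ≤ B)
    (hFe : ∀ s : ℂ, s.re = σ → |s.im| ≤ T → LSeries a s = F s) :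
    ‖∑ n ∈ Finset.Icc 1 ⌊x⌋₊, a n * (1 - n / x : ℝ)‖ ≤ 6 * x * (B * x ^ (-δ) + B / T + A / T) := by
  have hx0 : 0 < x := by linarith
  have hxc : (x : ℂ) ≠ 0 := by exact_mod_cast hx0.ne'
  have hlx : 0 < Real.log x := Real.log_pos hx
  have hσ1 : 1 < σ := by rw [hσ]; have : 0 < 1 / Real.log x := by positivity
                         linarith
  have hA0 : 0 ≤ A := le_trans (tsum_nonneg fun n => norm_nonneg _) hA
  have hB0 : 0 ≤ B := le_trans (norm_nonneg _) (hFb σ (by simp; linarith) (by simp) (by simp; linarith))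
  have hxσ : x ^ σ = x * Real.exp 1 := by
    rw [hσ, Real.rpow_add hx0, Real.rpow_one, Real.rpow_def_of_pos hx0, mul_one_div_cancel hlx.ne']
  have he : Real.exp 1 ≤ 3 := by linarith [Real.exp_one_lt_d9]
  set κ : ℂ → ℂ := fun s => 1 / (s * (s + 1)) with hκ
  set G : ℂ → ℂ := fun s => F s * (x : ℂ) ^ s * κ s with hG
  set f : ℝ → ℂ := fun y => LSeries a ((σ : ℂ) + y * Complex.I) * (x : ℂ) ^ ((σ : ℂ) + y * Complex.I) *
      (1 / (((σ : ℂ) + y * Complex.I) * ((σ : ℂ) + y * Complex.I + 1))) with hf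
  have hfb : ∀ y, ‖f y‖ ≤ (12 * A * x) * (1 + y ^ 2)⁻¹ := by
    intro y
    rw [hf]
    simp only
    rw [norm_mul, norm_mul, Complex.norm_cpow_eq_rpow_re_of_pos hx0]
    have h1 := (esz_LSeries_le a σ y hsum).trans hA
    have h2 := esz_ker_bound ((σ : ℂ) + y * Complex.I) (by simp; linarith)
    have h3 : ((σ : ℂ) + y * Complex.I).re = σ := by simp
    have h4 : ((σ : ℂ) + y * Complex.I).im = y := by simp
    rw [h4] at h2
    rw [h3, hxσ]
    calc _ ≤ A * (x * 3) * (4 * (1 + y ^ 2)⁻¹) := by gcongr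
      _ = _ := by ring
  have hfc : Continuous f := by
    refine ((esz_LSeries_cont a σ hsum).mul ?_).mul (esz_ker_cont σ (by linarith))
    exact Continuous.const_cpow (by fun_prop) (Or.inl hxc)
  have hfi : MeasureTheory.Integrable f :=
    MeasureTheory.Integrable.mono' (integrable_inv_one_add_sq.const_mul (12 * A * x))
      hfc.aestronglyMeasurable (Filter.Eventually.of_forall hfb)
  have hper := esz_perron a σ x (by linarith) hx0 hsum
  have hs1 := esz_split f hfi (12 * A * x) T hT (by positivity) hfb
  have hGb : ∀ s : ℂ, 1 - δ ≤ s.re → s.re ≤ σ → |s.im| ≤ T →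
      ‖G s‖ ≤ B * x ^ s.re * (4 * (1 + s.im ^ 2)⁻¹) := by
    intro s h1 h2 h3
    rw [hG]
    simp only
    rw [norm_mul, norm_mul, Complex.norm_cpow_eq_rpow_re_of_pos hx0]
    have := hFb s h1 h2 h3
    have := esz_ker_bound s (by linarith)
    gcongr
  have hrect := Complex.integral_boundary_rect_eq_zero_of_differentiableOn G
    ((1 - δ : ℝ) + (-T : ℝ) * Complex.I) (σ + T * Complex.I) (by
      intro s hs
      rw [Complex.mem_reProdIm] at hs
      simp at hs
      rw [Set.uIcc_of_le (by linarith), Set.uIcc_of_le (by linarith)] at hs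
      obtain ⟨⟨h1, h2⟩, h3, h4⟩ := hs
      apply DifferentiableAt.differentiableWithinAt
      have hs0 : s ≠ 0 := fun h => by rw [h] at h1; simp at h1; linarith
      have hs1 : s + 1 ≠ 0 := fun h => by
        have := congrArg Complex.re h; simp at this; linarith
      refine ((hFd s h1 h2 (abs_le.mpr ⟨h3, h4⟩)).mul ?_).mul ?_
      · exact DifferentiableAt.const_cpow differentiableAt_id (Or.inl hxc)
      · exact (differentiableAt_const _).div (by fun_prop) (mul_ne_zero hs0 hs1))
  simp only [Complex.add_re, Complex.ofReal_re, Complex.mul_re, Complex.I_re, mul_zero, Complex.ofReal_im,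
    Complex.I_im, mul_one, sub_self, add_zero, Complex.add_im, Complex.mul_im, zero_add] at hrect
  have hright : ∫ y in (-T)..T, f y = ∫ y in (-T)..T, G ((σ : ℂ) + y * Complex.I) := by
    apply intervalIntegral.integral_congr
    intro y hy
    rw [Set.uIcc_of_le (by linarith)] at hy
    simp only [hf, hG, hκ]
    rw [hFe _ (by simp) (by simpa using abs_le.mpr hy)]
  have hx1 : x ^ (1 - δ) = x * x ^ (-δ) := by
    rw [sub_eq_add_neg, Real.rpow_add hx0, Real.rpow_one]
  have hleft : ‖∫ y in (-T)..T, G (((1 - δ : ℝ) : ℂ) + y * Complex.I)‖ ≤ (4 * B * (x * x ^ (-δ))) * Real.pi := by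
    apply esz_int_pi _ _ (by linarith) (by positivity)
    intro y hy
    have := hGb (((1 - δ : ℝ) : ℂ) + y * Complex.I) (by simp) (by simp; linarith) (by simpa using abs_le.mpr hy)
    have h3 : (((1 - δ : ℝ) : ℂ) + y * Complex.I).re = 1 - δ := by simp
    have h4 : (((1 - δ : ℝ) : ℂ) + y * Complex.I).im = y := by simp
    rw [h3, h4, hx1] at this
    linarith
  have hhor : ∀ t : ℝ, |t| = T → ‖∫ u in (1 - δ)..σ, G ((u : ℂ) + t * Complex.I)‖ ≤ 12 * B * x / T := by
    intro t ht
    have hb := intervalIntegral.norm_integral_le_of_norm_le_const (a := 1 - δ) (b := σ)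
      (f := fun u : ℝ => G ((u : ℂ) + t * Complex.I)) (C := 12 * B * x / T) (by
        intro u hu
        rw [Set.uIoc_of_le (by linarith)] at hu
        have h := hGb ((u : ℂ) + t * Complex.I) (by simpa using hu.1.le) (by simpa using hu.2) (by simpa using ht.le)
        have h3 : ((u : ℂ) + t * Complex.I).re = u := by simp
        have h4 : ((u : ℂ) + t * Complex.I).im = t := by simp
        rw [h3, h4] at h
        refine h.trans ?_
        have ht2 : t ^ 2 = T ^ 2 := by rw [← ht, sq_abs]
        have h5 : (1 + t ^ 2)⁻¹ ≤ T⁻¹ := by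
          rw [ht2]; gcongr; nlinarith
        have h6 : x ^ u ≤ x * 3 := by
          calc x ^ u ≤ x ^ σ := Real.rpow_le_rpow_of_exponent_le hx.le hu.2
            _ = x * Real.exp 1 := hxσ
            _ ≤ x * 3 := by gcongr
        calc B * x ^ u * (4 * (1 + t ^ 2)⁻¹) ≤ B * (x * 3) * (4 * T⁻¹) := by gcongr
          _ = 12 * B * x / T := by ring)
    refine hb.trans ?_
    have : |σ - (1 - δ)| ≤ 1 := by rw [abs_of_nonneg (by linarith)]; linarith
    have h0 : 0 ≤ 12 * B * x / T := by positivity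
    nlinarith
  have hT1 := hhor T (abs_of_nonneg (by linarith))
  have hT2 := hhor (-T) (by rw [abs_neg, abs_of_nonneg (by linarith)])
  have hR : ‖∫ y in (-T)..T, f y‖ ≤ (4 * B * (x * x ^ (-δ))) * Real.pi + 12 * B * x / T + 12 * B * x / T := by
    rw [hright]
    have h7 : Complex.I • (∫ y in (-T)..T, G ((σ : ℂ) + y * Complex.I)) =
      Complex.I • (∫ y in (-T)..T, G (((1 - δ : ℝ) : ℂ) + y * Complex.I))
       + (∫ u in (1 - δ)..σ, G ((u : ℂ) + T * Complex.I)) - ∫ u in (1 - δ)..σ, G ((u : ℂ) + (-T : ℝ) * Complex.I) := by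
      linear_combination hrect
    have h8 := congrArg norm h7
    rw [norm_smul, Complex.norm_I, one_mul] at h8
    rw [h8]
    refine (norm_sub_le _ _).trans ?_
    refine add_le_add ((norm_add_le _ _).trans ?_) hT2
    refine add_le_add ?_ hT1
    rw [norm_smul, Complex.norm_I, one_mul]
    exact hleft
  rw [hper] at hs1
  rw [norm_mul] at hs1
  have hpi : ‖(2 * Real.pi : ℂ)‖ = 2 * Real.pi := by
    rw [norm_mul]; simp [Real.pi_pos.le]
  rw [hpi] at hs1
  have hp3 := Real.pi_gt_three
  have hp4 := Real.pi_lt_four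
  set S := ‖∑ n ∈ Finset.Icc 1 ⌊x⌋₊, a n * (1 - n / x : ℝ)‖
  have hS0 : 0 ≤ S := norm_nonneg _
  have e1 : 0 ≤ B * (x * x ^ (-δ)) := by positivity
  have e2 : 0 ≤ B * x / T := by positivity
  have e3 : 0 ≤ A * x / T := by positivity
  have h9 : 2 * Real.pi * S ≤ 4 * (B * (x * x ^ (-δ))) * Real.pi + 24 * (B * x / T) + 24 * (A * x / T) := by
    refine hs1.trans ?_
    calc _ ≤ (4 * B * (x * x ^ (-δ))) * Real.pi + 12 * B * x / T + 12 * B * x / T + 2 * (12 * A * x) / T := by gcongr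
      _ = _ := by ring
  have h10 : 6 * x * (B * x ^ (-δ) + B / T + A / T) = 6 * (B * (x * x ^ (-δ)) + B * x / T + A * x / T) := by ring
  rw [h10]
  by_contra hcon
  push Not at hcon
  nlinarith


lemma esz_zsum : ∃ C : ℝ, 1 ≤ C ∧ ∀ δ : ℝ, 0 < δ → δ ≤ 1 →
    ∑' n : ℕ, 1 / (n : ℝ) ^ (1 + δ) ≤ C / δ := by
  obtain ⟨C, hC, h⟩ := esz_U_zeta
  refine ⟨max 1 (3 * C), le_max_left _ _, fun δ hδ hδ1 => ?_⟩
  have h1 : riemannZeta ((1 + δ : ℝ) : ℂ) = ((∑' n : ℕ, 1 / (n : ℝ) ^ (1 + δ) : ℝ) : ℂ) := by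
    rw [zeta_eq_tsum_one_div_nat_cpow (by simpa using hδ), Complex.ofReal_tsum]
    congr 1; ext n
    rw [Complex.ofReal_div, Complex.ofReal_cpow (by positivity)]; simp
  have hne : ((1 + δ : ℝ) : ℂ) ≠ 1 := by
    intro h
    have := Complex.ofReal_eq_one.mp h
    linarith
  have h2 := h 2 ((1 + δ : ℝ) : ℂ) le_rfl (by simp; linarith) (by
    rw [Complex.norm_real, Real.norm_of_nonneg (by positivity)]
    have : (2 * 2 : ℝ) + 1 ≤ Real.exp (2 * 2) := Real.add_one_le_exp _
    linarith)
  have h3 : ‖((1 + δ : ℝ) : ℂ) - 1‖ = δ := by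
    have : ((1 + δ : ℝ) : ℂ) - 1 = (δ : ℂ) := by push_cast; ring
    rw [this, Complex.norm_real, Real.norm_of_nonneg hδ.le]
  have h4 : ‖riemannZeta ((1 + δ : ℝ) : ℂ)‖ ≤ 3 * C / δ := by
    rw [riemannZeta_eq_inv_sub_mul hne, norm_mul, norm_inv, h3, inv_mul_eq_div]
    rw [h3] at h2
    gcongr
    nlinarith
  rw [h1, Complex.norm_real] at h4
  refine (le_abs_self _).trans (h4.trans ?_)
  gcongr
  exact le_max_right _ _

lemma esz_A : ∃ C : ℝ, 1 ≤ C ∧ ∀ a : ℕ → ℂ, (∀ n : ℕ, 1 ≤ n → ‖a n‖ ≤ 1 + Real.log n) → ∀ L σ : ℝ, 1 ≤ L →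
    σ = 1 + 1 / L → LSeriesSummable a σ ∧ ∑' n, ‖LSeries.term a (σ : ℂ) n‖ ≤ C * (1 + 2 * L) ^ 2 := by
  obtain ⟨C, hC, h⟩ := esz_zsum
  refine ⟨C, hC, fun a ha L σ hL hσ => ?_⟩
  have hL0 : 0 < L := by linarith
  set δ := 1 / (2 * L) with hδ
  have hδ0 : 0 < δ := by positivity
  have hδ1 : δ ≤ 1 := by rw [hδ, div_le_one (by positivity)]; linarith
  have hb : ∀ n, ‖LSeries.term a (σ : ℂ) n‖ ≤ (1 + 2 * L) * (1 / (n : ℝ) ^ (1 + δ)) := by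
    intro n
    rcases eq_or_ne n 0 with rfl | hn
    · simp; positivity
    · rw [LSeries.norm_term_eq, if_neg hn]
      have hn0 : 0 < (n : ℝ) := by exact_mod_cast Nat.pos_of_ne_zero hn
      have hn1 : 1 ≤ (n : ℝ) := by exact_mod_cast Nat.one_le_iff_ne_zero.mpr hn
      have h1 := Real.log_le_rpow_div hn0.le hδ0
      have h2 : 1 ≤ (n : ℝ) ^ δ := Real.one_le_rpow hn1 hδ0.le
      have h3 : ‖a n‖ ≤ (1 + 2 * L) * (n : ℝ) ^ δ := by
        have h4 : (n : ℝ) ^ δ / δ = 2 * L * (n : ℝ) ^ δ := by rw [hδ]; field_simp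
        rw [h4] at h1
        have := ha n (Nat.one_le_iff_ne_zero.mpr hn)
        linarith
      have h5 : ((σ : ℂ)).re = (1 + δ) + δ := by
        rw [Complex.ofReal_re, hσ, hδ]; field_simp; ring
      rw [h5, Real.rpow_add hn0]
      rw [div_le_iff₀ (by positivity)]
      calc _ ≤ _ := h3
        _ = _ := by field_simp
  have hs : Summable fun n : ℕ => (1 + 2 * L) * (1 / (n : ℝ) ^ (1 + δ)) :=
    (Real.summable_one_div_nat_rpow.mpr (by linarith)).mul_left _
  have hsn : Summable fun n => ‖LSeries.term a (σ : ℂ) n‖ :=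
    Summable.of_nonneg_of_le (fun n => norm_nonneg _) hb hs
  refine ⟨hsn.of_norm, ?_⟩
  calc ∑' n, ‖LSeries.term a (σ : ℂ) n‖ ≤ ∑' n : ℕ, (1 + 2 * L) * (1 / (n : ℝ) ^ (1 + δ)) := hsn.tsum_le_tsum hb hs
    _ = (1 + 2 * L) * ∑' n : ℕ, (1 / (n : ℝ) ^ (1 + δ)) := tsum_mul_left
    _ ≤ (1 + 2 * L) * (C / δ) := by gcongr; exact h δ hδ0 hδ1
    _ = (1 + 2 * L) * (C * (2 * L)) := by rw [hδ]; field_simp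
    _ ≤ _ := by nlinarith [mul_pos (show (0:ℝ) < 1 + 2 * L by positivity) (show 0 < C by linarith)]

lemma esz_triv (a : ℕ → ℂ) (ha : ∀ n : ℕ, 1 ≤ n → ‖a n‖ ≤ 1 + Real.log n) (u v : ℕ) (y : ℝ)
    (w : ℕ → ℝ) (hw : ∀ n ∈ Finset.Ioc u v, |w n| ≤ 1)
    (huv : u ≤ v) (hy : (v : ℝ) ≤ y) (hy1 : 1 ≤ y) :
    ‖∑ n ∈ Finset.Ioc u v, a n * (w n : ℝ)‖ ≤ ((v : ℝ) - u) * (1 + Real.log y) := by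
  have hb : ∀ n ∈ Finset.Ioc u v, ‖a n * (w n : ℝ)‖ ≤ 1 + Real.log y := by
    intro n hn
    have hw' := hw n hn
    rw [Finset.mem_Ioc] at hn
    have hn1 : 1 ≤ n := by omega
    have h1 : ‖a n‖ ≤ 1 + Real.log y := by
      refine (ha n hn1).trans ?_
      have : Real.log n ≤ Real.log y := Real.log_le_log (by exact_mod_cast hn1)
        (le_trans (by exact_mod_cast hn.2) hy)
      linarith
    rw [norm_mul, Complex.norm_real, Real.norm_eq_abs]
    nlinarith [norm_nonneg (a n), abs_nonneg (w n)]
  refine (norm_sum_le_of_le _ hb).trans ?_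
  rw [Finset.sum_const, Nat.card_Ioc, nsmul_eq_mul, Nat.cast_sub huv]

lemma esz_desmooth (a : ℕ → ℂ) (ha : ∀ n : ℕ, 1 ≤ n → ‖a n‖ ≤ 1 + Real.log n) (x h E : ℝ) (hx : 1 ≤ x)
    (hh : 0 < h) (hhx : h ≤ x)
    (h1 : ‖∑ n ∈ Finset.Icc 1 ⌊x⌋₊, a n * (1 - n / x : ℝ)‖ ≤ E * x)
    (h2 : ‖∑ n ∈ Finset.Icc 1 ⌊x + h⌋₊, a n * (1 - n / (x + h) : ℝ)‖ ≤ E * (x + h)) :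
    ‖∑ n ∈ Finset.Icc 1 ⌊x⌋₊, a n‖ ≤ 5 * x ^ 2 * E / h + (h + 1) * (1 + Real.log (2 * x)) := by
  have hE : 0 ≤ E := by
    have := (norm_nonneg _).trans h1
    by_contra hc
    push Not at hc
    nlinarith
  have hx0 : 0 < x := by linarith
  have hfl : ⌊x⌋₊ ≤ ⌊x + h⌋₊ := Nat.floor_mono (by linarith)
  have hIcc : ∀ k : ℕ, Finset.Icc 1 k = Finset.Ioc 0 k := fun k => by ext n; simp [Nat.succ_le_iff]
  have hkey : (h : ℂ) * ∑ n ∈ Finset.Icc 1 ⌊x⌋₊, a n =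
      ((x + h : ℝ) : ℂ) * (∑ n ∈ Finset.Icc 1 ⌊x + h⌋₊, a n * (1 - n / (x + h) : ℝ))
      - (x : ℂ) * (∑ n ∈ Finset.Icc 1 ⌊x⌋₊, a n * (1 - n / x : ℝ))
      - (h : ℂ) * ∑ n ∈ Finset.Ioc ⌊x⌋₊ ⌊x + h⌋₊, a n * (((x + h - n) / h : ℝ) : ℂ) := by
    rw [hIcc, hIcc, ← Finset.sum_Ioc_consecutive _ (Nat.zero_le _) hfl, mul_add, Finset.mul_sum, Finset.mul_sum,
      Finset.mul_sum, Finset.mul_sum, Finset.mul_sum]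
    have e1 : ∀ n : ℕ, ((x + h : ℝ) : ℂ) * (a n * ((1 - n / (x + h) : ℝ) : ℂ)) = (h : ℂ) * (a n * (((x + h - n) / h : ℝ) : ℂ)) := by
      intro n
      have : (x : ℂ) + h ≠ 0 := by exact_mod_cast (by positivity : x + h ≠ 0)
      have : (h : ℂ) ≠ 0 := by exact_mod_cast hh.ne'
      push_cast; field_simp
    rw [Finset.sum_congr (s₁ := Finset.Ioc ⌊x⌋₊ ⌊x + h⌋₊) rfl (fun n _ => e1 n)]
    rw [add_sub_assoc, add_sub_assoc, sub_right_comm, sub_self, zero_sub, ← sub_eq_add_neg, ← Finset.sum_sub_distrib]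
    refine Finset.sum_congr rfl fun n _ => ?_
    have : (x : ℂ) + h ≠ 0 := by exact_mod_cast (by positivity : x + h ≠ 0)
    have : (x : ℂ) ≠ 0 := by exact_mod_cast (by positivity : x ≠ 0)
    push_cast; field_simp; ring
  have hfl2 : ((⌊x + h⌋₊ : ℕ) : ℝ) ≤ x + h := Nat.floor_le (by linarith)
  have hfl3 : x < (⌊x⌋₊ : ℝ) + 1 := Nat.lt_floor_add_one x
  have h3 := esz_triv a ha ⌊x⌋₊ ⌊x + h⌋₊ (2 * x) (fun n => (x + h - n) / h) (by
    intro n hn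
    rw [Finset.mem_Ioc] at hn
    have hn1 : x < n := (Nat.floor_lt hx0.le).mp hn.1
    have hn2 : (n : ℝ) ≤ x + h := (Nat.le_floor_iff (by linarith)).mp hn.2
    rw [abs_of_nonneg (div_nonneg (by linarith) hh.le), div_le_one hh]
    linarith) hfl (by linarith) (by linarith)
  have hl0 : 0 ≤ Real.log (2 * x) := Real.log_nonneg (by linarith)
  have h4 : h * ‖∑ n ∈ Finset.Icc 1 ⌊x⌋₊, a n‖ ≤ (x + h) * (E * (x + h)) + x * (E * x) + h * ((h + 1) * (1 + Real.log (2 * x))) := by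
    have := congrArg norm hkey
    rw [norm_mul, Complex.norm_real, Real.norm_of_nonneg hh.le] at this
    rw [this]
    refine (norm_sub_le _ _).trans (add_le_add ((norm_sub_le _ _).trans (add_le_add ?_ ?_)) ?_)
    · rw [norm_mul, Complex.norm_real, Real.norm_of_nonneg (by positivity)]; gcongr
    · rw [norm_mul, Complex.norm_real, Real.norm_of_nonneg (by positivity)]; gcongr
    · rw [norm_mul, Complex.norm_real, Real.norm_of_nonneg (by positivity)];
      refine mul_le_mul_of_nonneg_left (h3.trans ?_) hh.le
      gcongr
      linarith
  have h5 : (x + h) * (E * (x + h)) + x * (E * x) ≤ 5 * x ^ 2 * E := by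
    have : (x + h) ^ 2 ≤ 4 * x ^ 2 := by nlinarith
    nlinarith
  rw [← mul_le_mul_iff_right₀ hh, mul_add, mul_div_cancel₀ _ hh.ne']
  linarith


lemma esz_poly_exp (k : ℕ) (c : ℝ) (hc : 0 < c) : ∃ C : ℝ, 1 ≤ C ∧ ∀ l : ℝ, 0 ≤ l →
    l ^ k ≤ C * Real.exp (c * l) := by
  refine ⟨max 1 (k.factorial / c ^ k), le_max_left _ _, fun l hl => ?_⟩
  have h := Real.pow_div_factorial_le_exp (c * l) (by positivity) k
  rw [div_le_iff₀ (by positivity), mul_pow] at h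
  calc l ^ k = (c ^ k * l ^ k) / c ^ k := by field_simp
    _ ≤ (Real.exp (c * l) * k.factorial) / c ^ k := by gcongr
    _ = (k.factorial / c ^ k) * Real.exp (c * l) := by ring
    _ ≤ _ := by gcongr; exact le_max_right _ _

lemma esz_smooth (c₂ : ℝ) (hc : 0 < c₂) (hc1 : c₂ ≤ 1) : ∃ K l₀ : ℝ, 1 ≤ K ∧ 2 ≤ l₀ ∧ ∀ l : ℝ, l₀ ≤ l →
    ∀ (a : ℕ → ℂ) (F : ℂ → ℂ) (B : ℝ), 1 ≤ B → (∀ n : ℕ, 1 ≤ n → ‖a n‖ ≤ 1 + Real.log n) →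
    (∀ s : ℂ, |s.re - 1| ≤ c₂ / l ^ 9 → |s.im| ≤ Real.exp l → DifferentiableAt ℂ F s ∧ ‖F s‖ ≤ B ∧
      (1 < s.re → LSeries a s = F s)) →
    ∀ y : ℝ, Real.exp (l ^ 10 / 2) ≤ y → y ≤ 2 * Real.exp (l ^ 10) →
    ‖∑ n ∈ Finset.Icc 1 ⌊y⌋₊, a n * (1 - n / y : ℝ)‖ ≤ K * B * Real.exp (-(c₂ / 4) * l) * y := by
  obtain ⟨C0, hC0, hA⟩ := esz_A
  obtain ⟨C1, hC1, h20⟩ := esz_poly_exp 20 (c₂ / 4) (by positivity)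
  refine ⟨6 * (2 + 25 * C0 * C1), max 2 (2 / c₂), by nlinarith, le_max_left _ _, ?_⟩
  intro l hl a F B hB ha hF y hy1 hy2
  have hl2 : 2 ≤ l := (le_max_left _ _).trans hl
  have hlc : 2 ≤ l * c₂ := by
    have := (le_max_right _ _).trans hl
    rwa [div_le_iff₀ hc] at this
  have hl0 : 0 < l := by linarith
  have h9 : (2 : ℝ) ^ 9 ≤ l ^ 9 := by gcongr
  have h10 : (2 : ℝ) ^ 10 ≤ l ^ 10 := by gcongr
  have hy0 : 0 < y := lt_of_lt_of_le (Real.exp_pos _) hy1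
  set L := Real.log y with hL
  have hL1 : l ^ 10 / 2 ≤ L := (Real.le_log_iff_exp_le hy0).mpr hy1
  have hL2 : L ≤ l ^ 10 + 1 := by
    have h := Real.log_le_log hy0 hy2
    rw [Real.log_mul (by norm_num) (Real.exp_pos _).ne', Real.log_exp] at h
    have := Real.log_two_lt_d9
    linarith
  have hLp : 0 < L := by norm_num at h10; linarith
  have hyL : y = Real.exp L := (Real.exp_log hy0).symm
  have hy : 1 < y := by rw [hyL]; exact Real.one_lt_exp_iff.mpr hLp
  have hσδ : 1 / L ≤ c₂ / l ^ 9 := by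
    rw [div_le_div_iff₀ hLp (by positivity)]
    have : c₂ * (l ^ 10 / 2) ≤ c₂ * L := by gcongr
    have : 2 * l ^ 9 ≤ l * c₂ * l ^ 9 := by gcongr
    have : l * c₂ * l ^ 9 = c₂ * l ^ 10 := by ring
    linarith
  have hδ2 : c₂ / l ^ 9 ≤ 1 / 2 := by
    rw [div_le_div_iff₀ (by positivity) (by norm_num)]
    norm_num at h9; linarith
  have hT : 1 ≤ Real.exp l := Real.one_le_exp hl0.le
  obtain ⟨hsum, hAb⟩ := hA a ha L (1 + 1 / L) (by norm_num at h10; linarith) rfl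
  have hδ0 : 0 < c₂ / l ^ 9 := by positivity
  have hreg : ∀ s : ℂ, 1 - c₂ / l ^ 9 ≤ s.re → s.re ≤ 1 + 1 / L → |s.re - 1| ≤ c₂ / l ^ 9 := by
    intro s h1 h2
    rw [abs_le]; constructor <;> linarith
  have hmain := esz_contour a F y (c₂ / l ^ 9) (1 + 1 / L) (Real.exp l) _ B hy hδ0 hδ2 rfl (by linarith) hT
    hsum hAb (fun s h1 h2 h3 => (hF s (hreg s h1 h2) h3).1) (fun s h1 h2 h3 => (hF s (hreg s h1 h2) h3).2.1)
    (fun s h1 h3 => (hF s (hreg s (by rw [h1]; have : 0 < 1 / L := by positivity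
                                      linarith) h1.le) h3).2.2 (by rw [h1]; have : 0 < 1 / L := by positivity
                                                                   linarith))
  refine hmain.trans ?_
  have e1 : y ^ (-(c₂ / l ^ 9)) ≤ Real.exp (-(c₂ / 2) * l) := by
    rw [Real.rpow_def_of_pos hy0]
    apply Real.exp_le_exp.mpr
    have : c₂ / 2 * l = (l ^ 10 / 2) * (c₂ / l ^ 9) := by field_simp
    have : (l ^ 10 / 2) * (c₂ / l ^ 9) ≤ L * (c₂ / l ^ 9) := by gcongr
    rw [← hL]
    linarith
  have e2 : 1 / Real.exp l ≤ Real.exp (-(c₂ / 2) * l) := by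
    rw [one_div, ← Real.exp_neg]
    apply Real.exp_le_exp.mpr
    nlinarith
  have e3 : C0 * (1 + 2 * L) ^ 2 ≤ 25 * C0 * C1 * Real.exp (c₂ / 4 * l) := by
    have : (1 + 2 * L) ≤ 5 * l ^ 10 := by norm_num at h10; linarith
    calc C0 * (1 + 2 * L) ^ 2 ≤ C0 * (5 * l ^ 10) ^ 2 := by gcongr
      _ = 25 * C0 * l ^ 20 := by ring
      _ ≤ 25 * C0 * (C1 * Real.exp (c₂ / 4 * l)) := by gcongr; exact h20 l hl0.le
      _ = _ := by ring
  have hp1 : 1 ≤ Real.exp (c₂ / 4 * l) := Real.one_le_exp (by positivity)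
  have e4 : Real.exp (-(c₂ / 2) * l) * Real.exp (c₂ / 4 * l) = Real.exp (-(c₂ / 4) * l) := by
    rw [← Real.exp_add]; congr 1; ring
  set w := Real.exp (-(c₂ / 2) * l)
  set v := Real.exp (c₂ / 4 * l)
  have hw : 0 < w := Real.exp_pos _
  calc 6 * y * (B * y ^ (-(c₂ / l ^ 9)) + B / Real.exp l + C0 * (1 + 2 * L) ^ 2 / Real.exp l)
      = 6 * y * (B * y ^ (-(c₂ / l ^ 9)) + B * (1 / Real.exp l) + C0 * (1 + 2 * L) ^ 2 * (1 / Real.exp l)) := by ring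
    _ ≤ 6 * y * (B * w + B * w + (25 * C0 * C1 * v) * w) := by gcongr
    _ ≤ 6 * y * (B * (w * v) + B * (w * v) + (25 * C0 * C1 * v) * w * B) := by
        have : w ≤ w * v := le_mul_of_one_le_right hw.le hp1
        have : (25 * C0 * C1 * v) * w ≤ (25 * C0 * C1 * v) * w * B := by
          exact le_mul_of_one_le_right (by positivity) hB
        gcongr
    _ = 6 * (2 + 25 * C0 * C1) * B * (w * v) * y := by ring
    _ = _ := by rw [e4]

lemma esz_main (c₂ : ℝ) (hc : 0 < c₂) (hc1 : c₂ ≤ 1) : ∃ C l₀ : ℝ, 1 ≤ C ∧ 2 ≤ l₀ ∧ ∀ l : ℝ, l₀ ≤ l →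
    ∀ (a : ℕ → ℂ) (F : ℂ → ℂ) (B : ℝ), 1 ≤ B → (∀ n : ℕ, 1 ≤ n → ‖a n‖ ≤ 1 + Real.log n) →
    (∀ s : ℂ, |s.re - 1| ≤ c₂ / l ^ 9 → |s.im| ≤ Real.exp l → DifferentiableAt ℂ F s ∧ ‖F s‖ ≤ B ∧
      (1 < s.re → LSeries a s = F s)) →
    ∀ x : ℝ, x ≤ Real.exp (l ^ 10) →
    ‖∑ n ∈ Finset.Icc 1 ⌊x⌋₊, a n‖ ≤ C * B * Real.exp (l ^ 10) * Real.exp (-(c₂ / 16) * l) := by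
  obtain ⟨K, l₀, hK, hl₀, hS⟩ := esz_smooth c₂ hc hc1
  obtain ⟨C2, hC2, h10⟩ := esz_poly_exp 10 (c₂ / 16) (by positivity)
  refine ⟨5 * K + 4 * C2, l₀, by linarith, hl₀, ?_⟩
  intro l hl a F B hB ha hF x hxN
  have hl2 : 2 ≤ l := hl₀.trans hl
  have hl0 : 0 < l := by linarith
  have h2 : (2 : ℝ) ^ 10 ≤ l ^ 10 := by gcongr
  have h3 : 2 * l ≤ l ^ 10 := by
    calc 2 * l ≤ l * l := by gcongr
      _ = l ^ 2 := by ring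
      _ ≤ l ^ 10 := pow_le_pow_right₀ (by linarith) (by norm_num)
  norm_num at h2
  set N := Real.exp (l ^ 10) with hN
  have hN0 : 0 < N := Real.exp_pos _
  set u := Real.exp (-(c₂ / 8) * l) with hu
  have hu0 : 0 < u := Real.exp_pos _
  have hu1 : u ≤ 1 := Real.exp_le_one_iff.mpr (by nlinarith)
  have hul : l ^ 10 * u ≤ C2 * Real.exp (-(c₂ / 16) * l) := by
    calc l ^ 10 * u ≤ C2 * Real.exp (c₂ / 16 * l) * u := by gcongr; exact h10 l hl0.le
      _ = C2 * Real.exp (-(c₂ / 16) * l) := by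
        rw [mul_assoc, hu, ← Real.exp_add]; congr 2; ring
  have hu16 : u ≤ Real.exp (-(c₂ / 16) * l) := Real.exp_le_exp.mpr (by nlinarith)
  set r := Real.exp (-(c₂ / 16) * l)
  have hr0 : 0 < r := Real.exp_pos _
  have hhalf : Real.exp (l ^ 10 / 2) ≤ N * u := by
    rw [hN, hu, ← Real.exp_add]
    apply Real.exp_le_exp.mpr
    have : c₂ / 8 * l ≤ l := mul_le_of_le_one_left hl0.le (by linarith)
    linarith
  have h1N : 1 ≤ N * u := le_trans (Real.one_le_exp (by positivity)) hhalf
  by_cases hx : Real.exp (l ^ 10 / 2) ≤ x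
  · have hx1 : 1 ≤ x := le_trans (Real.one_le_exp (by positivity)) hx
    have hx0 : 0 < x := by linarith
    have hxu1 : x * u ≤ x := mul_le_of_le_one_right hx0.le hu1
    have hxu0 : 0 ≤ x * u := by positivity
    have hd := esz_desmooth a ha x (x * u) (K * B * Real.exp (-(c₂ / 4) * l)) hx1 (by positivity)
      hxu1 (hS l hl a F B hB ha hF x hx (by linarith))
      (hS l hl a F B hB ha hF (x + x * u) (by linarith) (by linarith))
    refine hd.trans ?_
    have e1 : 5 * x ^ 2 * (K * B * Real.exp (-(c₂ / 4) * l)) / (x * u) = 5 * K * B * x * u := by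
      have : Real.exp (-(c₂ / 4) * l) = u * u := by rw [hu, ← Real.exp_add]; congr 1; ring
      rw [this]; field_simp
    rw [e1]
    have hlog : 1 + Real.log (2 * x) ≤ 2 * l ^ 10 := by
      have : Real.log (2 * x) ≤ Real.log (2 * N) := Real.log_le_log (by positivity) (by linarith)
      rw [Real.log_mul (by norm_num) hN0.ne', hN, Real.log_exp] at this
      have := Real.log_two_lt_d9
      linarith
    have hlog0 : 0 ≤ 1 + Real.log (2 * x) := by
      have := Real.log_nonneg (show 1 ≤ 2 * x by linarith)
      linarith
    have hxu : x * u ≤ N * u := by gcongr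
    have hq : (x * u + 1) * (1 + Real.log (2 * x)) ≤ (N * u + N * u) * (2 * l ^ 10) :=
      mul_le_mul (by linarith) hlog hlog0 (by positivity)
    calc 5 * K * B * x * u + (x * u + 1) * (1 + Real.log (2 * x))
        ≤ 5 * K * B * N * r + (N * u + N * u) * (2 * l ^ 10) := by
          refine add_le_add ?_ hq
          gcongr
      _ = 5 * K * B * N * r + 4 * N * (l ^ 10 * u) := by ring
      _ ≤ 5 * K * B * N * r + 4 * N * (C2 * r) := by gcongr
      _ ≤ 5 * K * B * N * r + 4 * N * (C2 * r) * B := by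
        have : 4 * N * (C2 * r) ≤ 4 * N * (C2 * r) * B := le_mul_of_one_le_right (by positivity) hB
        linarith
      _ = _ := by ring
  · push Not at hx
    have h1h : 1 ≤ Real.exp (l ^ 10 / 2) := Real.one_le_exp (by positivity)
    have hfl : ((⌊x⌋₊ : ℕ) : ℝ) ≤ Real.exp (l ^ 10 / 2) := by
      rcases le_or_gt 0 x with h | h
      · exact (Nat.floor_le h).trans hx.le
      · rw [Nat.floor_of_nonpos h.le]; simp; positivity
    have ht := esz_triv a ha 0 ⌊x⌋₊ (Real.exp (l ^ 10 / 2)) (fun _ => 1) (by simp) (by simp) hfl h1h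
    have hIcc : Finset.Icc 1 ⌊x⌋₊ = Finset.Ioc 0 ⌊x⌋₊ := by ext n; simp [Nat.succ_le_iff]
    rw [hIcc]
    simp only [Complex.ofReal_one, mul_one, Nat.cast_zero, sub_zero, Real.log_exp] at ht
    refine ht.trans ?_
    calc (⌊x⌋₊ : ℝ) * (1 + l ^ 10 / 2) ≤ (N * u) * (4 * l ^ 10) := by
          gcongr
          · exact hfl.trans hhalf
          · linarith
      _ = 4 * N * (l ^ 10 * u) := by ring
      _ ≤ 4 * N * (C2 * r) := by gcongr
      _ ≤ 4 * N * (C2 * r) * B := by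
        have : 4 * N * (C2 * r) ≤ 4 * N * (C2 * r) * B := le_mul_of_one_le_right (by positivity) hB
        linarith
      _ ≤ (5 * K + 4 * C2) * B * N * r := by
        have : 0 ≤ 5 * K * B * N * r := by positivity
        calc 4 * N * (C2 * r) * B ≤ 5 * K * B * N * r + 4 * N * (C2 * r) * B := by linarith
          _ = _ := by ring

open ArithmeticFunction in
lemma esz_mu_le (n : ℕ) : ‖((moebius n : ℤ) : ℂ)‖ ≤ 1 := by
  rw [Complex.norm_intCast]
  exact_mod_cast abs_moebius_le_one

open ArithmeticFunction in
lemma esz_a_mu {m : ℕ} (χ : DirichletCharacter ℂ m) (n : ℕ) (hn : 1 ≤ n) :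
    ‖χ (n : ZMod m) * ((moebius n : ℤ) : ℂ)‖ ≤ 1 + Real.log n := by
  rw [norm_mul]
  have h1 := χ.norm_le_one (n : ZMod m)
  have h2 := esz_mu_le n
  have h3 : 0 ≤ Real.log n := Real.log_natCast_nonneg n
  nlinarith [norm_nonneg (χ (n : ZMod m)), norm_nonneg ((moebius n : ℤ) : ℂ)]

open ArithmeticFunction in
lemma esz_a_La {m : ℕ} (χ : DirichletCharacter ℂ m) (n : ℕ) (hn : 1 ≤ n) :
    ‖χ (n : ZMod m) * ((vonMangoldt n : ℝ) : ℂ)‖ ≤ 1 + Real.log n := by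
  rw [norm_mul, Complex.norm_real, Real.norm_of_nonneg vonMangoldt_nonneg]
  have h1 := χ.norm_le_one (n : ZMod m)
  have h2 : vonMangoldt n ≤ Real.log n := vonMangoldt_le_log
  have h3 : 0 ≤ vonMangoldt n := vonMangoldt_nonneg
  nlinarith [norm_nonneg (χ (n : ZMod m))]

lemma esz_pp (p : ℕ) (hp : p.Prime) (s : ℂ) (hs : 1 / 2 ≤ s.re) :
    ((p : ℝ) ^ 2)⁻¹ ≤ ‖1 - (p : ℂ) ^ (-s)‖ := by
  have hp2 : (2 : ℝ) ≤ p := by exact_mod_cast hp.two_le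
  have h1 : ‖(p : ℂ) ^ (-s)‖ ≤ 3 / 4 := by
    rw [Complex.norm_natCast_cpow_of_pos hp.pos]
    calc (p : ℝ) ^ (-s).re ≤ (p : ℝ) ^ (-(1/2) : ℝ) := by
          apply Real.rpow_le_rpow_of_exponent_le (by linarith)
          simp; linarith
      _ ≤ (2 : ℝ) ^ (-(1/2) : ℝ) := Real.rpow_le_rpow_of_nonpos (by norm_num) hp2 (by norm_num)
      _ ≤ 3 / 4 := by
        rw [Real.rpow_neg (by norm_num), ← Real.sqrt_eq_rpow, inv_le_comm₀ (by positivity) (by norm_num)]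
        apply Real.le_sqrt_of_sq_le; norm_num
  have h2 : 1 - ‖(p : ℂ) ^ (-s)‖ ≤ ‖1 - (p : ℂ) ^ (-s)‖ := by
    simpa using norm_sub_norm_le (1 : ℂ) ((p : ℂ) ^ (-s))
  have h3 : ((p : ℝ) ^ 2)⁻¹ ≤ ((2 : ℝ) ^ 2)⁻¹ := by gcongr
  norm_num at h3 h2 ⊢
  linarith

lemma esz_pprod (m : ℕ) (hm : m ≠ 0) (s : ℂ) (hs : 1 / 2 ≤ s.re) :
    ((m : ℝ) ^ 2)⁻¹ ≤ ‖∏ p ∈ m.primeFactors, (1 - (p : ℂ) ^ (-s))‖ := by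
  rw [norm_prod]
  calc ((m : ℝ) ^ 2)⁻¹ ≤ (((∏ p ∈ m.primeFactors, p : ℕ) : ℝ) ^ 2)⁻¹ := by
        have : (∏ p ∈ m.primeFactors, p : ℕ) ≤ m := Nat.le_of_dvd (Nat.pos_of_ne_zero hm) (Nat.prod_primeFactors_dvd m)
        have h0 : 0 < (∏ p ∈ m.primeFactors, p : ℕ) := Finset.prod_pos fun p hp => (Nat.prime_of_mem_primeFactors hp).pos
        have h0' : (0 : ℝ) < ((∏ p ∈ m.primeFactors, p : ℕ) : ℝ) := by exact_mod_cast h0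
        gcongr
    _ = ∏ p ∈ m.primeFactors, ((p : ℝ) ^ 2)⁻¹ := by
        push_cast
        rw [← Finset.prod_pow, Finset.prod_inv_distrib]
    _ ≤ _ := Finset.prod_le_prod (fun p _ => by positivity) fun p hp =>
        esz_pp p (Nat.prime_of_mem_primeFactors hp) s hs

open ArithmeticFunction in
lemma esz_mu_L {m : ℕ} [NeZero m] (χ : DirichletCharacter ℂ m) (s : ℂ) (hs : 1 < s.re) :
    LSeries (fun n => χ (n : ZMod m) * ((moebius n : ℤ) : ℂ)) s = (χ.LFunction s)⁻¹ := by
  have h := DirichletCharacter.LSeries.mul_mu_eq_one χ hs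
  rw [← χ.LFunction_eq_LSeries hs] at h
  exact (eq_inv_of_mul_eq_one_right h)

lemma esz_region (c₂ l : ℝ) (hc : 0 < c₂) (hc1 : c₂ ≤ 1) (hl : 2 ≤ l) (s : ℂ) (h : |s.re - 1| ≤ c₂ / l ^ 9) :
    1 - 1 / (2 * l) ≤ s.re ∧ 1 / 2 ≤ s.re ∧ |s.re - 1| ≤ 1 := by
  have h1 : c₂ / l ^ 9 ≤ 1 / (2 * l) := by
    rw [div_le_div_iff₀ (by positivity) (by positivity)]
    have : 2 * l ≤ l ^ 9 := by
      calc 2 * l ≤ l * l := by gcongr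
        _ = l ^ 2 := by ring
        _ ≤ l ^ 9 := pow_le_pow_right₀ (by linarith) (by norm_num)
    nlinarith
  have h2 : 1 / (2 * l) ≤ 1 / 2 := by
    gcongr; linarith
  have h3 := abs_le.mp h
  exact ⟨by linarith, by linarith, by linarith⟩

open ArithmeticFunction in
lemma esz_mu_sum : ∃ c C l₀ : ℝ, 0 < c ∧ c ≤ 1 ∧ 1 ≤ C ∧ 2 ≤ l₀ ∧ ∀ l : ℝ, l₀ ≤ l → eszH l →
    ∀ (m : ℕ) [NeZero m] (χ : DirichletCharacter ℂ m), (m : ℝ) < Real.exp l → ∀ x : ℝ, x ≤ Real.exp (l ^ 10) →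
    ‖∑ n ∈ Finset.Icc 1 ⌊x⌋₊, χ (n : ZMod m) * ((moebius n : ℤ) : ℂ)‖ ≤
      C * (m : ℝ) ^ 2 * Real.exp (l ^ 10) * Real.exp (-c * l) := by
  obtain ⟨d₂, d, l₁, hd₂, hd₂1, hd, hl₁, hLB⟩ := esz_LB
  obtain ⟨e₂, e, l₂, he₂, he₂1, he, he1, hl₂, hzlb⟩ := esz_zlb
  obtain ⟨C, l₃, hC, hl₃, hM⟩ := esz_main (min d₂ e₂) (by positivity) ((min_le_left _ _).trans hd₂1)
  set c₂ := min d₂ e₂ with hc₂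
  have hc₂0 : 0 < c₂ := by positivity
  have hc₂1 : c₂ ≤ 1 := (min_le_left _ _).trans hd₂1
  obtain ⟨C7, hC7, h7⟩ := esz_poly_exp 7 (c₂ / 32) (by positivity)
  set D := max 1 (max (1 / d) (1 / e)) with hD
  have hD1 : 1 ≤ D := le_max_left _ _
  refine ⟨c₂ / 32, C * D * C7, max l₁ (max l₂ l₃), by positivity, by linarith, ?_,
    hl₁.trans (le_max_left _ _), ?_⟩
  · have := one_le_mul_of_one_le_of_one_le hC hD1
    exact one_le_mul_of_one_le_of_one_le this hC7
  intro l hl H m _ χ hm x hx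
  have hll₁ : l₁ ≤ l := (le_max_left _ _).trans hl
  have hll₂ : l₂ ≤ l := (le_max_left _ _).trans ((le_max_right _ _).trans hl)
  have hll₃ : l₃ ≤ l := (le_max_right _ _).trans ((le_max_right _ _).trans hl)
  have hl2 : 2 ≤ l := hl₁.trans hll₁
  have hl0 : 0 < l := by linarith
  have hm1 : (1 : ℝ) ≤ m := by exact_mod_cast Nat.one_le_iff_ne_zero.mpr (NeZero.ne m)
  have hB1 : 1 ≤ D * l ^ 7 * (m : ℝ) ^ 2 :=
    one_le_mul_of_one_le_of_one_le (one_le_mul_of_one_le_of_one_le hD1 (one_le_pow₀ (by linarith))) (one_le_pow₀ hm1)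
  have key : ∃ F : ℂ → ℂ, ∀ s : ℂ, |s.re - 1| ≤ c₂ / l ^ 9 → |s.im| ≤ Real.exp l → DifferentiableAt ℂ F s ∧
      ‖F s‖ ≤ D * l ^ 7 * (m : ℝ) ^ 2 ∧
      (1 < s.re → LSeries (fun n => χ (n : ZMod m) * ((moebius n : ℤ) : ℂ)) s = F s) := by
    by_cases hχ : χ = 1
    · subst hχ
      refine ⟨fun s => (s - 1) * (riemannZeta₁ s * ∏ p ∈ m.primeFactors, (1 - (p : ℂ) ^ (-s)))⁻¹, ?_⟩
      intro s hre him
      have hre' : |s.re - 1| ≤ e₂ / l ^ 9 := hre.trans (by gcongr; exact min_le_right _ _)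
      obtain ⟨hz1, hz2⟩ := hzlb l hll₂ s hre' him
      have hz0 : riemannZeta₁ s ≠ 0 := by
        intro h
        rw [h, norm_zero] at hz2
        have : 0 < e / l ^ 8 := by positivity
        linarith
      obtain ⟨_, hs2, _⟩ := esz_region c₂ l hc₂0 hc₂1 hl2 s hre
      have hpp := esz_pprod m (NeZero.ne m) s hs2
      have hp0 : ∏ p ∈ m.primeFactors, (1 - (p : ℂ) ^ (-s)) ≠ 0 := by
        intro h
        rw [h, norm_zero] at hpp
        have : 0 < ((m : ℝ) ^ 2)⁻¹ := by positivity
        linarith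
      refine ⟨?_, ?_, ?_⟩
      · refine DifferentiableAt.mul (by fun_prop) (DifferentiableAt.inv ?_ (mul_ne_zero hz0 hp0))
        refine (differentiable_riemannZeta₁ s).mul ?_
        refine DifferentiableAt.fun_finsetProd fun p hp => ?_
        have : (p : ℂ) ≠ 0 := by exact_mod_cast (Nat.prime_of_mem_primeFactors hp).ne_zero
        exact (differentiableAt_const _).sub (DifferentiableAt.const_cpow (by fun_prop) (Or.inl this))
      · rw [norm_mul, norm_inv, norm_mul, ← div_eq_mul_inv, div_le_iff₀ (by positivity)]
        have hDe : 1 ≤ D * e := by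
          have : 1 / e ≤ D := (le_max_right _ _).trans (le_max_right _ _)
          rwa [div_le_iff₀ he] at this
        calc ‖s - 1‖ ≤ (D * e) * ‖s - 1‖ := le_mul_of_one_le_left (norm_nonneg _) hDe
          _ = D * l ^ 7 * (m : ℝ) ^ 2 * ((e / l ^ 7 * ‖s - 1‖) * ((m : ℝ) ^ 2)⁻¹) := by field_simp
          _ ≤ _ := by gcongr
      · intro hs
        have hs1 : s ≠ 1 := by rintro rfl; simp at hs
        have h1 : s - 1 ≠ 0 := sub_ne_zero.mpr hs1
        rw [esz_mu_L _ s hs]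
        have := DirichletCharacter.LFunctionTrivChar_eq_mul_riemannZeta (N := m) hs1
        rw [DirichletCharacter.LFunctionTrivChar] at this
        rw [this, riemannZeta_eq_inv_sub_mul hs1]
        field_simp
    · refine ⟨fun s => (χ.LFunction s)⁻¹, fun s hre him => ?_⟩
      have hre' : |s.re - 1| ≤ d₂ / l ^ 9 := hre.trans (by gcongr; exact min_le_left _ _)
      have hb := hLB l hll₁ H m χ s hm hχ hre' him
      have hpos : 0 < d / l ^ 7 := by positivity
      have hn0 : χ.LFunction s ≠ 0 := norm_pos_iff.mp (lt_of_lt_of_le hpos hb)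
      refine ⟨(DirichletCharacter.differentiable_LFunction hχ s).inv hn0, ?_, fun hs => esz_mu_L _ s hs⟩
      rw [norm_inv]
      calc ‖χ.LFunction s‖⁻¹ ≤ (d / l ^ 7)⁻¹ := by gcongr
        _ = (1 / d) * l ^ 7 := by field_simp
        _ ≤ D * l ^ 7 := by gcongr; exact (le_max_left _ _).trans (le_max_right _ _)
        _ ≤ D * l ^ 7 * (m : ℝ) ^ 2 := le_mul_of_one_le_right (by positivity) (one_le_pow₀ hm1)
  obtain ⟨F, hF⟩ := key
  have := hM l hll₃ _ F (D * l ^ 7 * (m : ℝ) ^ 2) hB1 (fun n hn => esz_a_mu χ n hn) hF x hx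
  refine this.trans ?_
  have hexp : Real.exp (c₂ / 32 * l) * Real.exp (-(c₂ / 16) * l) = Real.exp (-(c₂ / 32) * l) := by
    rw [← Real.exp_add]; congr 1; ring
  calc C * (D * l ^ 7 * (m : ℝ) ^ 2) * Real.exp (l ^ 10) * Real.exp (-(c₂ / 16) * l)
      ≤ C * (D * (C7 * Real.exp (c₂ / 32 * l)) * (m : ℝ) ^ 2) * Real.exp (l ^ 10) * Real.exp (-(c₂ / 16) * l) := by
        gcongr; exact h7 l hl0.le
    _ = C * D * C7 * (m : ℝ) ^ 2 * Real.exp (l ^ 10) * (Real.exp (c₂ / 32 * l) * Real.exp (-(c₂ / 16) * l)) := by ring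
    _ = _ := by rw [hexp]


lemma esz_absorb (c₂ : ℝ) (hc : 0 < c₂) (k : ℕ) : ∃ C7 : ℝ, 1 ≤ C7 ∧ ∀ l C D M N : ℝ, 0 ≤ l → 0 ≤ C → 0 ≤ D →
    0 ≤ N → C * (D * l ^ k) * N * Real.exp (-(c₂ / 16) * l) ≤ C * D * C7 * N * Real.exp (-(c₂ / 32) * l) := by
  obtain ⟨C7, hC7, h7⟩ := esz_poly_exp k (c₂ / 32) (by positivity)
  refine ⟨C7, hC7, fun l C D M N hl hC hD hN => ?_⟩
  have hexp : Real.exp (c₂ / 32 * l) * Real.exp (-(c₂ / 16) * l) = Real.exp (-(c₂ / 32) * l) := by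
    rw [← Real.exp_add]; congr 1; ring
  calc C * (D * l ^ k) * N * Real.exp (-(c₂ / 16) * l)
      ≤ C * (D * (C7 * Real.exp (c₂ / 32 * l))) * N * Real.exp (-(c₂ / 16) * l) := by
        gcongr; exact h7 l hl
    _ = C * D * C7 * N * (Real.exp (c₂ / 32 * l) * Real.exp (-(c₂ / 16) * l)) := by ring
    _ = _ := by rw [hexp]

open ArithmeticFunction in
lemma esz_La_L {m : ℕ} [NeZero m] (χ : DirichletCharacter ℂ m) (s : ℂ) (hs : 1 < s.re) :
    LSeries (fun n => χ (n : ZMod m) * ((vonMangoldt n : ℝ) : ℂ)) s = -deriv χ.LFunction s / χ.LFunction s := by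
  have h := DirichletCharacter.LSeries_twist_vonMangoldt_eq χ hs
  rw [← χ.LFunction_eq_LSeries hs, ← χ.deriv_LFunction_eq_deriv_LSeries hs] at h
  exact h

open ArithmeticFunction in
lemma esz_La_sum : ∃ c C l₀ : ℝ, 0 < c ∧ c ≤ 1 ∧ 1 ≤ C ∧ 2 ≤ l₀ ∧ ∀ l : ℝ, l₀ ≤ l → eszH l →
    ∀ (m : ℕ) [NeZero m] (χ : DirichletCharacter ℂ m), (m : ℝ) < Real.exp l → χ ≠ 1 → ∀ x : ℝ, x ≤ Real.exp (l ^ 10) →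
    ‖∑ n ∈ Finset.Icc 1 ⌊x⌋₊, χ (n : ZMod m) * ((vonMangoldt n : ℝ) : ℂ)‖ ≤
      C * Real.exp (l ^ 10) * Real.exp (-c * l) := by
  obtain ⟨c₂, d, l₁, hc₂0, hc₂1, hd, hl₁, hLB⟩ := esz_LB
  obtain ⟨C1, hC1, hder⟩ := esz_deriv 1 one_pos le_rfl
  obtain ⟨C, l₃, hC, hl₃, hM⟩ := esz_main c₂ hc₂0 hc₂1
  obtain ⟨C7, hC7, h7⟩ := esz_absorb c₂ hc₂0 9
  set D := max 1 (C1 / d) with hD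
  have hD1 : 1 ≤ D := le_max_left _ _
  refine ⟨c₂ / 32, C * D * C7, max l₁ l₃, by positivity, by linarith, ?_,
    hl₁.trans (le_max_left _ _), ?_⟩
  · have := one_le_mul_of_one_le_of_one_le hC hD1
    exact one_le_mul_of_one_le_of_one_le this hC7
  intro l hl H m _ χ hm hχ x hx
  have hll₁ : l₁ ≤ l := (le_max_left _ _).trans hl
  have hll₃ : l₃ ≤ l := (le_max_right _ _).trans hl
  have hl2 : 2 ≤ l := hl₁.trans hll₁
  have hl0 : 0 < l := by linarith
  have := hM l hll₃ _ (fun s => -deriv χ.LFunction s / χ.LFunction s) (D * l ^ 9)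
    (one_le_mul_of_one_le_of_one_le hD1 (one_le_pow₀ (by linarith))) (fun n hn => esz_a_La χ n hn) (by
    intro s hre him
    have hb := hLB l hll₁ H m χ s hm hχ hre him
    have hpos : 0 < d / l ^ 7 := by positivity
    have hn0 : χ.LFunction s ≠ 0 := norm_pos_iff.mp (lt_of_lt_of_le hpos hb)
    have hdiff := DirichletCharacter.differentiable_LFunction hχ
    refine ⟨(hdiff.deriv s).neg.div (hdiff s) hn0, ?_, fun hs => esz_La_L _ s hs⟩
    obtain ⟨hs1, hs2, hs3⟩ := esz_region c₂ l hc₂0 hc₂1 hl2 s hre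
    have hdb := hder l m χ s hl2 hm.le hs1 (by
      have := esz_norm_aux s _ hs3 him
      have := esz_exp_aux l hl2
      have := Real.exp_pos l
      linarith) (Or.inl hχ)
    rw [norm_div, norm_neg]
    calc ‖deriv χ.LFunction s‖ / ‖χ.LFunction s‖ ≤ (C1 * l ^ 2) / (d / l ^ 7) := by gcongr
      _ = (C1 / d) * l ^ 9 := by field_simp
      _ ≤ D * l ^ 9 := by gcongr; exact le_max_right _ _) x hx
  exact this.trans (h7 l C D 0 _ hl0.le (by linarith) (by linarith) (Real.exp_pos _).le)

lemma esz_near_bd : ∃ r K : ℝ, 0 < r ∧ r ≤ 1 ∧ 1 ≤ K ∧ ∀ s : ℂ, ‖s - 1‖ ≤ r →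
    ‖-(deriv riemannZeta₁ s / riemannZeta₁ s) - riemannZeta₀ s‖ ≤ K := by
  obtain ⟨r, hr, hr1, hnear⟩ := esz_zeta1_near
  have hcpt : IsCompact (Metric.closedBall (1 : ℂ) r) := isCompact_closedBall _ _
  obtain ⟨K1, hK1⟩ := hcpt.exists_bound_of_continuousOn
    (f := deriv riemannZeta₁) differentiable_riemannZeta₁.deriv.continuous.continuousOn
  obtain ⟨K2, hK2⟩ := hcpt.exists_bound_of_continuousOn
    (f := riemannZeta₀) differentiable_riemannZeta₀.continuous.continuousOn
  refine ⟨r, max 1 (2 * K1 + K2), hr, hr1, le_max_left _ _, fun s hs => ?_⟩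
  have hmem : s ∈ Metric.closedBall (1 : ℂ) r := by rwa [Metric.mem_closedBall, dist_eq_norm]
  have h12 : 1 / 2 ≤ ‖riemannZeta₁ s‖ := by
      have h3 := hnear s hs
      have h4 : ‖(1 : ℂ)‖ ≤ ‖riemannZeta₁ s‖ + ‖riemannZeta₁ s - 1‖ := by
        rw [norm_sub_rev]
        calc ‖(1 : ℂ)‖ = ‖riemannZeta₁ s + (1 - riemannZeta₁ s)‖ := by ring_nf
          _ ≤ _ := norm_add_le _ _
      rw [norm_one] at h4; linarith
  refine (norm_sub_le _ _).trans (le_trans ?_ (le_max_right _ _))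
  refine add_le_add ?_ (hK2 s hmem)
  rw [norm_neg, norm_div, div_le_iff₀ (by linarith)]
  have := hK1 s hmem
  nlinarith [norm_nonneg (deriv riemannZeta₁ s)]

open ArithmeticFunction in
lemma esz_psi_L (s : ℂ) (hs : 1 < s.re) :
    LSeries (fun n => ((vonMangoldt n - 1 : ℝ) : ℂ)) s = - deriv riemannZeta s / riemannZeta s - riemannZeta s := by
  have h := LSeries_sub (LSeriesSummable_vonMangoldt hs) (LSeriesSummable_one_iff.mpr hs)
  rw [LSeries_vonMangoldt_eq_deriv_riemannZeta_div hs, LSeries_one_eq_riemannZeta hs] at h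
  rw [← h]
  congr 1
  ext n; simp

open ArithmeticFunction in
lemma esz_psi_sum : ∃ c C l₀ : ℝ, 0 < c ∧ c ≤ 1 ∧ 1 ≤ C ∧ 2 ≤ l₀ ∧ ∀ l : ℝ, l₀ ≤ l →
    ∀ x : ℝ, x ≤ Real.exp (l ^ 10) →
    ‖∑ n ∈ Finset.Icc 1 ⌊x⌋₊, ((vonMangoldt n - 1 : ℝ) : ℂ)‖ ≤
      C * Real.exp (l ^ 10) * Real.exp (-c * l) := by
  obtain ⟨c₂, e, l₂, hc₂0, hc₂1, he, he1, hl₂, hzlb⟩ := esz_zlb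
  obtain ⟨r, K, hr, hr1, hK, hnear⟩ := esz_near_bd
  obtain ⟨C1, hC1, hder⟩ := esz_deriv r hr hr1
  obtain ⟨C0, hC0, hU⟩ := esz_U
  obtain ⟨C, l₃, hC, hl₃, hM⟩ := esz_main c₂ hc₂0 hc₂1
  obtain ⟨C7, hC7, h7⟩ := esz_absorb c₂ hc₂0 9
  set D := max K (C1 / e + C0 * (1 + 1 / r)) with hD
  have hD1 : 1 ≤ D := hK.trans (le_max_left _ _)
  refine ⟨c₂ / 32, C * D * C7, max l₂ l₃, by positivity, by linarith, ?_,
    hl₂.trans (le_max_left _ _), ?_⟩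
  · have := one_le_mul_of_one_le_of_one_le hC hD1
    exact one_le_mul_of_one_le_of_one_le this hC7
  intro l hl x hx
  have hll₂ : l₂ ≤ l := (le_max_left _ _).trans hl
  have hll₃ : l₃ ≤ l := (le_max_right _ _).trans hl
  have hl2 : 2 ≤ l := hl₂.trans hll₂
  have hl0 : 0 < l := by linarith
  have := hM l hll₃ (fun n => ((vonMangoldt n - 1 : ℝ) : ℂ)) (fun s => -(deriv riemannZeta₁ s / riemannZeta₁ s) - riemannZeta₀ s) (D * l ^ 9)
    (one_le_mul_of_one_le_of_one_le hD1 (one_le_pow₀ (by linarith))) (fun n hn => by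
      rw [Complex.norm_real, Real.norm_eq_abs, abs_le]
      have h2 : vonMangoldt n ≤ Real.log n := vonMangoldt_le_log
      have h3 : 0 ≤ vonMangoldt n := vonMangoldt_nonneg
      have h4 : 0 ≤ Real.log n := Real.log_natCast_nonneg n
      constructor <;> linarith) (by
    intro s hre him
    obtain ⟨hz1, hz2⟩ := hzlb l hll₂ s hre him
    have hz0 : riemannZeta₁ s ≠ 0 := by
      intro h
      rw [h, norm_zero] at hz2
      have : 0 < e / l ^ 8 := by positivity
      linarith
    have hform : s ≠ 1 → -(deriv riemannZeta₁ s / riemannZeta₁ s) - riemannZeta₀ s =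
        - deriv riemannZeta s / riemannZeta s - riemannZeta s := by
      intro hs
      have h1 : s - 1 ≠ 0 := sub_ne_zero.mpr hs
      have h2 := riemannZeta_eq_inv_sub_add hs
      rw [deriv_riemannZeta_eq_neg_inv_sub_sq_mul_add hs]
      have h3 : riemannZeta₀ s = riemannZeta s - (s - 1)⁻¹ := by rw [h2]; ring
      rw [h3, riemannZeta_eq_inv_sub_mul hs]
      field_simp
      ring
    refine ⟨?_, ?_, ?_⟩
    · exact (((differentiable_riemannZeta₁.deriv s).div (differentiable_riemannZeta₁ s) hz0).neg).sub
        (differentiable_riemannZeta₀ s)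
    · by_cases hs : ‖s - 1‖ ≤ r / l
      · refine (hnear s (hs.trans (div_le_self hr.le (by linarith)))).trans ?_
        calc K ≤ D := le_max_left _ _
          _ ≤ D * l ^ 9 := le_mul_of_one_le_right (by linarith) (one_le_pow₀ (by linarith))
      · push Not at hs
        have hrl : 0 < r / l := by positivity
        have hs1 : s ≠ 1 := by rintro rfl; simp at hs; linarith
        have h1 : 0 < ‖s - 1‖ := hrl.trans hs
        have hlow : e / l ^ 7 ≤ ‖riemannZeta s‖ := by
          rw [riemannZeta_eq_inv_sub_mul hs1, norm_mul, norm_inv, inv_mul_eq_div, le_div_iff₀ h1]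
          exact hz1
        obtain ⟨hr1, hr2, hr3⟩ := esz_region c₂ l hc₂0 hc₂1 hl2 s hre
        have hnn := esz_norm_aux s _ hr3 him
        have hee := esz_exp_aux l hl2
        have hep := Real.exp_pos l
        have hm1 : ((1 : ℕ) : ℝ) ≤ Real.exp l := by simpa using hl0.le
        have hdb := hder l 1 1 s hl2 hm1 hr1 (by linarith) (Or.inr hs.le)
        have hub := (hU l 1 1 s hl2 hm1 (by
          have : 1 / (2 * l) ≤ 1 / l := by gcongr; linarith
          linarith) (by linarith)).2 hs1
        rw [DirichletCharacter.LFunction_modOne_eq] at hdb hub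
        rw [hform hs1]
        refine (norm_sub_le _ _).trans ?_
        rw [norm_div, norm_neg]
        have e1 : ‖deriv riemannZeta s‖ / ‖riemannZeta s‖ ≤ (C1 / e) * l ^ 9 := by
          calc _ ≤ (C1 * l ^ 2) / (e / l ^ 7) := by gcongr
            _ = _ := by field_simp
        have e2 : ‖riemannZeta s‖ ≤ C0 * (1 + 1 / r) * l ^ 9 := by
          have h3 : 1 / ‖s - 1‖ ≤ 1 / (r / l) := by gcongr
          calc ‖riemannZeta s‖ ≤ C0 * (l + 1 / ‖s - 1‖) := hub
            _ ≤ C0 * (l + 1 / (r / l)) := by gcongr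
            _ = C0 * (1 + 1 / r) * l := by field_simp
            _ ≤ C0 * (1 + 1 / r) * l ^ 9 := by
              gcongr
              exact le_self_pow₀ (by linarith) (by norm_num)
        calc _ ≤ (C1 / e) * l ^ 9 + C0 * (1 + 1 / r) * l ^ 9 := add_le_add e1 e2
          _ = (C1 / e + C0 * (1 + 1 / r)) * l ^ 9 := by ring
          _ ≤ D * l ^ 9 := by gcongr; exact le_max_right _ _
    · intro hs
      have hs1 : s ≠ 1 := by rintro rfl; simp at hs
      rw [esz_psi_L s hs]
      exact (hform hs1).symm) x hx
  exact this.trans (h7 l C D 0 _ hl0.le (by linarith) (by linarith) (Real.exp_pos _).le)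


noncomputable def eszPs (l : ℝ) : Finset ℕ :=
  (Finset.range (⌈Real.exp l⌉₊ + 1)).filter fun p => Nat.Prime p ∧ (p : ℝ) < Real.exp l

lemma esz_mem_Ps (l : ℝ) (p : ℕ) : p ∈ eszPs l ↔ p.Prime ∧ (p : ℝ) < Real.exp l := by
  unfold eszPs
  rw [Finset.mem_filter, Finset.mem_range]
  constructor
  · exact fun h => h.2
  · intro h
    refine ⟨?_, h⟩
    have : p < ⌈Real.exp l⌉₊ := Nat.lt_ceil.mpr h.2
    omega

/-- number of `n ≤ X` in a residue class -/
lemma esz_count (X a m : ℕ) (hm : 0 < m) :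
    |(((Finset.Ioc 0 X).filter (fun n => n % m = a % m)).card : ℝ) - (X : ℝ) / m| ≤ 1 := by
  have h1 := Nat.Ioc_filter_modEq_card 0 X hm a
  have hm' : (0 : ℝ) < m := by exact_mod_cast hm
  have h2 : (Finset.Ioc 0 X).filter (fun n => n % m = a % m) =
      (Finset.Ioc 0 X).filter (fun n => n ≡ a [MOD m]) := rfl
  rw [h2]
  set K := ((Finset.Ioc 0 X).filter (fun n => n ≡ a [MOD m])).card with hK
  set u : ℚ := ((X : ℚ) - a) / m with hu
  set v : ℚ := (((0 : ℕ) : ℚ) - a) / m with hv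
  have huv : ((u : ℚ) : ℝ) - (v : ℚ) = (X : ℝ) / m := by
    rw [hu, hv]; push_cast; ring
  have hle : ⌊v⌋ ≤ ⌊u⌋ := by
    apply Int.floor_le_floor
    rw [hu, hv]
    gcongr
    simp
  rw [max_eq_left (by linarith)] at h1
  have h3 : (K : ℝ) = (⌊u⌋ : ℝ) - ⌊v⌋ := by exact_mod_cast h1
  rw [h3, ← huv]
  have a1 : (⌊u⌋ : ℝ) ≤ u := by exact_mod_cast Int.floor_le u
  have a2 : (u : ℝ) < ⌊u⌋ + 1 := by exact_mod_cast Int.lt_floor_add_one u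
  have a3 : (⌊v⌋ : ℝ) ≤ v := by exact_mod_cast Int.floor_le v
  have a4 : (v : ℝ) < ⌊v⌋ + 1 := by exact_mod_cast Int.lt_floor_add_one v
  rw [abs_le]
  constructor <;> linarith

lemma esz_countd (X a m d : ℕ) (hm : 0 < m) (hd : 0 < d) (hc : d.Coprime m) (ε : ℝ) (h0 : 0 ≤ ε)
    (h1 : ε ≤ 1) :
    |(((Finset.Ioc 0 X).filter (fun n => n % m = a % m ∧ d ∣ n)).card : ℝ) - (X : ℝ) / (m * d)| ≤
      ((X : ℝ) / d) ^ (1 - ε) := by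
  have hm' : (0 : ℝ) < m := by exact_mod_cast hm
  have hm1 : (1 : ℝ) ≤ m := by exact_mod_cast hm
  have hd' : (0 : ℝ) < d := by exact_mod_cast hd
  rcases lt_or_ge X d with h | h
  · have he : (Finset.Ioc 0 X).filter (fun n => n % m = a % m ∧ d ∣ n) = ∅ := by
      rw [Finset.filter_eq_empty_iff]
      intro n hn hh
      rw [Finset.mem_Ioc] at hn
      have := Nat.le_of_dvd hn.1 hh.2
      omega
    rw [he]
    simp only [Finset.card_empty, Nat.cast_zero, zero_sub, abs_neg]
    rw [abs_of_nonneg (by positivity)]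
    have hX : (X : ℝ) / d ≤ 1 := by
      rw [div_le_one hd']; exact_mod_cast h.le
    have hX0 : 0 ≤ (X : ℝ) / d := by positivity
    calc (X : ℝ) / (m * d) ≤ X / (1 * d) := by gcongr
      _ = X / d := by rw [one_mul]
      _ ≤ _ := by
        rcases hX0.eq_or_lt with h | h
        · rw [← h]; apply Real.rpow_nonneg le_rfl
        · exact Real.self_le_rpow_of_le_one hX0 hX (by linarith)
  · obtain ⟨b, hb1, hb2⟩ := Nat.chineseRemainder hc 0 a
    have hs : (Finset.Ioc 0 X).filter (fun n => n % m = a % m ∧ d ∣ n) =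
        (Finset.Ioc 0 X).filter (fun n => n % (m * d) = b % (m * d)) := by
      apply Finset.filter_congr
      intro n _
      have : n % (m * d) = b % (m * d) ↔ n ≡ b [MOD m * d] := Iff.rfl
      rw [this, ← Nat.modEq_and_modEq_iff_modEq_mul hc.symm]
      apply and_congr
      · exact ⟨fun h => Nat.ModEq.trans h hb2.symm, fun h => h.trans hb2⟩
      · rw [← Nat.modEq_zero_iff_dvd]
        exact ⟨fun h => h.trans hb1.symm, fun h => h.trans hb1⟩
    rw [hs]
    have := esz_count X b (m * d) (Nat.mul_pos hm hd)
    push_cast at this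
    refine this.trans ?_
    apply Real.one_le_rpow _ (by linarith)
    rw [one_le_div hd']
    exact_mod_cast h

lemma esz_sieve_core (X a m : ℕ) (hm : 0 < m) (T : Finset ℕ) (hT : ∀ p ∈ T, p.Prime ∧ ¬ p ∣ m) (ε : ℝ)
    (h0 : 0 ≤ ε) (h1 : ε ≤ 1) :
    |∑ n ∈ (Finset.Ioc 0 X).filter (fun n => n % m = a % m),
        ∏ p ∈ T, (1 + if p ∣ n then (-1 : ℝ) else 0) - (X : ℝ) / m * ∏ p ∈ T, (1 + -(1 / (p : ℝ)))| ≤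
      (X : ℝ) ^ (1 - ε) * ∏ p ∈ T, (1 + (p : ℝ) ^ (ε - 1)) := by
  simp_rw [Finset.prod_one_add]
  rw [Finset.sum_comm, Finset.mul_sum, Finset.mul_sum, ← Finset.sum_sub_distrib]
  refine (Finset.abs_sum_le_sum_abs _ _).trans (Finset.sum_le_sum ?_)
  intro S hS
  rw [Finset.mem_powerset] at hS
  set d := ∏ p ∈ S, p with hd
  have hprod : ∀ n, ∏ p ∈ S, (if p ∣ n then (-1 : ℝ) else 0) = if d ∣ n then (-1) ^ S.card else 0 := by
    intro n
    by_cases hdn : d ∣ n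
    · rw [if_pos hdn, ← Finset.prod_const]
      apply Finset.prod_congr rfl
      intro p hp
      rw [if_pos ((Finset.dvd_prod_of_mem _ hp).trans hdn)]
    · rw [if_neg hdn]
      by_contra hne
      apply hdn
      apply Finset.prod_primes_dvd n (fun p hp => (hT p (hS hp)).1.prime)
      intro p hp
      by_contra hpn
      exact hne (Finset.prod_eq_zero hp (if_neg hpn))
  have hd0 : 0 < d := Finset.prod_pos (fun p hp => (hT p (hS hp)).1.pos)
  have hcop : d.Coprime m := by
    apply Nat.Coprime.prod_left
    intro p hp
    exact ((hT p (hS hp)).1.coprime_iff_not_dvd).mpr (hT p (hS hp)).2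
  have hdr : (d : ℝ) = ∏ p ∈ S, (p : ℝ) := by rw [hd]; push_cast; rfl
  have e1 : ∏ p ∈ S, -(1 / (p : ℝ)) = (-1) ^ S.card * (1 / d) := by
    rw [Finset.prod_neg, hdr, Finset.prod_div_distrib, Finset.prod_const_one]
  have e2 : ∏ p ∈ S, (p : ℝ) ^ (ε - 1) = (d : ℝ) ^ (ε - 1) := by
    rw [Real.finsetProd_rpow _ _ (fun _ _ => Nat.cast_nonneg _), hdr]
  have e3 : ∑ n ∈ (Finset.Ioc 0 X).filter (fun n => n % m = a % m),
      ∏ p ∈ S, (if p ∣ n then (-1 : ℝ) else 0) = (-1) ^ S.card *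
        (((Finset.Ioc 0 X).filter (fun n => n % m = a % m ∧ d ∣ n)).card : ℝ) := by
    simp_rw [hprod]
    rw [← Finset.sum_filter, Finset.filter_filter, Finset.sum_const, nsmul_eq_mul, mul_comm]
  rw [e1, e2, e3]
  have := esz_countd X a m d hm hd0 hcop ε h0 h1
  have hd' : (0 : ℝ) < d := by exact_mod_cast hd0
  have e4 : ((X : ℝ) / d) ^ (1 - ε) = (X : ℝ) ^ (1 - ε) * (d : ℝ) ^ (ε - 1) := by
    rw [Real.div_rpow (Nat.cast_nonneg _) hd'.le, div_eq_mul_inv, ← Real.rpow_neg hd'.le, neg_sub]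
  rw [← e4]
  refine le_trans (le_of_eq ?_) this
  have hm' : (m : ℝ) ≠ 0 := by positivity
  have : (-1 : ℝ) ^ S.card * (((Finset.Ioc 0 X).filter (fun n => n % m = a % m ∧ d ∣ n)).card : ℝ) -
    (X : ℝ) / m * ((-1) ^ S.card * (1 / d)) = (-1 : ℝ) ^ S.card *
    ((((Finset.Ioc 0 X).filter (fun n => n % m = a % m ∧ d ∣ n)).card : ℝ) - (X : ℝ) / (m * d)) := by
    field_simp
  rw [this, abs_mul, abs_pow, abs_neg, abs_one, one_pow, one_mul]

lemma esz_Ps_sum (l : ℝ) (hl : 2 ≤ l) : ∑ p ∈ eszPs l, 1 / (p : ℝ) ≤ l + 3 := by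
  set K := ⌈Real.exp l⌉₊ + 1 with hK
  have hsub : eszPs l ⊆ Finset.Icc 1 K := by
    intro p hp
    have hp' := hp
    rw [esz_mem_Ps] at hp
    rw [eszPs, Finset.mem_filter, Finset.mem_range] at hp'
    rw [Finset.mem_Icc]
    exact ⟨hp.1.one_lt.le, hp'.1.le⟩
  have h1 : ∑ p ∈ eszPs l, 1 / (p : ℝ) ≤ ∑ p ∈ Finset.Icc 1 K, 1 / (p : ℝ) :=
    Finset.sum_le_sum_of_subset_of_nonneg hsub (fun _ _ _ => by positivity)
  have h2 := harmonic_le_one_add_log K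
  have h3 : ((harmonic K : ℚ) : ℝ) = ∑ p ∈ Finset.Icc 1 K, 1 / (p : ℝ) := by
    rw [harmonic_eq_sum_Icc]
    push_cast
    simp
  have hep : 3 ≤ Real.exp l := by linarith [Real.add_one_le_exp l]
  have h4 : (K : ℝ) ≤ Real.exp (l + 1) := by
    rw [hK, Real.exp_add]
    push_cast
    have := (Nat.ceil_lt_add_one (Real.exp_pos l).le).le
    have h5 := Real.exp_one_gt_d9
    nlinarith
  have h5 : Real.log K ≤ l + 1 := by
    rw [Real.log_le_iff_le_exp (by rw [hK]; positivity)]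
    exact h4
  linarith

lemma esz_V_le (l : ℝ) (hl : 2 ≤ l) (T : Finset ℕ) (hT : T ⊆ eszPs l) :
    ∏ p ∈ T, ((p : ℝ) / ((p : ℝ) - 1)) ≤ Real.exp (2 * (l + 3)) := by
  have h2 : ∀ p ∈ T, (2 : ℝ) ≤ p := fun p hp => by
    exact_mod_cast ((esz_mem_Ps l p).mp (hT hp)).1.two_le
  calc ∏ p ∈ T, ((p : ℝ) / ((p : ℝ) - 1)) ≤ ∏ p ∈ T, Real.exp (2 * (1 / (p : ℝ))) := by
        apply Finset.prod_le_prod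
        · intro p hp
          have := h2 p hp
          apply div_nonneg <;> linarith
        · intro p hp
          have := h2 p hp
          refine le_trans ?_ (Real.add_one_le_exp _)
          rw [div_le_iff₀ (by linarith)]
          have : (2 * (1 / (p : ℝ)) + 1) * (p - 1) = p + 1 - 2 / p := by field_simp; ring
          rw [this]
          have : 2 / (p : ℝ) ≤ 1 := by rw [div_le_one (by linarith)]; linarith
          linarith
    _ = Real.exp (2 * ∑ p ∈ T, 1 / (p : ℝ)) := by rw [← Real.exp_sum, Finset.mul_sum]
    _ ≤ _ := by
      gcongr
      refine le_trans ?_ (esz_Ps_sum l hl)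
      exact Finset.sum_le_sum_of_subset_of_nonneg hT (fun _ _ _ => by positivity)

lemma esz_E_le (l : ℝ) (hl : 2 ≤ l) (T : Finset ℕ) (hT : T ⊆ eszPs l) :
    ∏ p ∈ T, (1 + (p : ℝ) ^ (1 / l - 1)) ≤ Real.exp (3 * (l + 3)) := by
  calc ∏ p ∈ T, (1 + (p : ℝ) ^ (1 / l - 1)) ≤ ∏ p ∈ T, Real.exp (3 * (1 / (p : ℝ))) := by
        apply Finset.prod_le_prod
        · intro p hp
          positivity
        · intro p hp
          have hp' := (esz_mem_Ps l p).mp (hT hp)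
          have hp0 : (0 : ℝ) < p := by exact_mod_cast hp'.1.pos
          refine le_trans ?_ (Real.add_one_le_exp _)
          rw [add_comm]
          gcongr
          rw [Real.rpow_sub hp0, Real.rpow_one, mul_one_div]
          gcongr
          calc (p : ℝ) ^ (1 / l) ≤ (Real.exp l) ^ (1 / l) := by
                gcongr
                exact hp'.2.le
            _ = Real.exp 1 := by
              rw [← Real.exp_mul]; congr 1; field_simp
            _ ≤ 3 := by linarith [Real.exp_one_lt_d9]
    _ = Real.exp (3 * ∑ p ∈ T, 1 / (p : ℝ)) := by rw [← Real.exp_sum, Finset.mul_sum]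
    _ ≤ _ := by
      gcongr
      refine le_trans ?_ (esz_Ps_sum l hl)
      exact Finset.sum_le_sum_of_subset_of_nonneg hT (fun _ _ _ => by positivity)

lemma esz_cramer_eq (l : ℝ) (n : ℕ) : cramer (Real.exp l) (n : ℤ) =
    ∏ p ∈ eszPs l, (((p : ℝ) / ((p : ℝ) - 1)) * (1 + if p ∣ n then (-1 : ℝ) else 0)) := by
  unfold cramer eszPs
  apply Finset.prod_congr rfl
  intro p _
  by_cases h : p ∣ n
  · rw [if_pos h, if_pos (by exact_mod_cast h)]; simp
  · rw [if_neg h, if_neg (by exact_mod_cast h)]; simp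

lemma esz_cramer_zero (l : ℝ) (n p : ℕ) (hp : p.Prime) (hpl : (p : ℝ) < Real.exp l) (hpn : p ∣ n) :
    cramer (Real.exp l) (n : ℤ) = 0 := by
  rw [esz_cramer_eq]
  apply Finset.prod_eq_zero ((esz_mem_Ps l p).mpr ⟨hp, hpl⟩)
  rw [if_pos hpn]; simp

lemma esz_sieve (l : ℝ) (hl : 2 ≤ l) (X a m : ℕ) (hm : 0 < m) (hX : (X : ℝ) ≤ Real.exp (l ^ 10))
    (hco : ∀ p, p ∈ eszPs l → p ∣ m → ¬ p ∣ a) :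
    |∑ n ∈ (Finset.Ioc 0 X).filter (fun n => n % m = a % m), cramer (Real.exp l) (n : ℤ) -
      (X : ℝ) / m * ∏ p ∈ (eszPs l).filter (fun p => p ∣ m), ((p : ℝ) / ((p : ℝ) - 1))| ≤
      Real.exp (l ^ 10) * Real.exp (-l) := by
  set V1 := ∏ p ∈ (eszPs l).filter (fun p => p ∣ m), ((p : ℝ) / ((p : ℝ) - 1)) with hV1
  set T := (eszPs l).filter (fun p => ¬ p ∣ m) with hTdef
  set V2 := ∏ p ∈ T, ((p : ℝ) / ((p : ℝ) - 1)) with hV2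
  have hTp : ∀ p ∈ T, p.Prime ∧ ¬ p ∣ m := by
    intro p hp
    rw [hTdef, Finset.mem_filter, esz_mem_Ps] at hp
    exact ⟨hp.1.1, hp.2⟩
  have hTs : T ⊆ eszPs l := Finset.filter_subset _ _
  have hl0 : 0 < l := by linarith
  have hcore := esz_sieve_core X a m hm T hTp (1 / l) (by positivity) (by
    rw [div_le_one hl0]; linarith)
  have hc1 : ∀ n ∈ (Finset.Ioc 0 X).filter (fun n => n % m = a % m), cramer (Real.exp l) (n : ℤ) =
      V1 * V2 * ∏ p ∈ T, (1 + if p ∣ n then (-1 : ℝ) else 0) := by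
    intro n hn
    rw [Finset.mem_filter] at hn
    rw [esz_cramer_eq, ← Finset.prod_filter_mul_prod_filter_not (eszPs l) (fun p => p ∣ m),
      mul_assoc V1]
    congr 1
    · rw [hV1]
      apply Finset.prod_congr rfl
      intro p hp
      rw [Finset.mem_filter] at hp
      rw [if_neg]
      · simp
      · intro hpn
        apply hco p hp.1 hp.2
        have h3 : n ≡ a [MOD m] := hn.2
        exact ((h3.of_dvd hp.2).dvd_iff dvd_rfl).mp hpn
    · rw [hV2, ← Finset.prod_mul_distrib]
  rw [Finset.sum_congr rfl hc1, ← Finset.mul_sum]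
  have hmain : V2 * ∏ p ∈ T, (1 + -(1 / (p : ℝ))) = 1 := by
    rw [hV2, ← Finset.prod_mul_distrib]
    apply Finset.prod_eq_one
    intro p hp
    have h2 : (2 : ℝ) ≤ p := by exact_mod_cast (hTp p hp).1.two_le
    have h3 : (p : ℝ) - 1 ≠ 0 := by linarith
    have h4 : (p : ℝ) ≠ 0 := by linarith
    field_simp
    ring
  have e1 : ∀ S : ℝ, V1 * V2 * S - (X : ℝ) / m * V1 = V1 * V2 * (S - (X : ℝ) / m *
      ∏ p ∈ T, (1 + -(1 / (p : ℝ)))) := by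
    intro S
    linear_combination (-(X : ℝ) / m * V1) * (-hmain)
  rw [e1, abs_mul]
  have hVV : V1 * V2 = ∏ p ∈ eszPs l, ((p : ℝ) / ((p : ℝ) - 1)) :=
    Finset.prod_filter_mul_prod_filter_not (eszPs l) (fun p => p ∣ m) _
  have hVV0 : 0 ≤ V1 * V2 := by
    rw [hVV]
    apply Finset.prod_nonneg
    intro p hp
    have : (2 : ℝ) ≤ p := by exact_mod_cast ((esz_mem_Ps l p).mp hp).1.two_le
    apply div_nonneg <;> linarith
  have hVVle : V1 * V2 ≤ Real.exp (2 * (l + 3)) := hVV ▸ esz_V_le l hl _ (Finset.Subset.refl _)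
  have hXle : (X : ℝ) ^ (1 - 1 / l) ≤ Real.exp (l ^ 10 - l ^ 9) := by
    have h5 : 1 / l ≤ 1 := by rw [div_le_one hl0]; linarith
    calc (X : ℝ) ^ (1 - 1 / l) ≤ (Real.exp (l ^ 10)) ^ (1 - 1 / l) :=
          Real.rpow_le_rpow (Nat.cast_nonneg _) hX (by linarith)
      _ = _ := by
        rw [← Real.exp_mul]; congr 1; field_simp
  have hE := esz_E_le l hl T hTs
  rw [abs_of_nonneg hVV0]
  calc _ ≤ Real.exp (2 * (l + 3)) * (Real.exp (l ^ 10 - l ^ 9) * Real.exp (3 * (l + 3))) := by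
        refine mul_le_mul hVVle (hcore.trans ?_) (abs_nonneg _) (Real.exp_pos _).le
        refine mul_le_mul hXle hE ?_ (Real.exp_pos _).le
        exact Finset.prod_nonneg (fun _ _ => by positivity)
    _ ≤ _ := by
      rw [← Real.exp_add, ← Real.exp_add, ← Real.exp_add]
      apply Real.exp_le_exp.mpr
      have : (2 : ℝ) ^ 8 * l ≤ l ^ 8 * l := by gcongr
      nlinarith

lemma esz_totient (l : ℝ) (m : ℕ) (hm : 0 < m) (hml : (m : ℝ) < Real.exp l) :
    (1 / (m : ℝ)) * ∏ p ∈ (eszPs l).filter (fun p => p ∣ m), ((p : ℝ) / ((p : ℝ) - 1)) =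
      1 / (m.totient : ℝ) := by
  have hs : (eszPs l).filter (fun p => p ∣ m) = m.primeFactors := by
    ext p
    rw [Finset.mem_filter, esz_mem_Ps, Nat.mem_primeFactors]
    constructor
    · exact fun h => ⟨h.1.1, h.2, hm.ne'⟩
    · intro h
      refine ⟨⟨h.1, lt_of_le_of_lt ?_ hml⟩, h.2.1⟩
      exact_mod_cast Nat.le_of_dvd hm h.2.1
  rw [hs]
  have h1 : (m.totient : ℝ) = m * ∏ p ∈ m.primeFactors, (1 - (p : ℝ)⁻¹) := by
    have := congrArg (fun x : ℚ => (x : ℝ)) (Nat.totient_eq_mul_prod_factors m)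
    push_cast at this
    exact this
  have h2 : (∏ p ∈ m.primeFactors, ((p : ℝ) / ((p : ℝ) - 1))) * ∏ p ∈ m.primeFactors, (1 - (p : ℝ)⁻¹)
      = 1 := by
    rw [← Finset.prod_mul_distrib]
    apply Finset.prod_eq_one
    intro p hp
    have h2 : (2 : ℝ) ≤ p := by exact_mod_cast (Nat.prime_of_mem_primeFactors hp).two_le
    have h3 : (p : ℝ) - 1 ≠ 0 := by linarith
    have h4 : (p : ℝ) ≠ 0 := by linarith
    field_simp
  have h3 : (0 : ℝ) < m.totient := by exact_mod_cast Nat.totient_pos.mpr hm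
  have hm' : (0 : ℝ) < m := by exact_mod_cast hm
  rw [eq_div_iff h3.ne', h1]
  have h4 : 1 / (m : ℝ) * m = 1 := by field_simp
  linear_combination h2 + ((∏ p ∈ m.primeFactors, ((p : ℝ) / ((p : ℝ) - 1))) *
    ∏ p ∈ m.primeFactors, (1 - (p : ℝ)⁻¹)) * h4

lemma esz_prod_sqrt (l : ℝ) (m : ℕ) (hm : 0 < m) :
    0 ≤ ∏ p ∈ (eszPs l).filter (fun p => p ∣ m), ((p : ℝ) / ((p : ℝ) - 1)) ∧
    (∏ p ∈ (eszPs l).filter (fun p => p ∣ m), ((p : ℝ) / ((p : ℝ) - 1))) ^ 2 ≤ 2 * m := by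
  set T := (eszPs l).filter (fun p => p ∣ m) with hT
  have hTp : ∀ p ∈ T, p.Prime ∧ p ∣ m := by
    intro p hp
    rw [hT, Finset.mem_filter, esz_mem_Ps] at hp
    exact ⟨hp.1.1, hp.2⟩
  have h2 : ∀ p ∈ T, (2 : ℝ) ≤ p := fun p hp => by exact_mod_cast (hTp p hp).1.two_le
  have hnn : ∀ p ∈ T, 0 ≤ (p : ℝ) / ((p : ℝ) - 1) := fun p hp => by
    have := h2 p hp
    apply div_nonneg <;> linarith
  refine ⟨Finset.prod_nonneg hnn, ?_⟩
  rw [← Finset.prod_pow]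
  calc ∏ p ∈ T, ((p : ℝ) / ((p : ℝ) - 1)) ^ 2 ≤ ∏ p ∈ T, ((if p = 2 then 2 else 1) * (p : ℝ)) := by
        apply Finset.prod_le_prod
        · intro p hp; positivity
        · intro p hp
          have h3 := h2 p hp
          rw [div_pow, div_le_iff₀ (by nlinarith)]
          by_cases hp2 : p = 2
          · rw [hp2]; norm_num
          · rw [if_neg hp2]
            have h4 : (3 : ℝ) ≤ p := by
              have := (hTp p hp).1.two_le
              exact_mod_cast (by omega : 3 ≤ p)
            have : (p : ℝ) ≤ (p - 1) ^ 2 := by nlinarith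
            nlinarith
    _ = (∏ p ∈ T, (if p = 2 then (2 : ℝ) else 1)) * ∏ p ∈ T, (p : ℝ) := Finset.prod_mul_distrib
    _ ≤ 2 * m := by
      gcongr
      · rw [Finset.prod_ite_eq']
        split_ifs <;> norm_num
      · have : ∏ p ∈ T, p ∣ m := Finset.prod_primes_dvd m (fun p hp => (hTp p hp).1.prime)
          (fun p hp => (hTp p hp).2)
        have h5 := Nat.le_of_dvd hm this
        have h6 : ((∏ p ∈ T, p : ℕ) : ℝ) ≤ m := by exact_mod_cast h5
        rwa [Nat.cast_prod] at h6


lemma esz_orth (m : ℕ) [NeZero m] (a : ℕ) (ha : a.Coprime m) (f : ℕ → ℂ) (s : Finset ℕ)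
    (y : DirichletCharacter ℂ m → ℂ) (B : ℝ)
    (hB : ∀ χ : DirichletCharacter ℂ m, ‖∑ n ∈ s, χ (n : ZMod m) * f n - y χ‖ ≤ B) :
    ‖(m.totient : ℂ) * ∑ n ∈ s.filter (fun n => n % m = a % m), f n -
      ∑ χ : DirichletCharacter ℂ m, χ ((a : ZMod m)⁻¹) * y χ‖ ≤ m.totient * B := by
  have hu : IsUnit (a : ZMod m) := (ZMod.isUnit_iff_coprime a m).mpr ha
  have h1 : (m.totient : ℂ) * ∑ n ∈ s.filter (fun n => n % m = a % m), f n =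
      ∑ χ : DirichletCharacter ℂ m, χ ((a : ZMod m)⁻¹) * ∑ n ∈ s, χ (n : ZMod m) * f n := by
    simp_rw [Finset.mul_sum]
    rw [Finset.sum_comm, Finset.sum_filter]
    apply Finset.sum_congr rfl
    intro n _
    simp_rw [← mul_assoc]
    rw [← Finset.sum_mul, DirichletCharacter.sum_char_inv_mul_char_eq ℂ hu (n : ZMod m)]
    have hiff := ZMod.natCast_eq_natCast_iff' a n m
    by_cases h : n % m = a % m
    · rw [if_pos h, if_pos (hiff.mpr h.symm)]
    · rw [if_neg h, if_neg (fun h' => h (hiff.mp h').symm), zero_mul]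
  rw [h1, ← Finset.sum_sub_distrib]
  refine (norm_sum_le _ _).trans ?_
  have h2 : ∀ χ ∈ (Finset.univ : Finset (DirichletCharacter ℂ m)),
      ‖χ ((a : ZMod m)⁻¹) * ∑ n ∈ s, χ (n : ZMod m) * f n - χ ((a : ZMod m)⁻¹) * y χ‖ ≤ B := by
    intro χ _
    rw [← mul_sub, norm_mul]
    have := DirichletCharacter.norm_le_one χ ((a : ZMod m)⁻¹)
    exact (mul_le_of_le_one_left (norm_nonneg _) this).trans (hB χ)
  refine (Finset.sum_le_card_nsmul _ _ _ h2).trans (le_of_eq ?_)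
  rw [nsmul_eq_mul, Finset.card_univ, ← Nat.card_eq_fintype_card,
    DirichletCharacter.card_eq_totient_of_hasEnoughRootsOfUnity]

lemma esz_orth0 (m : ℕ) [NeZero m] (a : ℕ) (ha : a.Coprime m) (f : ℕ → ℂ) (s : Finset ℕ) (B : ℝ)
    (hB : ∀ χ : DirichletCharacter ℂ m, ‖∑ n ∈ s, χ (n : ZMod m) * f n‖ ≤ B) :
    ‖∑ n ∈ s.filter (fun n => n % m = a % m), f n‖ ≤ B := by
  have h := esz_orth m a ha f s (fun _ => 0) B (by simpa using hB)
  simp only [mul_zero, Finset.sum_const_zero, sub_zero, norm_mul, Complex.norm_natCast] at h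
  have : (0 : ℝ) < m.totient := by
    exact_mod_cast Nat.totient_pos.mpr (Nat.pos_of_ne_zero (NeZero.ne m))
  exact le_of_mul_le_mul_left h this

lemma esz_IccIoc (X : ℕ) : Finset.Icc 1 ⌊(X : ℝ)⌋₊ = Finset.Ioc 0 X := by
  rw [Nat.floor_natCast]; rfl

open ArithmeticFunction in
lemma esz_La_prime (X p : ℕ) (hp : p.Prime) :
    ∑ n ∈ (Finset.Ioc 0 X).filter (fun n => p ∣ n), vonMangoldt n ≤ Real.log X := by
  rcases Nat.eq_zero_or_pos X with rfl | hX
  · simp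
  have hsub : ((Finset.Ioc 0 X).filter (fun n => p ∣ n)).filter (fun n => vonMangoldt n ≠ 0) ⊆
      (Finset.Icc 1 (Nat.log p X)).image (fun k => p ^ k) := by
    intro n hn
    rw [Finset.mem_filter, Finset.mem_filter, Finset.mem_Ioc] at hn
    obtain ⟨⟨⟨hn0, hnX⟩, hpn⟩, hL⟩ := hn
    rw [vonMangoldt_ne_zero_iff, isPrimePow_nat_iff] at hL
    obtain ⟨q, k, hq, hk, rfl⟩ := hL
    have hpq : p = q := (Nat.prime_dvd_prime_iff_eq hp hq).mp (hp.dvd_of_dvd_pow hpn)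
    subst hpq
    rw [Finset.mem_image]
    refine ⟨k, ?_, rfl⟩
    rw [Finset.mem_Icc]
    exact ⟨hk, Nat.le_log_of_pow_le hp.one_lt hnX⟩
  rw [← Finset.sum_filter_ne_zero]
  calc _ ≤ ∑ n ∈ (Finset.Icc 1 (Nat.log p X)).image (fun k => p ^ k), vonMangoldt n :=
        Finset.sum_le_sum_of_subset_of_nonneg hsub (fun _ _ _ => vonMangoldt_nonneg)
    _ = ∑ k ∈ Finset.Icc 1 (Nat.log p X), vonMangoldt (p ^ k) := by
      apply Finset.sum_image
      intro i _ j _ hij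
      exact Nat.pow_right_injective hp.two_le hij
    _ = ∑ k ∈ Finset.Icc 1 (Nat.log p X), Real.log p := by
      apply Finset.sum_congr rfl
      intro k hk
      rw [Finset.mem_Icc] at hk
      rw [vonMangoldt_apply_pow (by omega), vonMangoldt_apply_prime hp]
    _ = Nat.log p X * Real.log p := by rw [Finset.sum_const, nsmul_eq_mul]; simp
    _ = Real.log ((p ^ Nat.log p X : ℕ) : ℝ) := by push_cast; rw [Real.log_pow]
    _ ≤ Real.log X := by
      apply Real.log_le_log
      · exact_mod_cast pow_pos hp.pos _
      · exact_mod_cast Nat.pow_log_le_self p hX.ne'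

open ArithmeticFunction in
lemma esz_La_noncop (X m : ℕ) (hm : 0 < m) :
    ∑ n ∈ (Finset.Ioc 0 X).filter (fun n => ¬ n.Coprime m), vonMangoldt n ≤ m * Real.log X := by
  have hlog : 0 ≤ Real.log X := Real.log_natCast_nonneg X
  have hite : ∀ (n p : ℕ), 0 ≤ if p ∣ n then vonMangoldt n else 0 := by
    intro n p
    split_ifs
    · exact vonMangoldt_nonneg
    · exact le_rfl
  calc _ ≤ ∑ n ∈ (Finset.Ioc 0 X).filter (fun n => ¬ n.Coprime m),
          ∑ p ∈ m.primeFactors, (if p ∣ n then vonMangoldt n else 0) := by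
        apply Finset.sum_le_sum
        intro n hn
        rw [Finset.mem_filter, Nat.Prime.not_coprime_iff_dvd] at hn
        obtain ⟨hn, p, hp, hpn, hpm⟩ := hn
        have h1 := Finset.single_le_sum (f := fun p => if p ∣ n then vonMangoldt n else 0)
          (fun p _ => hite n p) (Nat.mem_primeFactors.mpr ⟨hp, hpm, hm.ne'⟩)
        simpa [hpn] using h1
    _ ≤ ∑ n ∈ Finset.Ioc 0 X, ∑ p ∈ m.primeFactors, (if p ∣ n then vonMangoldt n else 0) :=
        Finset.sum_le_sum_of_subset_of_nonneg (Finset.filter_subset _ _)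
          (fun n _ _ => Finset.sum_nonneg (fun p _ => hite n p))
    _ = ∑ p ∈ m.primeFactors, ∑ n ∈ (Finset.Ioc 0 X).filter (fun n => p ∣ n), vonMangoldt n := by
        rw [Finset.sum_comm]
        simp_rw [Finset.sum_filter]
    _ ≤ ∑ p ∈ m.primeFactors, Real.log X :=
        Finset.sum_le_sum (fun p hp => esz_La_prime X p (Nat.prime_of_mem_primeFactors hp))
    _ = m.primeFactors.card * Real.log X := by rw [Finset.sum_const, nsmul_eq_mul]
    _ ≤ _ := by
      gcongr
      have h1 : m.primeFactors ⊆ Finset.Icc 1 m := fun p hp => by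
        rw [Finset.mem_Icc]
        exact ⟨(Nat.prime_of_mem_primeFactors hp).one_lt.le, Nat.le_of_mem_primeFactors hp⟩
      have := Finset.card_le_card h1
      simpa using this

open ArithmeticFunction in
/-- Reduction of Möbius sums over a progression to coprime classes. -/
lemma esz_mu_red (m : ℕ) (hm : 0 < m) (a X : ℕ) (B : ℝ)
    (hB : ∀ b Y : ℕ, b.Coprime m → Y ≤ X →
      |∑ n ∈ (Finset.Ioc 0 Y).filter (fun n => n % m = b % m), ((moebius n : ℤ) : ℝ)| ≤ B) (hB0 : 0 ≤ B) :
    |∑ n ∈ (Finset.Ioc 0 X).filter (fun n => n % m = a % m), ((moebius n : ℤ) : ℝ)| ≤ m * B := by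
  set g := Nat.gcd a m with hg
  have hg0 : 0 < g := Nat.gcd_pos_of_pos_right a hm
  have hgm : g ∣ m := Nat.gcd_dvd_right a m
  have hga : g ∣ a := Nat.gcd_dvd_left a m
  set Y := X / g with hY
  have hgn : ∀ n, n % m = a % m → g = Nat.gcd n m := by
    intro n hn
    have h3 : n ≡ a [MOD m] := hn
    rw [hg]; exact (h3.gcd_eq).symm
  have himg : (Finset.Ioc 0 X).filter (fun n => n % m = a % m) =
      ((Finset.Ioc 0 Y).filter (fun k => (g * k) % m = a % m)).image (fun k => g * k) := by
    ext n
    rw [Finset.mem_filter, Finset.mem_Ioc, Finset.mem_image]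
    constructor
    · rintro ⟨⟨h0, hX⟩, hn⟩
      have : g ∣ n := by rw [hgn n hn]; exact Nat.gcd_dvd_left n m
      obtain ⟨k, rfl⟩ := this
      refine ⟨k, ?_, rfl⟩
      rw [Finset.mem_filter, Finset.mem_Ioc]
      refine ⟨⟨Nat.pos_of_mul_pos_left h0, ?_⟩, hn⟩
      rw [hY, Nat.le_div_iff_mul_le hg0, mul_comm]; exact hX
    · rintro ⟨k, hk, rfl⟩
      rw [Finset.mem_filter, Finset.mem_Ioc, hY, Nat.le_div_iff_mul_le hg0, mul_comm] at hk
      exact ⟨⟨Nat.mul_pos hg0 hk.1.1, hk.1.2⟩, hk.2⟩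
  rw [himg, Finset.sum_image (fun i _ j _ hij => Nat.eq_of_mul_eq_mul_left hg0 hij)]
  have hsplit := Finset.sum_fiberwise_of_maps_to
    (s := (Finset.Ioc 0 Y).filter (fun k => (g * k) % m = a % m)) (t := Finset.range m)
    (g := fun k => k % m) (fun k _ => Finset.mem_range.mpr (Nat.mod_lt k hm))
    (fun k => ((moebius (g * k) : ℤ) : ℝ))
  rw [← hsplit]
  refine (Finset.abs_sum_le_sum_abs _ _).trans ?_
  have hb : ∀ b ∈ Finset.range m, |∑ k ∈ ((Finset.Ioc 0 Y).filter (fun k => (g * k) % m = a % m)).filter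
      (fun k => k % m = b), ((moebius (g * k) : ℤ) : ℝ)| ≤ B := by
    intro b hb
    rw [Finset.mem_range] at hb
    by_cases hcond : (g * b) % m = a % m ∧ g.Coprime b
    · obtain ⟨hc1, hc2⟩ := hcond
      have hbm : b.Coprime m := by
        obtain ⟨m', hm'⟩ := hgm
        have h1 : Nat.gcd (g * b) (g * m') = g := by rw [← hm']; exact (hgn _ hc1).symm
        rw [Nat.gcd_mul_left] at h1
        have h2 : Nat.gcd b m' = 1 := by
          have : g * Nat.gcd b m' = g * 1 := by rw [h1, mul_one]
          exact Nat.eq_of_mul_eq_mul_left hg0 this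
        rw [hm']
        exact Nat.Coprime.mul_right hc2.symm h2
      have hset : ((Finset.Ioc 0 Y).filter (fun k => (g * k) % m = a % m)).filter
          (fun k => k % m = b) = (Finset.Ioc 0 Y).filter (fun k => k % m = b % m) := by
        rw [Finset.filter_filter]
        apply Finset.filter_congr
        intro k _
        rw [Nat.mod_eq_of_lt hb]
        constructor
        · exact fun h => h.2
        · intro h
          refine ⟨?_, h⟩
          rw [← hc1, Nat.mul_mod, h, Nat.mul_mod g b, Nat.mod_eq_of_lt hb]
      rw [hset]
      have hmul : ∀ k ∈ (Finset.Ioc 0 Y).filter (fun k => k % m = b % m),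
          ((moebius (g * k) : ℤ) : ℝ) = ((moebius g : ℤ) : ℝ) * ((moebius k : ℤ) : ℝ) := by
        intro k hk
        rw [Finset.mem_filter] at hk
        have h3 : k ≡ b [MOD m] := hk.2
        have h4 : g.Coprime k := by
          have := (h3.of_dvd hgm).gcd_eq
          rw [Nat.Coprime, Nat.gcd_comm, this, Nat.gcd_comm]; exact hc2
        rw [isMultiplicative_moebius.map_mul_of_coprime h4]
        push_cast; rfl
      rw [Finset.sum_congr rfl hmul, ← Finset.mul_sum, abs_mul]
      have h5 : |((moebius g : ℤ) : ℝ)| ≤ 1 := by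
        exact_mod_cast abs_moebius_le_one (n := g)
      exact (mul_le_of_le_one_left (abs_nonneg _) h5).trans (hB b Y hbm (Nat.div_le_self _ _))
    · rw [Finset.sum_eq_zero]
      · simpa using hB0
      · intro k hk
        rw [Finset.mem_filter, Finset.mem_filter] at hk
        obtain ⟨⟨_, hk1⟩, hk2⟩ := hk
        have h3 : k ≡ b [MOD m] := by rw [Nat.ModEq, hk2, Nat.mod_eq_of_lt hb]
        have h6 : (g * b) % m = a % m := by
          rw [← hk1]; exact (h3.mul_left g).symm
        have h7 : ¬ g.Coprime b := fun h => hcond ⟨h6, h⟩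
        have h8 : ¬ g.Coprime k := by
          have := (h3.of_dvd hgm).gcd_eq
          intro h; apply h7
          rw [Nat.Coprime, Nat.gcd_comm, ← this, Nat.gcd_comm]; exact h
        have h9 : moebius (g * k) = 0 := by
          apply moebius_eq_zero_of_not_squarefree
          intro hsq
          exact h8 (Nat.coprime_of_squarefree_mul hsq)
        rw [h9]; simp
  refine (Finset.sum_le_card_nsmul _ _ _ hb).trans (le_of_eq ?_)
  rw [nsmul_eq_mul, Finset.card_range]


lemma esz_one_le_E (l : ℝ) (hl : 2 ≤ l) (k : ℝ) (hk : k ≤ 4) : Real.exp (k * l) ≤ Real.exp (l ^ 10) := by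
  apply Real.exp_le_exp.mpr
  have : (2 : ℝ) ^ 9 * l ≤ l ^ 9 * l := by gcongr
  nlinarith

lemma esz_triv_count (l : ℝ) (hl : 2 ≤ l) (c : ℝ) (hc1 : c ≤ 1) (X a m : ℕ) (hm : 0 < m)
    (hX : (X : ℝ) ≤ Real.exp (l ^ 10)) (hml : Real.exp (c * l) ≤ m) :
    (((Finset.Ioc 0 X).filter (fun n => n % m = a % m)).card : ℝ) ≤
      2 * (Real.exp (l ^ 10) * Real.exp (-c * l)) := by
  have h1 := (abs_le.mp (esz_count X a m hm)).2
  have h2 : (X : ℝ) / m ≤ Real.exp (l ^ 10) * Real.exp (-c * l) := by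
    rw [neg_mul, Real.exp_neg, ← div_eq_mul_inv]
    gcongr
  have h3 : 1 ≤ Real.exp (l ^ 10) * Real.exp (-c * l) := by
    rw [neg_mul, Real.exp_neg, ← div_eq_mul_inv, one_le_div (Real.exp_pos _)]
    exact esz_one_le_E l hl c (by linarith)
  linarith

open ArithmeticFunction in
lemma esz_mu_fin : ∃ c C l₀ : ℝ, 0 < c ∧ c ≤ 1 ∧ 1 ≤ C ∧ 2 ≤ l₀ ∧ ∀ l : ℝ, l₀ ≤ l → eszH l →
    ∀ a m X : ℕ, 0 < m → (X : ℝ) ≤ Real.exp (l ^ 10) →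
    |∑ n ∈ (Finset.Ioc 0 X).filter (fun n => n % m = a % m), ((moebius n : ℤ) : ℝ)| ≤
      C * (Real.exp (l ^ 10) * Real.exp (-c * l)) := by
  obtain ⟨c, C, l₀, hc, hc1, hC, hl₀, hmu⟩ := esz_mu_sum
  refine ⟨c / 6, C + 2, l₀, by positivity, by linarith, by linarith, hl₀, ?_⟩
  intro l hl hH a m X hm hX
  have hl2 : 2 ≤ l := hl₀.trans hl
  have hE : 0 < Real.exp (l ^ 10) * Real.exp (-(c / 6) * l) := by positivity
  have hcl : c * l ≤ l := mul_le_of_le_one_left (by linarith) hc1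
  have hcl0 : 0 ≤ c * l := by positivity
  have hCE : 0 ≤ C * (Real.exp (l ^ 10) * Real.exp (-(c / 6) * l)) := by positivity
  rcases lt_or_ge (m : ℝ) (Real.exp (c / 6 * l)) with h | h
  · haveI : NeZero m := ⟨hm.ne'⟩
    have hml : (m : ℝ) < Real.exp l := h.trans_le (Real.exp_le_exp.mpr (by linarith))
    have := esz_mu_red m hm a X (C * (m : ℝ) ^ 2 * Real.exp (l ^ 10) * Real.exp (-c * l)) (by
      intro b Y hb hY
      have h1 := esz_orth0 m b hb (fun n => ((moebius n : ℤ) : ℂ)) (Finset.Ioc 0 Y)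
        (C * (m : ℝ) ^ 2 * Real.exp (l ^ 10) * Real.exp (-c * l)) (by
          intro χ
          have h2 := hmu l hl hH m χ hml (Y : ℝ) (le_trans (by exact_mod_cast hY) hX)
          rwa [esz_IccIoc] at h2)
      rw [← Real.norm_eq_abs, ← Complex.norm_real]
      push_cast
      exact h1) (by positivity)
    refine this.trans ?_
    have h3 : (m : ℝ) ^ 3 ≤ Real.exp (c / 2 * l) := by
      calc (m : ℝ) ^ 3 ≤ (Real.exp (c / 6 * l)) ^ 3 := by gcongr
        _ = _ := by rw [← Real.exp_nat_mul]; congr 1; push_cast; ring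
    calc (m : ℝ) * (C * (m : ℝ) ^ 2 * Real.exp (l ^ 10) * Real.exp (-c * l)) =
          C * Real.exp (l ^ 10) * ((m : ℝ) ^ 3 * Real.exp (-c * l)) := by ring
      _ ≤ C * Real.exp (l ^ 10) * (Real.exp (c / 2 * l) * Real.exp (-c * l)) := by gcongr
      _ ≤ C * Real.exp (l ^ 10) * Real.exp (-(c / 6) * l) := by
        rw [← Real.exp_add (c / 2 * l)]
        gcongr
        linarith
      _ ≤ _ := by linarith
  · refine (Finset.abs_sum_le_sum_abs _ _).trans ?_
    have h1 : ∀ n ∈ (Finset.Ioc 0 X).filter (fun n => n % m = a % m), |((moebius n : ℤ) : ℝ)| ≤ 1 := by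
      intro n _
      exact_mod_cast abs_moebius_le_one (n := n)
    refine (Finset.sum_le_card_nsmul _ _ _ h1).trans ?_
    rw [nsmul_eq_mul, mul_one]
    have := esz_triv_count l hl2 (c / 6) (by linarith) X a m hm hX h
    linarith

open ArithmeticFunction in
lemma esz_La_cop : ∃ c C l₀ : ℝ, 0 < c ∧ c ≤ 1 ∧ 1 ≤ C ∧ 2 ≤ l₀ ∧ ∀ l : ℝ, l₀ ≤ l → eszH l →
    ∀ m X : ℕ, 0 < m → (m : ℝ) < Real.exp l → (X : ℝ) ≤ Real.exp (l ^ 10) →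
    (m : ℝ) * Real.log X ≤ C * (Real.exp (l ^ 10) * Real.exp (-c * l)) ∧
    ∀ a : ℕ, a.Coprime m →
    |∑ n ∈ (Finset.Ioc 0 X).filter (fun n => n % m = a % m), vonMangoldt n - X / (m.totient : ℝ)| ≤
      C * (Real.exp (l ^ 10) * Real.exp (-c * l)) := by
  obtain ⟨c1, C1, l1, hc1, hc11, hC1, hl1, hLa⟩ := esz_La_sum
  obtain ⟨c2, C2, l2, hc2, hc21, hC2, hl2, hpsi⟩ := esz_psi_sum
  obtain ⟨C3, hC3, h3⟩ := esz_poly_exp 10 1 one_pos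
  refine ⟨min c1 c2, C1 + C2 + C3, max l1 l2, lt_min hc1 hc2, (min_le_left _ _).trans hc11, by linarith,
    hl1.trans (le_max_left _ _), ?_⟩
  intro l hl hH m X hm hml hX
  have hll1 := (le_max_left _ _).trans hl
  have hll2 := (le_max_right _ _).trans hl
  have hl2' : 2 ≤ l := hl1.trans hll1
  set c := min c1 c2 with hc
  have hcc1 : c ≤ c1 := min_le_left _ _
  have hcc2 : c ≤ c2 := min_le_right _ _
  set F := Real.exp (l ^ 10) * Real.exp (-c * l) with hF
  have hF0 : 0 < F := by positivity
  have e1 : C1 * Real.exp (l ^ 10) * Real.exp (-c1 * l) ≤ C1 * F := by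
    rw [hF, ← mul_assoc]; gcongr
  have e2 : C2 * Real.exp (l ^ 10) * Real.exp (-c2 * l) ≤ C2 * F := by
    rw [hF, ← mul_assoc]; gcongr
  have e3 : (m : ℝ) * Real.log X ≤ C3 * F := by
    have hlog : Real.log X ≤ l ^ 10 := by
      rcases Nat.eq_zero_or_pos X with h0 | h0
      · rw [h0]; simp; positivity
      · rw [Real.log_le_iff_le_exp (by exact_mod_cast h0)]; exact hX
    have h4 := h3 l (by linarith)
    calc (m : ℝ) * Real.log X ≤ Real.exp l * (C3 * Real.exp (1 * l)) := by
          refine mul_le_mul hml.le (hlog.trans h4) (Real.log_natCast_nonneg X) (Real.exp_pos _).le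
      _ = C3 * (Real.exp (3 * l) * Real.exp (-l)) := by
        rw [← Real.exp_add, mul_left_comm, ← Real.exp_add]; congr 2; ring
      _ ≤ C3 * (Real.exp (l ^ 10) * Real.exp (-c * l)) := by
        have := esz_one_le_E l hl2' 3 (by norm_num)
        have hcl : c * l ≤ l := mul_le_of_le_one_left (by linarith) (hcc1.trans hc11)
        gcongr
        linarith
  have hBig : C3 * F ≤ (C1 + C2 + C3) * F := by gcongr; linarith
  refine ⟨e3.trans hBig, ?_⟩
  intro a ha
  haveI : NeZero m := ⟨hm.ne'⟩
  have hor := esz_orth m a ha (fun n => ((vonMangoldt n : ℝ) : ℂ)) (Finset.Ioc 0 X)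
    (fun χ => if χ = 1 then (X : ℂ) else 0) ((C1 + C2 + C3) * F) (by
      intro χ
      by_cases hχ : χ = 1
      · rw [if_pos hχ, hχ]
        have h5 : ∑ n ∈ Finset.Ioc 0 X, (1 : DirichletCharacter ℂ m) (n : ZMod m) *
            ((vonMangoldt n : ℝ) : ℂ) - X = ∑ n ∈ Finset.Ioc 0 X, ((vonMangoldt n - 1 : ℝ) : ℂ) -
            ((∑ n ∈ (Finset.Ioc 0 X).filter (fun n => ¬ n.Coprime m), vonMangoldt n : ℝ) : ℂ) := by
          rw [Finset.sum_filter]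
          push_cast
          rw [Finset.sum_sub_distrib, sub_right_comm, ← Finset.sum_sub_distrib]
          congr 1
          · apply Finset.sum_congr rfl
            intro n _
            by_cases hn : n.Coprime m
            · rw [MulChar.one_apply ((ZMod.isUnit_iff_coprime n m).mpr hn)]
              simp [hn]
            · rw [MulChar.map_nonunit _ (fun h => hn ((ZMod.isUnit_iff_coprime n m).mp h))]
              simp [hn]
          · simp
        rw [h5]
        refine (norm_sub_le _ _).trans ?_
        have h6 := hpsi l hll2 (X : ℝ) hX
        rw [esz_IccIoc] at h6
        have h7 := esz_La_noncop X m hm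
        rw [Complex.norm_real, Real.norm_eq_abs, abs_of_nonneg (Finset.sum_nonneg
          (fun _ _ => vonMangoldt_nonneg))]
        have : 0 ≤ C1 * F := by positivity
        linarith
      · rw [if_neg hχ, sub_zero]
        have h6 := hLa l hll1 hH m χ hml hχ (X : ℝ) hX
        rw [esz_IccIoc] at h6
        have : 0 ≤ C2 * F := by positivity
        have : 0 ≤ C3 * F := by positivity
        linarith)
  have hu : IsUnit ((a : ZMod m)⁻¹) := by
    have hu : IsUnit (a : ZMod m) := (ZMod.isUnit_iff_coprime a m).mpr ha
    exact IsUnit.of_mul_eq_one (a : ZMod m) (ZMod.inv_mul_of_unit _ hu)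
  have hsum : ∑ χ : DirichletCharacter ℂ m, χ ((a : ZMod m)⁻¹) * (if χ = 1 then (X : ℂ) else 0) = X := by
    rw [Finset.sum_eq_single 1]
    · rw [if_pos rfl, MulChar.one_apply hu, one_mul]
    · intro χ _ h; rw [if_neg h, mul_zero]
    · simp
  rw [hsum] at hor
  have hφ : (0 : ℝ) < m.totient := by
    exact_mod_cast Nat.totient_pos.mpr hm
  have h8 : ‖((m.totient * ∑ n ∈ (Finset.Ioc 0 X).filter (fun n => n % m = a % m), vonMangoldt n -
      X : ℝ) : ℂ)‖ ≤ m.totient * ((C1 + C2 + C3) * F) := by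
    push_cast
    exact hor
  rw [Complex.norm_real, Real.norm_eq_abs] at h8
  have h9 : ∀ S : ℝ, m.totient * S - X = m.totient * (S - X / m.totient) := by
    intro S; field_simp
  rw [h9, abs_mul, abs_of_pos hφ] at h8
  exact le_of_mul_le_mul_left h8 hφ

open ArithmeticFunction in
lemma esz_La_fin : ∃ c C l₀ : ℝ, 0 < c ∧ c ≤ 1 ∧ 1 ≤ C ∧ 2 ≤ l₀ ∧ ∀ l : ℝ, l₀ ≤ l → eszH l →
    ∀ a m X : ℕ, 0 < m → (X : ℝ) ≤ Real.exp (l ^ 10) →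
    |∑ n ∈ (Finset.Ioc 0 X).filter (fun n => n % m = a % m),
      (vonMangoldt n - cramer (Real.exp l) (n : ℤ))| ≤
      C * (Real.exp (l ^ 10) * Real.exp (-c * l)) := by
  obtain ⟨c, C, l₀, hc, hc1, hC, hl₀, hLa⟩ := esz_La_cop
  obtain ⟨C3, hC3, h3⟩ := esz_poly_exp 10 (1 / 2) (by norm_num)
  refine ⟨c / 2, C + 2 * C3 + 3, l₀, by positivity, by linarith, by linarith, hl₀, ?_⟩
  intro l hl hH a m X hm hX
  have hl2 : 2 ≤ l := hl₀.trans hl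
  set E := Real.exp (l ^ 10) with hE
  have hE0 : 0 < E := Real.exp_pos _
  have hm' : (0 : ℝ) < m := by exact_mod_cast hm
  set F := E * Real.exp (-(c / 2) * l) with hF
  have hF0 : 0 < F := by positivity
  have hcl : c * l ≤ l := mul_le_of_le_one_left (by linarith) hc1
  have hcl0 : 0 ≤ c * l := by positivity
  have f1 : E * Real.exp (-l) ≤ F := by
    rw [hF]; gcongr; linarith
  have f2 : E * Real.exp (-c * l) ≤ F := by
    rw [hF]; gcongr; linarith
  have f3 : E * Real.exp (-(l / 2)) ≤ F := by
    rw [hF]; gcongr; linarith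
  rw [Finset.sum_sub_distrib]
  set SL := ∑ n ∈ (Finset.Ioc 0 X).filter (fun n => n % m = a % m), vonMangoldt n with hSL
  set SC := ∑ n ∈ (Finset.Ioc 0 X).filter (fun n => n % m = a % m), cramer (Real.exp l) (n : ℤ) with hSC
  have hSL0 : 0 ≤ SL := Finset.sum_nonneg (fun _ _ => vonMangoldt_nonneg)
  have hSCzero : ∀ p ∈ eszPs l, p ∣ m → p ∣ a → SC = 0 := by
    intro p hp hpm hpa
    apply Finset.sum_eq_zero
    intro n hn
    rw [Finset.mem_filter] at hn
    have h3 : n ≡ a [MOD m] := hn.2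
    have hp' := (esz_mem_Ps l p).mp hp
    exact esz_cramer_zero l n p hp'.1 hp'.2 (((h3.of_dvd hpm).dvd_iff dvd_rfl).mpr hpa)
  rcases lt_or_ge (m : ℝ) (Real.exp l) with h | h
  · obtain ⟨hA, hB⟩ := hLa l hl hH m X hm h hX
    by_cases ha : a.Coprime m
    · have h1 := hB a ha
      have h2 := esz_sieve l hl2 X a m hm hX (by
        intro p hp hpm hpa
        have hp' := (esz_mem_Ps l p).mp hp
        exact Nat.not_coprime_of_dvd_of_dvd hp'.1.one_lt hpa hpm ha)
      have h4 := esz_totient l m hm h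
      have h5 : (X : ℝ) / m * ∏ p ∈ (eszPs l).filter (fun p => p ∣ m), ((p : ℝ) / ((p : ℝ) - 1)) =
          X / (m.totient : ℝ) := by
        rw [div_eq_mul_one_div (X : ℝ) m, mul_assoc, h4]; ring
      rw [h5] at h2
      rw [abs_le] at h1 h2 ⊢
      have h6 : C * (E * Real.exp (-c * l)) ≤ C * F := by gcongr
      have h7 : 0 ≤ C3 * F := by positivity
      constructor <;> linarith
    · have h1 : SL ≤ m * Real.log X := by
        refine le_trans ?_ (esz_La_noncop X m hm)
        apply Finset.sum_le_sum_of_subset_of_nonneg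
        · intro n hn
          rw [Finset.mem_filter] at hn ⊢
          refine ⟨hn.1, fun hco => ha ?_⟩
          have h3 : n ≡ a [MOD m] := hn.2
          rw [Nat.Coprime, ← h3.gcd_eq]; exact hco
        · exact fun _ _ _ => vonMangoldt_nonneg
      have h2 : SC = 0 := by
        rw [Nat.Prime.not_coprime_iff_dvd] at ha
        obtain ⟨p, hp, hpa, hpm⟩ := ha
        refine hSCzero p ((esz_mem_Ps l p).mpr ⟨hp, lt_of_le_of_lt ?_ h⟩) hpm hpa
        exact_mod_cast Nat.le_of_dvd hm hpm
      rw [h2, sub_zero, abs_of_nonneg hSL0]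
      have h6 : C * (E * Real.exp (-c * l)) ≤ C * F := by gcongr
      have h7 : 0 ≤ C3 * F := by positivity
      linarith
  · have hcard := esz_triv_count l hl2 1 le_rfl X a m hm hX (by rwa [one_mul])
    have hlog : ∀ n ∈ (Finset.Ioc 0 X).filter (fun n => n % m = a % m), vonMangoldt n ≤ l ^ 10 := by
      intro n hn
      rw [Finset.mem_filter, Finset.mem_Ioc] at hn
      refine vonMangoldt_le_log.trans ?_
      rw [Real.log_le_iff_le_exp (by exact_mod_cast hn.1.1)]
      exact le_trans (by exact_mod_cast hn.1.2) hX
    have hSLle : SL ≤ 2 * C3 * F := by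
      have h1 := Finset.sum_le_card_nsmul _ _ _ hlog
      rw [nsmul_eq_mul] at h1
      calc SL ≤ _ := h1
        _ ≤ (2 * (E * Real.exp (-1 * l))) * (C3 * Real.exp (1 / 2 * l)) := by
          have := h3 l (by linarith)
          gcongr
        _ = 2 * C3 * (E * Real.exp (-(l / 2))) := by
          have : Real.exp (-(l / 2)) = Real.exp (-1 * l) * Real.exp (1 / 2 * l) := by
            rw [← Real.exp_add]; congr 1; ring
          rw [this]; ring
        _ ≤ _ := by gcongr
    have hSCle : |SC| ≤ 3 * F := by
      by_cases hex : ∃ p ∈ eszPs l, p ∣ m ∧ p ∣ a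
      · obtain ⟨p, hp, hpm, hpa⟩ := hex
        rw [hSCzero p hp hpm hpa, abs_zero]; positivity
      · push Not at hex
        have h2 := esz_sieve l hl2 X a m hm hX hex
        obtain ⟨hP0, hP2⟩ := esz_prod_sqrt l m hm
        set P := ∏ p ∈ (eszPs l).filter (fun p => p ∣ m), ((p : ℝ) / ((p : ℝ) - 1)) with hP
        have h4 : P / m ≤ 2 * Real.exp (-(l / 2)) := by
          apply le_of_sq_le_sq _ (by positivity)
          have e1 : (Real.exp (-(l / 2))) ^ 2 = Real.exp (-l) := by
            rw [← Real.exp_nat_mul]; congr 1; push_cast; ring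
          rw [mul_pow, e1, div_pow]
          have e2 : 1 / (m : ℝ) ≤ Real.exp (-l) := by
            rw [Real.exp_neg, ← one_div]; gcongr
          calc P ^ 2 / (m : ℝ) ^ 2 ≤ 2 * m / (m : ℝ) ^ 2 := by gcongr
            _ = 2 * (1 / (m : ℝ)) := by field_simp
            _ ≤ 2 * Real.exp (-l) := by gcongr
            _ ≤ _ := by nlinarith [Real.exp_pos (-l)]
        have h5 : (X : ℝ) / m * P ≤ 2 * F := by
          calc (X : ℝ) / m * P = X * (P / m) := by ring
            _ ≤ E * (2 * Real.exp (-(l / 2))) := by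
              gcongr
            _ = 2 * (E * Real.exp (-(l / 2))) := by ring
            _ ≤ 2 * F := by gcongr
        have h6 : 0 ≤ (X : ℝ) / m * P := by positivity
        rw [abs_le] at h2 ⊢
        constructor <;> linarith
    have h7 : 0 ≤ C * F := by positivity
    rw [abs_le] at hSCle ⊢
    constructor <;> linarith

lemma esz_prog (N'' N' : ℝ) (a m : ℕ) (h0 : 0 < N'') (h1 : N'' ≤ N') (f : ℕ → ℝ) :
    ∑ n ∈ progFinset N'' N' a m, f n =
      ∑ n ∈ (Finset.Ioc 0 ⌊N'⌋₊).filter (fun n => n % m = a % m), f n -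
      ∑ n ∈ (Finset.Ioc 0 ⌊N''⌋₊).filter (fun n => n % m = a % m), f n := by
  have hfl : ⌊N''⌋₊ ≤ ⌊N'⌋₊ := Nat.floor_le_floor h1
  have hs : progFinset N'' N' a m = (Finset.Ioc ⌊N''⌋₊ ⌊N'⌋₊).filter (fun n => n % m = a % m) := by
    ext n
    unfold progFinset
    rw [Finset.mem_filter, Finset.mem_filter, Finset.mem_range, Finset.mem_Ioc, Nat.floor_lt h0.le,
      Nat.le_floor_iff (h0.le.trans h1)]
    constructor
    · rintro ⟨_, h2, h3, h4⟩
      exact ⟨⟨h2, h3⟩, h4⟩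
    · rintro ⟨⟨h2, h3⟩, h4⟩
      exact ⟨Nat.lt_succ_of_le (Nat.le_floor h3), h2, h3, h4⟩
  rw [hs, eq_sub_iff_add_eq, add_comm]
  simp_rw [Finset.sum_filter]
  exact Finset.sum_Ioc_consecutive _ (Nat.zero_le _) hfl

theorem equidistribution_without_siegel_zero :
    ∃ c₀ c C : ℝ, 0 < c₀ ∧ 0 < c ∧ 0 < C ∧ ∃ N₀ : ℝ, ∀ N : ℝ, N₀ ≤ N →
      (∀ (q : ℕ) [NeZero q] (χ : DirichletCharacter ℂ q), (q : ℝ) < Qparam N →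
        χ.IsPrimitive → (∀ n : ZMod q, (starRingEnd ℂ) (χ n) = χ n) →
        ∀ β : ℝ, 1 - c₀ / Real.log (Qparam N) < β → β < 1 →
          DirichletCharacter.LFunction χ (β : ℂ) ≠ 0) →
      ∀ a m : ℕ, 1 ≤ m → ∀ N'' N' : ℝ, 0 < N'' → N'' ≤ N' → N' ≤ N →
        |∑ n ∈ progFinset N'' N' a m,
            ((ArithmeticFunction.moebius n : ℝ))|
          ≤ C * N * Real.exp (-c * Real.log N ^ ((1 : ℝ) / 10)) ∧
        |∑ n ∈ progFinset N'' N' a m,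
            (ArithmeticFunction.vonMangoldt n - cramer (Qparam N) (n : ℤ))|
          ≤ C * N * Real.exp (-c * Real.log N ^ ((1 : ℝ) / 10)) := by
  obtain ⟨c1, C1, l1, hc1, hc11, hC1, hl1, hmu⟩ := esz_mu_fin
  obtain ⟨c2, C2, l2, hc2, hc21, hC2, hl2, hLa⟩ := esz_La_fin
  refine ⟨1, min c1 c2, 2 * (C1 + C2), one_pos, lt_min hc1 hc2, by linarith,
    Real.exp ((max l1 l2) ^ 10), ?_⟩
  intro N hN hyp a m hm N'' N' h0 h1 hN'
  set L := max l1 l2 with hL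
  have hL2 : 2 ≤ L := hl1.trans (le_max_left _ _)
  have hN0 : 0 < N := (Real.exp_pos _).trans_le hN
  have hlogN : L ^ 10 ≤ Real.log N := by rwa [Real.le_log_iff_exp_le hN0]
  have hlog0 : 0 ≤ Real.log N := le_trans (by positivity) hlogN
  unfold Qparam at hyp ⊢
  rw [Real.log_exp] at hyp
  set l := Real.log N ^ ((1 : ℝ) / 10) with hl
  have hl10 : l ^ 10 = Real.log N := by
    rw [hl, ← Real.rpow_natCast, ← Real.rpow_mul hlog0]; norm_num
  have hl0 : 0 ≤ l := Real.rpow_nonneg hlog0 _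
  have hLl : L ≤ l := by
    apply le_of_pow_le_pow_left₀ (n := 10) (by norm_num) hl0
    rw [hl10]; exact hlogN
  have hE : Real.exp (l ^ 10) = N := by rw [hl10, Real.exp_log hN0]
  have hH : eszH l := hyp
  have hx1 : (⌊N'⌋₊ : ℝ) ≤ Real.exp (l ^ 10) := by
    rw [hE]; exact (Nat.floor_le (h0.le.trans h1)).trans hN'
  have hx2 : (⌊N''⌋₊ : ℝ) ≤ Real.exp (l ^ 10) := by
    rw [hE]; exact (Nat.floor_le h0.le).trans (h1.trans hN')
  have key : ∀ (f : ℕ → ℝ) (c C : ℝ), min c1 c2 ≤ c → 0 ≤ C → C ≤ C1 + C2 → (∀ X : ℕ,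
      (X : ℝ) ≤ Real.exp (l ^ 10) → |∑ n ∈ (Finset.Ioc 0 X).filter (fun n => n % m = a % m), f n| ≤
        C * (Real.exp (l ^ 10) * Real.exp (-c * l))) →
      |∑ n ∈ progFinset N'' N' a m, f n| ≤ 2 * (C1 + C2) * N * Real.exp (-(min c1 c2) * l) := by
    intro f c C hc hC0 hC hf
    rw [esz_prog N'' N' a m h0 h1]
    have g1 := hf _ hx1
    have g2 := hf _ hx2
    have g3 : C * (Real.exp (l ^ 10) * Real.exp (-c * l)) ≤
        (C1 + C2) * (N * Real.exp (-(min c1 c2) * l)) := by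
      rw [hE]
      have : Real.exp (-c * l) ≤ Real.exp (-(min c1 c2) * l) := by gcongr
      gcongr
    refine (abs_sub _ _).trans ?_
    linarith
  constructor
  · exact key _ c1 C1 (min_le_left _ _) (by linarith) (by linarith)
      (fun X hX => hmu l ((le_max_left _ _).trans hLl) hH a m X hm hX)
  · exact key _ c2 C2 (min_le_right _ _) (by linarith) (by linarith)
      (fun X hX => hLa l ((le_max_right _ _).trans hLl) hH a m X hm hX)
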